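/- arXiv:1302.2745 — 2 statements merged into one kernel-verified Lean document; each statement's English description precedes it below -/
import Mathlib

section
/- Let G be a finitely presented group and N a normal subgroup with G' ≤ N such that the torsion-free rank of G/N equals 2. Then there exists an automorphism μ of G/N for which the N-fibre product H_μ = {(g₁,g₂) ∈ G × G : μ(g₁N) = g₂N} is finitely presented if and only if there exist an element t ∈ G of infinite order and a finitely generated subgroup K with N ≤ K ≤ G such that G = K ⋊ ⟨t⟩ (i.e. G = K⟨t⟩ and K ∩ ⟨t⟩ = 1). -/
/-- A group is finitely presented if it is the quotient of a finitely generated free group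
by the normal closure of finitely many relators. -/
def FinitelyPresentedGroup (G : Type*) [Group G] : Prop :=
  ∃ (n : ℕ) (f : FreeGroup (Fin n) →* G) (S : Finset (FreeGroup (Fin n))),
    Function.Surjective f ∧ f.ker = Subgroup.normalClosure (S : Set (FreeGroup (Fin n)))

/-- The torsion-free rank of the abelianization of `G`, i.e. `rk G/G'`. -/
noncomputable def rkAb (G : Type*) [Group G] : ℕ :=
  Module.finrank ℤ (Additive (Abelianization G))

/-- The torsion-free rank of the quotient `G ⧸ K` (for `K` a normal subgroup). -/
noncomputable def rkQuot {G : Type*} [Group G] (K : Subgroup G) (hK : K.Normal) : ℕ :=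
  letI := hK
  rkAb (G ⧸ K)

/-- The fibre product associated to an isomorphism `μ : G₁⧸N₁ ≃* G₂⧸N₂`. -/
def fibreProduct {G₁ G₂ : Type*} [Group G₁] [Group G₂]
    (N₁ : Subgroup G₁) (N₂ : Subgroup G₂) [N₁.Normal] [N₂.Normal]
    (μ : (G₁ ⧸ N₁) ≃* (G₂ ⧸ N₂)) : Subgroup (G₁ × G₂) where
  carrier := {p | μ (QuotientGroup.mk p.1) = QuotientGroup.mk p.2}
  one_mem' := by simp
  mul_mem' := by
    intro a b ha hb
    simp only [Set.mem_setOf_eq] at *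
    rw [Prod.fst_mul, Prod.snd_mul, QuotientGroup.mk_mul, QuotientGroup.mk_mul, map_mul, ha, hb]
  inv_mem' := by
    intro a ha
    simp only [Set.mem_setOf_eq] at *
    rw [Prod.fst_inv, Prod.snd_inv, QuotientGroup.mk_inv, QuotientGroup.mk_inv, map_inv, ha]

theorem fpg_iff {G : Type*} [Group G] :
    FinitelyPresentedGroup G ↔ Group.IsFinitelyPresented G := by
  constructor
  · rintro ⟨n, f, S, hf, hk⟩
    exact ⟨n, f, hf, ↑S, S.finite_toSet, hk.symm⟩
  · rintro ⟨n, f, hf, S, hS, hk⟩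
    refine ⟨n, f, hS.toFinset, hf, ?_⟩
    rw [hS.coe_toFinset, hk]

theorem ker_fng {A B : Type*} [Group A] [Group B] [hA : Group.FG A]
    [hB : Group.IsFinitelyPresented B] (f : A →* B) (hf : Function.Surjective f) :
    f.ker.IsFinitelyNormallyGenerated := by
  obtain ⟨n, φ, hφ, T, hT, hTk⟩ := hB.out
  obtain ⟨X, hX⟩ := hA.out
  choose l hl using hf
  let σ : FreeGroup (Fin n) →* A := FreeGroup.lift (fun i => l (φ (FreeGroup.of i)))
  have hσ : ∀ w, f (σ w) = φ w := by
    intro w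
    have : f.comp σ = φ := by
      ext i; simp [σ, hl]
    rw [← this]; rfl
  choose m hm using hφ
  let Z : Set A := σ '' T ∪ (fun x => x⁻¹ * σ (m (f x))) '' (X : Set A)
  have hZf : Z.Finite := (hT.image _).union (X.finite_toSet.image _)
  refine ⟨Z, hZf, le_antisymm ?_ ?_⟩
  · apply Subgroup.normalClosure_le_normal
    rintro _ (⟨t, ht, rfl⟩ | ⟨x, hx, rfl⟩)
    · have : t ∈ φ.ker := hTk ▸ Subgroup.subset_normalClosure ht
      simpa [MonoidHom.mem_ker, hσ] using this
    · simp [MonoidHom.mem_ker, hσ, hm]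
  · intro g hg
    have h1 : ∀ g : A, ∃ w, g⁻¹ * σ w ∈ Subgroup.normalClosure Z := by
      intro g
      have hg : g ∈ Subgroup.closure (X : Set A) := by rw [hX]; trivial
      have key : Subgroup.closure (X : Set A) ≤
          ((((QuotientGroup.mk' (Subgroup.normalClosure Z)).comp σ).range).comap
            (QuotientGroup.mk' (Subgroup.normalClosure Z))) := by
        rw [Subgroup.closure_le]
        intro x hx
        refine ⟨m (f x), ?_⟩
        symm
        refine QuotientGroup.eq.2 ?_
        exact Subgroup.subset_normalClosure (Or.inr ⟨x, hx, rfl⟩)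
      obtain ⟨w, hw⟩ := key hg
      exact ⟨w, QuotientGroup.eq.1 hw.symm⟩
    obtain ⟨w, hw⟩ := h1 g
    have hZk : Subgroup.normalClosure Z ≤ f.ker := by
      apply Subgroup.normalClosure_le_normal
      rintro _ (⟨t, ht, rfl⟩ | ⟨x, hx, rfl⟩)
      · have : t ∈ φ.ker := hTk ▸ Subgroup.subset_normalClosure ht
        simpa [MonoidHom.mem_ker, hσ] using this
      · simp [MonoidHom.mem_ker, hσ, hm]
    have h2 : w ∈ φ.ker := by
      have := hZk hw
      rw [MonoidHom.mem_ker] at this hg ⊢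
      simpa [hσ, hg] using this
    rw [← hTk] at h2
    have h3 : Subgroup.normalClosure T ≤ (Subgroup.normalClosure Z).comap σ := by
      apply Subgroup.normalClosure_le_normal
      intro t ht
      exact Subgroup.subset_normalClosure (Or.inl ⟨t, ht, rfl⟩)
    have h4 : σ w ∈ Subgroup.normalClosure Z := h3 h2
    have := (Subgroup.normalClosure Z).mul_mem h4 ((Subgroup.normalClosure Z).inv_mem hw)
    simpa using this

theorem fp_retract {A B : Type*} [Group A] [Group B] [hA : Group.IsFinitelyPresented A]
    [hfg : Group.FG A]
    (r : A →* B) (s : B →* A) (hrs : ∀ b, r (s b) = b) : Group.IsFinitelyPresented B := by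
  obtain ⟨X, hX⟩ := hfg.out
  refine Group.IsFinitelyPresented.of_surjective r (fun b => ⟨s b, hrs b⟩) ?_
  let Z : Set A := (fun x => x⁻¹ * s (r x)) '' (X : Set A)
  refine ⟨Z, X.finite_toSet.image _, le_antisymm ?_ ?_⟩
  · apply Subgroup.normalClosure_le_normal
    rintro _ ⟨x, hx, rfl⟩
    simp [MonoidHom.mem_ker, hrs]
  · have h : (QuotientGroup.mk' (Subgroup.normalClosure Z)) =
        (QuotientGroup.mk' (Subgroup.normalClosure Z)).comp (s.comp r) := by
      apply MonoidHom.eq_of_eqOn_dense hX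
      intro x hx
      refine QuotientGroup.eq.2 ?_
      exact Subgroup.subset_normalClosure ⟨x, hx, rfl⟩
    intro g hg
    have h1 := DFunLike.congr_fun h g
    rw [MonoidHom.mem_ker] at hg
    have h2 : (QuotientGroup.mk' (Subgroup.normalClosure Z)) g = 1 := by
      rw [h1]; simp [hg]
    exact (QuotientGroup.eq_one_iff g).1 h2

theorem fg_of_fp {A : Type*} [Group A] (h : Group.IsFinitelyPresented A) : Group.FG A := by
  obtain ⟨n, φ, hφ, -⟩ := h.out
  exact Group.fg_of_surjective hφ

theorem fp_of_free_fg {A : Type*} [Group A] [IsFreeGroup A] [hfg : Group.FG A] :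
    Group.IsFinitelyPresented A := by
  obtain ⟨X, hX⟩ := hfg.out
  let r : FreeGroup X →* A := FreeGroup.lift (fun x => (x : A))
  have hr : Function.Surjective r := by
    rw [← MonoidHom.range_eq_top, eq_top_iff, ← hX, Subgroup.closure_le]
    intro x hx
    exact ⟨FreeGroup.of ⟨x, hx⟩, by simp [r]⟩
  choose l hl using hr
  let s : A →* FreeGroup X := IsFreeGroup.lift (fun a => l (IsFreeGroup.of a))
  refine fp_retract r s ?_
  intro b
  have : r.comp s = MonoidHom.id A := by
    apply IsFreeGroup.ext_hom
    intro a
    simp [s, hl]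
  exact DFunLike.congr_fun this b

theorem fp_finite_index {A : Type*} [Group A] (hA : Group.IsFinitelyPresented A)
    (B : Subgroup A) [hB : B.FiniteIndex] : Group.IsFinitelyPresented B := by
  obtain ⟨n, φ, hφ, T, hT, hTk⟩ := hA.out
  let FB : Subgroup (FreeGroup (Fin n)) := B.comap φ
  haveI : FB.FiniteIndex := by
    constructor
    rw [Subgroup.index_comap_of_surjective B hφ]
    exact hB.index_ne_zero
  haveI : Group.IsFinitelyPresented FB := fp_of_free_fg
  let ψ : FB →* B := φ.subgroupComap B
  have hψ : ∀ x : FB, ((ψ x : B) : A) = φ (x : FreeGroup (Fin n)) := fun x => rfl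
  have hTker : ∀ t ∈ T, φ t = 1 := by
    intro t ht
    have : t ∈ φ.ker := hTk ▸ Subgroup.subset_normalClosure ht
    exact this
  refine Group.IsFinitelyPresented.of_surjective ψ ?_ ?_
  · rintro ⟨b, hb⟩
    obtain ⟨x, rfl⟩ := hφ b
    exact ⟨⟨x, hb⟩, rfl⟩
  · haveI : Finite (FreeGroup (Fin n) ⧸ FB) := Subgroup.finite_quotient_of_finiteIndex
    let c : (FreeGroup (Fin n) ⧸ FB) → FreeGroup (Fin n) := fun q => q.out
    let Z0 : Set (FreeGroup (Fin n)) :=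
      (fun p : FreeGroup (Fin n) × (FreeGroup (Fin n) ⧸ FB) => (c p.2)⁻¹ * p.1 * c p.2) ''
        (T ×ˢ Set.univ)
    let Z : Set FB := Subtype.val ⁻¹' Z0
    have hZf : Z.Finite := by
      apply Set.Finite.preimage Subtype.val_injective.injOn
      exact (hT.prod Set.finite_univ).image _
    refine ⟨Z, hZf, le_antisymm ?_ ?_⟩
    · apply Subgroup.normalClosure_le_normal
      rintro ⟨x, hx⟩ ⟨⟨t, q⟩, ⟨ht, -⟩, h⟩
      simp only at h
      rw [SetLike.mem_coe, MonoidHom.mem_ker, Subtype.ext_iff, hψ]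
      simp only [← h, map_mul, map_inv, hTker t ht]
      simp
    · -- every conjugate of T lies in the image of normalClosure Z
      intro x hx
      have hx1 : (x : FreeGroup (Fin n)) ∈ φ.ker := by
        rw [MonoidHom.mem_ker] at hx ⊢
        rw [← hψ, hx]; rfl
      rw [← hTk] at hx1
      have key : Subgroup.normalClosure T ≤ (Subgroup.normalClosure Z).map FB.subtype := by
        unfold Subgroup.normalClosure
        rw [Subgroup.closure_le]
        intro g hg
        obtain ⟨t, ht, hc⟩ := Group.mem_conjugatesOfSet_iff.1 hg
        obtain ⟨u, rfl⟩ := isConj_iff.1 hc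
        -- u = f * (c q)⁻¹
        let q : FreeGroup (Fin n) ⧸ FB := QuotientGroup.mk u⁻¹
        have h1 : (c q)⁻¹ * u⁻¹ ∈ FB := QuotientGroup.eq.1 (Quotient.out_eq' q)
        have h2 : (c q)⁻¹ * t * c q ∈ FB := by
          change φ _ ∈ B
          simp [hTker t ht]
        have h3 : (⟨_, h2⟩ : FB) ∈ Subgroup.normalClosure Z :=
          Subgroup.subset_normalClosure ⟨(t, q), ⟨ht, trivial⟩, rfl⟩
        refine ⟨_, Subgroup.normalClosure_normal.conj_mem _ h3 (⟨_, h1⟩ : FB)⁻¹, ?_⟩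
        simp [mul_assoc]
      obtain ⟨y, hy, hyx⟩ := key hx1
      have : y = x := Subtype.ext hyx
      exact this ▸ hy

theorem rel_stable {G : Type*} [Group G] (hG : Group.IsFinitelyPresented G) {ι : Type*} [Finite ι]
    (κ : FreeGroup ι →* G) (t : G) (τ : G →* Multiplicative ℤ)
    (hτt : τ t = Multiplicative.ofAdd 1) (hκ : κ.range = τ.ker)
    (θp θm : FreeGroup ι →* FreeGroup ι)
    (hp : ∀ w, κ (θp w) = t * κ w * t⁻¹) (hm : ∀ w, κ (θm w) = t⁻¹ * κ w * t) :
    ∃ S : Set (FreeGroup ι), S.Finite ∧ (∀ s ∈ S, κ s = 1) ∧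
      ∀ R : Subgroup (FreeGroup ι), R.Normal → S ⊆ R → (∀ w ∈ R, θp w ∈ R) →
        (∀ w ∈ R, θm w ∈ R) → κ.ker ≤ R := by
  classical
  let S0 : Set (FreeGroup ι) := Set.range (fun i => (θp (θm (FreeGroup.of i)))⁻¹ * FreeGroup.of i) ∪
    Set.range (fun i => (θm (θp (FreeGroup.of i)))⁻¹ * FreeGroup.of i)
  have hS0f : S0.Finite := (Set.finite_range _).union (Set.finite_range _)
  have hS0k : ∀ s ∈ S0, κ s = 1 := by
    rintro _ (⟨i, rfl⟩ | ⟨i, rfl⟩) <;> simp [hp, hm, mul_assoc]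
  let F : Set (Subgroup (FreeGroup ι)) := {R | R.Normal ∧ S0 ⊆ R ∧ (∀ w ∈ R, θp w ∈ R) ∧
    (∀ w ∈ R, θm w ∈ R)}
  let R0 : Subgroup (FreeGroup ι) := sInf F
  have hR0m : ∀ w, w ∈ R0 ↔ ∀ R ∈ F, w ∈ R := fun w => Subgroup.mem_sInf
  have hR0n : R0.Normal := by
    constructor
    intro w hw g
    rw [hR0m] at hw ⊢
    intro R hR
    exact hR.1.conj_mem _ (hw R hR) g
  have hR0S : S0 ⊆ R0 := by
    intro s hs
    exact (hR0m s).2 (fun R hR => hR.2.1 hs)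
  have hR0p : ∀ w ∈ R0, θp w ∈ R0 := by
    intro w hw
    exact (hR0m _).2 (fun R hR => hR.2.2.1 _ ((hR0m w).1 hw R hR))
  have hR0q : ∀ w ∈ R0, θm w ∈ R0 := by
    intro w hw
    exact (hR0m _).2 (fun R hR => hR.2.2.2 _ ((hR0m w).1 hw R hR))
  have hR0k : R0 ≤ κ.ker := by
    apply sInf_le
    refine ⟨inferInstance, fun s hs => hS0k s hs, ?_, ?_⟩
    · intro w hw
      rw [MonoidHom.mem_ker] at hw ⊢
      simp [hp, hw]
    · intro w hw
      rw [MonoidHom.mem_ker] at hw ⊢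
      simp [hm, hw]
  let Tp : FreeGroup ι ⧸ R0 →* FreeGroup ι ⧸ R0 := QuotientGroup.map R0 R0 θp hR0p
  let Tm : FreeGroup ι ⧸ R0 →* FreeGroup ι ⧸ R0 := QuotientGroup.map R0 R0 θm hR0q
  have hTp : ∀ w : FreeGroup ι, Tp (w : FreeGroup ι ⧸ R0) = (θp w : FreeGroup ι ⧸ R0) :=
    fun w => rfl
  have hTm : ∀ w : FreeGroup ι, Tm (w : FreeGroup ι ⧸ R0) = (θm w : FreeGroup ι ⧸ R0) :=
    fun w => rfl
  let θ : MulAut (FreeGroup ι ⧸ R0) := MonoidHom.toMulEquiv Tp Tm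
    (by
      apply QuotientGroup.monoidHom_ext
      ext i
      exact QuotientGroup.eq.2 (hR0S (Or.inr ⟨i, rfl⟩)))
    (by
      apply QuotientGroup.monoidHom_ext
      ext i
      exact QuotientGroup.eq.2 (hR0S (Or.inl ⟨i, rfl⟩)))
  have hθ : ∀ w : FreeGroup ι, θ (w : FreeGroup ι ⧸ R0) = (θp w : FreeGroup ι ⧸ R0) :=
    fun w => rfl
  have hθi : ∀ w : FreeGroup ι, θ⁻¹ (w : FreeGroup ι ⧸ R0) = (θm w : FreeGroup ι ⧸ R0) :=
    fun w => rfl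
  let φ : Multiplicative ℤ →* MulAut (FreeGroup ι ⧸ R0) := zpowersHom _ θ
  let κ0 : FreeGroup ι ⧸ R0 →* G := QuotientGroup.lift R0 κ (fun w hw => hR0k hw)
  let tt : Multiplicative ℤ →* G := zpowersHom _ t
  have hφ1 : φ (Multiplicative.ofAdd 1) = θ := by simp [φ]
  have htt1 : tt (Multiplicative.ofAdd 1) = t := by simp [tt]
  have hcomp : ∀ g, κ0.comp (φ g).toMonoidHom = (MulAut.conj (tt g)).toMonoidHom.comp κ0 := by
    -- the set of good g is a subgroup
    let U : Subgroup (Multiplicative ℤ) :=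
      { carrier := {g | ∀ x, κ0 (φ g x) = tt g * κ0 x * (tt g)⁻¹}
        one_mem' := by intro x; simp
        mul_mem' := by
          intro a b ha hb x
          rw [map_mul, map_mul, MulAut.mul_apply, ha, hb]; group
        inv_mem' := by
          intro a ha x
          have := ha (φ a⁻¹ x)
          rw [← MulAut.mul_apply, ← map_mul, mul_inv_cancel, map_one, MulAut.one_apply] at this
          rw [this, map_inv tt]; group }
    have h1 : Multiplicative.ofAdd (1:ℤ) ∈ U := by
      intro x
      induction x using QuotientGroup.induction_on with
      | H w =>
        rw [hφ1, hθ, htt1]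
        exact hp w
    intro g
    have hg : g ∈ U := by
      have := U.zpow_mem h1 (Multiplicative.toAdd g)
      rwa [← ofAdd_zsmul, smul_eq_mul, mul_one, ofAdd_toAdd] at this
    exact MonoidHom.ext hg
  let Φ : (FreeGroup ι ⧸ R0) ⋊[φ] Multiplicative ℤ →* G := SemidirectProduct.lift κ0 tt hcomp
  have hΦl : ∀ x, Φ (SemidirectProduct.inl x) = κ0 x := fun x => SemidirectProduct.lift_inl _ _ _ _
  have hΦr : ∀ x, Φ (SemidirectProduct.inr x) = tt x := fun x => SemidirectProduct.lift_inr _ _ _ _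
  have hτκ : ∀ w, τ (κ w) = 1 := by
    intro w
    have : κ w ∈ τ.ker := hκ ▸ ⟨w, rfl⟩
    exact this
  have hττ : ∀ m, τ (tt m) = m := by
    intro m
    simp only [tt, zpowersHom_apply, map_zpow, hτt]
    rw [← ofAdd_zsmul, smul_eq_mul, mul_one, ofAdd_toAdd]
  have hΦs : Function.Surjective Φ := by
    intro g
    have : g * (tt (τ g))⁻¹ ∈ κ.range := by
      rw [hκ, MonoidHom.mem_ker, map_mul, map_inv, hττ, mul_inv_cancel]
    obtain ⟨w, hw⟩ := this
    refine ⟨SemidirectProduct.inl (w : FreeGroup ι ⧸ R0) * SemidirectProduct.inr (τ g), ?_⟩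
    rw [map_mul, hΦl, hΦr]
    change κ w * _ = _
    rw [hw]; group
  have hfg : Group.FG ((FreeGroup ι ⧸ R0) ⋊[φ] Multiplicative ℤ) := by
    -- surjection from a free group
    let Ψ : FreeGroup (Option ι) →* (FreeGroup ι ⧸ R0) ⋊[φ] Multiplicative ℤ :=
      FreeGroup.lift (fun o => o.elim (SemidirectProduct.inr (Multiplicative.ofAdd 1))
        (fun i => SemidirectProduct.inl ((FreeGroup.of i : FreeGroup ι) : FreeGroup ι ⧸ R0)))
    have hl : ∀ x : FreeGroup ι ⧸ R0, SemidirectProduct.inl x ∈ Ψ.range := by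
      intro x
      induction x using QuotientGroup.induction_on with
      | H w =>
        refine ⟨FreeGroup.map some w, ?_⟩
        have : Ψ.comp (FreeGroup.map some) = SemidirectProduct.inl.comp (QuotientGroup.mk' R0) := by
          ext i <;> simp [Ψ]
        exact DFunLike.congr_fun this w
    have hr : ∀ x : Multiplicative ℤ, SemidirectProduct.inr x ∈ Ψ.range := by
      intro x
      refine ⟨FreeGroup.of none ^ (Multiplicative.toAdd x), ?_⟩
      rw [map_zpow]
      simp only [Ψ, FreeGroup.lift_apply_of, Option.elim]
      rw [← map_zpow, ← ofAdd_zsmul, smul_eq_mul, mul_one, ofAdd_toAdd]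
    have hΨ : Function.Surjective Ψ := by
      intro x
      rw [← SemidirectProduct.inl_left_mul_inr_right x]
      exact Ψ.range.mul_mem (hl _) (hr _)
    exact Group.fg_of_surjective hΨ
  obtain ⟨Z, hZf, hZ⟩ := ker_fng Φ hΦs
  have hkerl : ∀ z ∈ Φ.ker, ∃ w : FreeGroup ι, κ w = 1 ∧
      z = SemidirectProduct.inl (w : FreeGroup ι ⧸ R0) := by
    intro z hz
    rw [MonoidHom.mem_ker, ← SemidirectProduct.inl_left_mul_inr_right z, map_mul, hΦl, hΦr] at hz
    obtain ⟨w, hw⟩ := QuotientGroup.mk_surjective z.left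
    rw [← hw] at hz
    change κ w * _ = _ at hz
    have h1 := congrArg τ hz
    rw [map_mul, hτκ, hττ, one_mul, map_one] at h1
    rw [h1, map_one, mul_one] at hz
    refine ⟨w, hz, ?_⟩
    rw [← SemidirectProduct.inl_left_mul_inr_right z, h1, hw, map_one, mul_one]
  have hZk : ∀ z ∈ Z, z ∈ Φ.ker := by
    intro z hz
    rw [← hZ]; exact Subgroup.subset_normalClosure hz
  choose! W hW1 hW2 using hkerl
  refine ⟨S0 ∪ W '' Z, hS0f.union (hZf.image _), ?_, ?_⟩
  · rintro s (hs | ⟨z, hz, rfl⟩)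
    · exact hS0k s hs
    · exact hW1 z (hZk z hz)
  · intro R hRn hRS hRp hRm
    have hR0R : R0 ≤ R := sInf_le ⟨hRn, fun s hs => hRS (Or.inl hs), hRp, hRm⟩
    let D : Subgroup ((FreeGroup ι ⧸ R0) ⋊[φ] Multiplicative ℤ) :=
      R.map (SemidirectProduct.inl.comp (QuotientGroup.mk' R0))
    have hDl : ∀ w ∈ R, SemidirectProduct.inl (w : FreeGroup ι ⧸ R0) ∈ D :=
      fun w hw => ⟨w, hw, rfl⟩
    have hDn : D.Normal := by
      let V : Subgroup ((FreeGroup ι ⧸ R0) ⋊[φ] Multiplicative ℤ) :=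
        { carrier := {g | (∀ d ∈ D, g * d * g⁻¹ ∈ D) ∧ (∀ d ∈ D, g⁻¹ * d * g ∈ D)}
          one_mem' := by constructor <;> intro d hd <;> simpa using hd
          mul_mem' := by
            intro a b ha hb
            constructor
            · intro d hd
              have := ha.1 _ (hb.1 _ hd)
              simpa [mul_assoc] using this
            · intro d hd
              have := hb.2 _ (ha.2 _ hd)
              simpa [mul_assoc] using this
          inv_mem' := by
            intro a ha
            exact ⟨by simpa using ha.2, by simpa using ha.1⟩ }
      have hVl : ∀ x : FreeGroup ι ⧸ R0, SemidirectProduct.inl x ∈ V := by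
        intro x
        induction x using QuotientGroup.induction_on with
        | H w =>
          constructor
          · rintro _ ⟨d, hd, rfl⟩
            exact ⟨w * d * w⁻¹, hRn.conj_mem d hd w, by simp⟩
          · rintro _ ⟨d, hd, rfl⟩
            refine ⟨w⁻¹ * d * w, ?_, by simp⟩
            simpa using hRn.conj_mem d hd w⁻¹
      have hVr : SemidirectProduct.inr (Multiplicative.ofAdd (1:ℤ)) ∈ V := by
        constructor
        · rintro _ ⟨d, hd, rfl⟩
          refine ⟨θp d, hRp d hd, ?_⟩
          have := SemidirectProduct.inl_aut (φ := φ) (Multiplicative.ofAdd (1:ℤ)) (d : FreeGroup ι ⧸ R0)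
          rw [hφ1, hθ, map_inv] at this
          exact this
        · rintro _ ⟨d, hd, rfl⟩
          refine ⟨θm d, hRm d hd, ?_⟩
          have := SemidirectProduct.inl_aut_inv (φ := φ) (Multiplicative.ofAdd (1:ℤ)) (d : FreeGroup ι ⧸ R0)
          rw [hφ1, hθi, map_inv] at this
          exact this
      constructor
      intro d hd g
      have hg : g ∈ V := by
        rw [← SemidirectProduct.inl_left_mul_inr_right g]
        refine V.mul_mem (hVl _) ?_
        have := V.zpow_mem hVr (Multiplicative.toAdd g.right)
        rwa [← map_zpow, ← ofAdd_zsmul, smul_eq_mul, mul_one, ofAdd_toAdd] at this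
      exact hg.1 d hd
    have hkD : Φ.ker ≤ D := by
      rw [← hZ]
      apply Subgroup.normalClosure_le_normal
      intro z hz
      rw [hW2 z (hZk z hz)]
      exact hDl _ (hRS (Or.inr ⟨z, hz, rfl⟩))
    intro w hw
    have h1 : SemidirectProduct.inl (w : FreeGroup ι ⧸ R0) ∈ Φ.ker := by
      rw [MonoidHom.mem_ker, hΦl]; exact hw
    obtain ⟨r, hr, hrw⟩ := hkD h1
    have h2 : (r : FreeGroup ι ⧸ R0) = (w : FreeGroup ι ⧸ R0) := SemidirectProduct.inl_injective hrw
    have h3 := hR0R (QuotientGroup.eq.1 h2)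
    have := R.mul_mem hr h3
    simpa using this

/-- the distinguished generator -/
def fa (ι : Type*) : FreeGroup (Option ι) := FreeGroup.of none
/-- the other generators -/
def fy {ι : Type*} (j : ι) : FreeGroup (Option ι) := FreeGroup.of (some j)
/-- exponent sum of `fa` -/
def qh (ι : Type*) : FreeGroup (Option ι) →* Multiplicative ℤ :=
  FreeGroup.lift (fun o => o.elim (Multiplicative.ofAdd 1) (fun _ => 1))
/-- generated by conjugates of the `fy j` by powers of `fa` in a window -/
def NF (ι : Type*) (lo hi : ℤ) : Subgroup (FreeGroup (Option ι)) :=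
  Subgroup.closure {x | ∃ (j : ι) (i : ℤ), lo ≤ i ∧ i ≤ hi ∧ x = fa ι ^ i * fy j * fa ι ^ (-i)}

theorem qh_fa (ι : Type*) : qh ι (fa ι) = Multiplicative.ofAdd 1 := by simp [qh, fa]
theorem qh_fy {ι : Type*} (j : ι) : qh ι (fy j) = 1 := by simp [qh, fy]
theorem qh_fa_zpow (ι : Type*) (k : ℤ) : qh ι (fa ι ^ k) = Multiplicative.ofAdd k := by
  rw [map_zpow, qh_fa, ← ofAdd_zsmul, smul_eq_mul, mul_one]

theorem NF_mono {ι : Type*} {l h l' h' : ℤ} (h1 : l' ≤ l) (h2 : h ≤ h') : NF ι l h ≤ NF ι l' h' := by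
  apply Subgroup.closure_mono
  rintro x ⟨j, i, hi, hi', rfl⟩
  exact ⟨j, i, by omega, by omega, rfl⟩

theorem NF_le_ker {ι : Type*} (l h : ℤ) : NF ι l h ≤ (qh ι).ker := by
  rw [NF, Subgroup.closure_le]
  rintro x ⟨j, i, hi, hi', rfl⟩
  simp only [SetLike.mem_coe, MonoidHom.mem_ker, map_mul, qh_fy, qh_fa_zpow]
  simp

theorem NF_gen {ι : Type*} (j : ι) {i l h : ℤ} (h1 : l ≤ i) (h2 : i ≤ h) :
    fa ι ^ i * fy j * fa ι ^ (-i) ∈ NF ι l h :=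
  Subgroup.subset_closure ⟨j, i, h1, h2, rfl⟩

theorem NF_shift {ι : Type*} {l h : ℤ} (k : ℤ) {x} (hx : x ∈ NF ι l h) :
    fa ι ^ k * x * fa ι ^ (-k) ∈ NF ι (l + k) (h + k) := by
  induction hx using Subgroup.closure_induction with
  | mem x hx =>
    obtain ⟨j, i, hi, hi', rfl⟩ := hx
    have := NF_gen (ι := ι) j (i := i + k) (l := l + k) (h := h + k) (by omega) (by omega)
    convert this using 1
    rw [zpow_add, neg_add, zpow_add]; group
  | one => simp
  | mul x y _ _ hx hy =>
    have := Subgroup.mul_mem _ hx hy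
    convert this using 1; group
  | inv x _ hx =>
    have := Subgroup.inv_mem _ hx
    convert this using 1; group

/-- every element is an element of some `NF` times a power of `fa` -/
theorem NF_decomp {ι : Type*} (w : FreeGroup (Option ι)) :
    ∃ (k : ℤ), 0 ≤ k ∧ w * fa ι ^ (-Multiplicative.toAdd (qh ι w)) ∈ NF ι (-k) k := by
  induction w using FreeGroup.induction_on with
  | C1 => exact ⟨0, le_refl _, by simp⟩
  | of o =>
    cases o with
    | none =>
      refine ⟨0, le_refl _, ?_⟩
      change fa ι * fa ι ^ (-Multiplicative.toAdd (qh ι (fa ι))) ∈ _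
      rw [qh_fa]; simp
    | some j =>
      refine ⟨0, le_refl _, ?_⟩
      change fy j * fa ι ^ (-Multiplicative.toAdd (qh ι (fy j))) ∈ _
      rw [qh_fy]
      simpa using NF_gen (ι := ι) j (i := 0) (l := -0) (h := 0) (by omega) (by omega)
  | inv_of o _ =>
    cases o with
    | none =>
      refine ⟨0, le_refl _, ?_⟩
      change (fa ι)⁻¹ * fa ι ^ (-Multiplicative.toAdd (qh ι (fa ι)⁻¹)) ∈ _
      rw [map_inv, qh_fa]; simp
    | some j =>
      refine ⟨0, le_refl _, ?_⟩
      change (fy j)⁻¹ * fa ι ^ (-Multiplicative.toAdd (qh ι (fy j)⁻¹)) ∈ _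
      rw [map_inv, qh_fy]
      simpa using NF_gen (ι := ι) j (i := 0) (l := -0) (h := 0) (by omega) (by omega)
  | mul x y hx hy =>
    obtain ⟨k, hk, hx⟩ := hx
    obtain ⟨l, hl, hy⟩ := hy
    set u := Multiplicative.toAdd (qh ι x)
    set v := Multiplicative.toAdd (qh ι y)
    have h1 := NF_shift u hy
    refine ⟨k + l + |u|, by positivity, ?_⟩
    have hu := neg_abs_le u
    have hu' := le_abs_self u
    have hu0 := abs_nonneg u
    have h2 := Subgroup.mul_mem _ (NF_mono (l' := -(k + l + |u|)) (h' := k + l + |u|) (by omega) (by omega) hx)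
      (NF_mono (l' := -(k + l + |u|)) (h' := k + l + |u|) (by omega) (by omega) h1)
    convert h2 using 1
    rw [map_mul, toAdd_mul]
    change x * y * fa ι ^ (-(u + v)) = _
    rw [neg_add, zpow_add]
    have : fa ι ^ (-u) * fa ι ^ (-v) = fa ι ^ (-v) * fa ι ^ (-u) := by
      rw [← zpow_add, ← zpow_add, add_comm]
    rw [this]; group

theorem NF_of_ker {ι : Type*} {w : FreeGroup (Option ι)} (hw : qh ι w = 1) :
    ∃ k : ℤ, 0 ≤ k ∧ w ∈ NF ι (-k) k := by
  obtain ⟨k, hk, h⟩ := NF_decomp w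
  exact ⟨k, hk, by simpa [hw] using h⟩

structure CoreRel {ι P : Type*} [Group P] (e1 e2 : FreeGroup (Option ι) →* P) (β : P)
    (c n m : ℤ) (Wp Wm : ι → FreeGroup (Option ι)) (E D : FreeGroup (Option ι)) : Prop where
  hn : 2 * c + 1 ≤ n
  hc : 0 ≤ c
  hm : n + 2 * c ≤ m
  hα : e1 (fa ι) = e2 (fa ι)
  hWp : ∀ j, Wp j ∈ NF ι (-c) c
  hWm : ∀ j, Wm j ∈ NF ι (-c) c
  hE : E ∈ NF ι (-c) c
  hD : D ∈ NF ι (-c) c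
  r1p : ∀ j, β * e1 (fy j) * β⁻¹ = e1 (Wp j)
  r1m : ∀ j, β⁻¹ * e1 (fy j) * β = e1 (Wm j)
  r2p : ∀ j, (β * e1 (fa ι) ^ (-n)) * e2 (fy j) * (β * e1 (fa ι) ^ (-n))⁻¹ = e2 (Wp j)
  r2m : ∀ j, (β * e1 (fa ι) ^ (-n))⁻¹ * e2 (fy j) * (β * e1 (fa ι) ^ (-n)) = e2 (Wm j)
  r3p : β * e1 (fa ι) * β⁻¹ = e1 (fa ι) * e1 E * e2 E
  r3m : β⁻¹ * e1 (fa ι) * β = e1 (fa ι) * e1 D * (e1 (fa ι) ^ (-n) * e2 D * e1 (fa ι) ^ n)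
  r5 : ∀ i j (k : ℤ), -m ≤ k → k ≤ m → Commute (e1 (fy i)) (e2 (fa ι ^ k * fy j * fa ι ^ (-k)))

theorem comm_window {ι P : Type*} [Group P] (e1 e2 : FreeGroup (Option ι) →* P)
    (hα : e1 (fa ι) = e2 (fa ι)) (m : ℤ)
    (r5 : ∀ i j (k : ℤ), -m ≤ k → k ≤ m → Commute (e1 (fy i)) (e2 (fa ι ^ k * fy j * fa ι ^ (-k))))
    {l1 h1 l2 h2 : ℤ} (ha : h2 - l1 ≤ m) (hb : -m ≤ l2 - h1) {x y} (hx : x ∈ NF ι l1 h1)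
    (hy : y ∈ NF ι l2 h2) : Commute (e1 x) (e2 y) := by
  induction hx using Subgroup.closure_induction with
  | mem x hx =>
    obtain ⟨i, k, hk, hk', rfl⟩ := hx
    induction hy using Subgroup.closure_induction with
    | mem y hy =>
      obtain ⟨j, l, hl, hl', rfl⟩ := hy
      have h := r5 i j (l - k) (by omega) (by omega)
      have h2 := (Commute.conj_iff (e2 (fa ι) ^ k)).2 h
      convert h2 using 1
      · simp [hα]
      · simp only [map_mul, map_zpow]; group
    | one => simp
    | mul x y _ _ hx hy => rw [map_mul e2]; exact hx.mul_right hy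
    | inv x _ hx => rw [map_inv]; exact hx.inv_right
  | one => simp
  | mul x y _ _ hx hy => rw [map_mul]; exact hx.mul_left hy
  | inv x _ hx => rw [map_inv]; exact hx.inv_left

theorem conj_mem_NF {ι : Type*} {l h : ℤ} {x y : FreeGroup (Option ι)} (hx : x ∈ NF ι l h)
    (hy : y ∈ NF ι l h) : x * y * x⁻¹ ∈ NF ι l h :=
  Subgroup.mul_mem _ (Subgroup.mul_mem _ hx hy) (Subgroup.inv_mem _ hx)

theorem comm_conj_cancel {P : Type*} [Group P] {x y : P} (h : Commute x y) : x * y * x⁻¹ = y := by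
  rw [h.eq, mul_inv_cancel_right]

theorem pow_up {ι P : Type*} [Group P] (e1 e2 : FreeGroup (Option ι) →* P)
    {β : P} {c n m : ℤ} {Wp Wm : ι → FreeGroup (Option ι)} {E D : FreeGroup (Option ι)}
    (H : CoreRel e1 e2 β c n m Wp Wm E D) (k : ℕ) (hk : (k : ℤ) ≤ m + 1)
    {z : FreeGroup (Option ι)} (hz : z ∈ NF ι (-c) c) :
    ∃ z' ∈ NF ι (-c) (k + c),
      (e1 (fa ι) * (e1 (fa ι) ^ n * e1 D * e1 (fa ι) ^ (-n)) * e2 D) ^ k * e2 z *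
        ((e1 (fa ι) * (e1 (fa ι) ^ n * e1 D * e1 (fa ι) ^ (-n)) * e2 D) ^ k)⁻¹ = e2 z' := by
  induction k with
  | zero => exact ⟨z, by simpa using hz, by simp⟩
  | succ k ih =>
    push_cast at hk
    obtain ⟨z', hz', h⟩ := ih (by omega)
    have hc := H.hc
    have hn := H.hn
    have hm := H.hm
    have h1 : D * z' * D⁻¹ ∈ NF ι (-c) (k + c) :=
      conj_mem_NF (NF_mono (by omega) (by omega) H.hD) hz'
    have h2 := NF_shift n H.hD
    have h3 := comm_window e1 e2 H.hα m H.r5 (by omega) (by omega) h2 h1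
    have h4 := NF_shift 1 h1
    refine ⟨_, NF_mono (by omega) (by push_cast; omega) h4, ?_⟩
    rw [pow_succ']
    have h5 := comm_conj_cancel h3
    have : ∀ A B C x y : P, A * y * A⁻¹ = x → (C * A) * y * (C * A)⁻¹ = C * x * C⁻¹ := by
      intro A B C x y h; rw [← h]; group
    rw [this _ 1 _ _ _ h, H.hα]
    rw [H.hα] at *
    simp only [map_mul, map_inv, map_zpow, zpow_one, H.hα] at h5 ⊢
    calc _ = e2 (fa ι) * ((e2 (fa ι) ^ n * e1 D * e2 (fa ι) ^ (-n)) * (e2 D * e2 z' * (e2 D)⁻¹) * (e2 (fa ι) ^ n * e1 D * e2 (fa ι) ^ (-n))⁻¹) * (e2 (fa ι))⁻¹ := by group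
      _ = _ := by rw [h5]; group

theorem pow_down {ι P : Type*} [Group P] (e1 e2 : FreeGroup (Option ι) →* P)
    {β : P} {c n m : ℤ} {Wp Wm : ι → FreeGroup (Option ι)} {E D : FreeGroup (Option ι)}
    (H : CoreRel e1 e2 β c n m Wp Wm E D) (k : ℕ) (hk : (k : ℤ) ≤ m + 1 - n)
    {z : FreeGroup (Option ι)} (hz : z ∈ NF ι (-c) c) :
    ∃ z' ∈ NF ι (-k - c) c,
      ((e1 (fa ι) * e1 E * e2 E) ^ k)⁻¹ * e2 z *
        ((e1 (fa ι) * e1 E * e2 E) ^ k) = e2 z' := by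
  induction k with
  | zero => exact ⟨z, by simpa using hz, by simp⟩
  | succ k ih =>
    push_cast at hk
    obtain ⟨z', hz', h⟩ := ih (by omega)
    have hc := H.hc
    have hn := H.hn
    have hm := H.hm
    have h4 : _ ∈ NF ι (-(k+1) - c) c := NF_mono (by omega) (by omega) (NF_shift (-1) hz')
    have h3 := comm_window e1 e2 H.hα m H.r5 (by omega) (by omega) H.hE h4
    have h1 := conj_mem_NF (Subgroup.inv_mem _ (NF_mono (l' := -(k+1) - c) (h' := c) (by omega) (by omega) H.hE)) h4
    refine ⟨_, NF_mono (by push_cast; omega) (by omega) h1, ?_⟩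
    rw [pow_succ]
    have h5 := comm_conj_cancel h3.inv_left
    have : ∀ A B C x y : P, A⁻¹ * y * A = x → (A * C)⁻¹ * y * (A * C) = C⁻¹ * x * C := by
      intro A B C x y h; rw [← h]; group
    rw [this _ 1 _ _ _ h, H.hα]
    simp only [map_mul, map_inv, zpow_one, neg_neg, inv_inv, zpow_neg] at h5 ⊢
    calc _ = (e2 E)⁻¹ * ((e1 E)⁻¹ * ((e2 (fa ι))⁻¹ * e2 z' * e2 (fa ι)) * e1 E) * e2 E := by group
      _ = _ := by rw [h5]

theorem comm_step {ι P : Type*} [Group P] (e1 e2 : FreeGroup (Option ι) →* P)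
    {β : P} {c n m : ℤ} {Wp Wm : ι → FreeGroup (Option ι)} {E D : FreeGroup (Option ι)}
    (H : CoreRel e1 e2 β c n m Wp Wm E D) : CoreRel e1 e2 β c n (m + 1) Wp Wm E D := by
  have hc := H.hc
  have hn := H.hn
  have hm := H.hm
  refine { H with hm := by omega, r5 := ?_ }
  intro i j k hk1 hk2
  by_cases hA : -m ≤ k ∧ k ≤ m
  · exact H.r5 i j k hA.1 hA.2
  have hm0 : ((m + 1).toNat : ℤ) = m + 1 := Int.toNat_of_nonneg (by omega)
  have hm1 : ((m + 1 - n).toNat : ℤ) = m + 1 - n := Int.toNat_of_nonneg (by omega)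
  have hk : k = m + 1 ∨ k = -(m + 1) := by omega
  rcases hk with rfl | rfl
  · obtain ⟨z', hz', h⟩ := pow_up e1 e2 H (m+1).toNat hm0.le (H.hWm j)
    rw [hm0] at hz'
    rw [← zpow_natCast, hm0] at h
    have h1 := comm_window e1 e2 H.hα m H.r5 (by omega) (by omega) (H.hWm i) (NF_shift (-n) hz')
    have h2 : e1 (Wm i) = β⁻¹ * e1 (fy i) * (β⁻¹)⁻¹ := by rw [← H.r1m, inv_inv]
    set b2 := β * e1 (fa ι) ^ (-n) with hb2
    have hA : e1 (fa ι) * (e1 (fa ι) ^ n * e1 D * e1 (fa ι) ^ (-n)) * e2 D = b2⁻¹ * e1 (fa ι) * b2⁻¹⁻¹ := by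
      rw [hb2]
      have h := H.r3m
      calc _ = e1 (fa ι) ^ n * (e1 (fa ι) * e1 D * (e1 (fa ι) ^ (-n) * e2 D * e1 (fa ι) ^ n)) * e1 (fa ι) ^ (-n) := by group
        _ = _ := by rw [← h]; group
    rw [hA, conj_zpow, ← H.r2m] at h
    have h3 : e2 (fa ι ^ (-n) * z' * fa ι ^ (- -n)) =
        β⁻¹ * e2 (fa ι ^ (m + 1) * fy j * fa ι ^ (-(m + 1))) * (β⁻¹)⁻¹ := by
      have hβ : β = b2 * e1 (fa ι) ^ n := by rw [hb2]; group
      simp only [map_mul, map_zpow]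
      rw [← h, hβ, H.hα]
      group
    rw [h2, h3] at h1
    exact (Commute.conj_iff _).1 h1
  · obtain ⟨z', hz', h⟩ := pow_down e1 e2 H (m+1-n).toNat hm1.le (H.hWp j)
    rw [hm1] at hz'
    rw [← zpow_natCast, hm1] at h
    have h1 := comm_window e1 e2 H.hα m H.r5 (by omega) (by omega) (H.hWp i) hz'
    have h2 : e1 (Wp i) = β * e1 (fy i) * β⁻¹ := by rw [← H.r1p]
    set b2 := β * e1 (fa ι) ^ (-n) with hb2
    have hA : e1 (fa ι) * e1 E * e2 E = b2 * e1 (fa ι) * b2⁻¹ := by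
      rw [hb2, ← H.r3p]; group
    rw [hA, conj_zpow, ← H.r2p] at h
    have h3 : e2 z' = β * e2 (fa ι ^ (-(m + 1)) * fy j * fa ι ^ (-(-(m + 1)))) * β⁻¹ := by
      have hβ : β = b2 * e1 (fa ι) ^ n := by rw [hb2]; group
      simp only [map_mul, map_zpow]
      rw [← h, hβ, H.hα]
      group
    rw [h2, h3] at h1
    exact (Commute.conj_iff _).1 h1

theorem comm_all {ι P : Type*} [Group P] (e1 e2 : FreeGroup (Option ι) →* P)
    {β : P} {c n m : ℤ} {Wp Wm : ι → FreeGroup (Option ι)} {E D : FreeGroup (Option ι)}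
    (H : CoreRel e1 e2 β c n m Wp Wm E D) {x y} (hx : qh ι x = 1) (hy : qh ι y = 1) :
    Commute (e1 x) (e2 y) := by
  have hs : ∀ k : ℕ, CoreRel e1 e2 β c n (m + k) Wp Wm E D := by
    intro k
    induction k with
    | zero => simpa using H
    | succ k ih => simpa [add_assoc] using comm_step e1 e2 ih
  obtain ⟨k, hk, hx⟩ := NF_of_ker hx
  obtain ⟨l, hl, hy⟩ := NF_of_ker hy
  have h := hs (k + l).toNat
  rw [Int.toNat_of_nonneg (by omega)] at h
  have := H.hm
  have := H.hn
  have := H.hc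
  exact comm_window e1 e2 H.hα _ h.r5 (by omega) (by omega) hx hy

/-- endomorphism of the free group with given images -/
def thetaHom {ι : Type*} (W : ι → FreeGroup (Option ι)) (E : FreeGroup (Option ι)) :
    FreeGroup (Option ι) →* FreeGroup (Option ι) :=
  FreeGroup.lift (fun o => o.elim (fa ι * E) W)

theorem thetaHom_fa {ι : Type*} (W : ι → FreeGroup (Option ι)) (E : FreeGroup (Option ι)) :
    thetaHom W E (fa ι) = fa ι * E := by simp [thetaHom, fa]
theorem thetaHom_fy {ι : Type*} (W : ι → FreeGroup (Option ι)) (E : FreeGroup (Option ι)) (j : ι) :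
    thetaHom W E (fy j) = W j := by simp [thetaHom, fy]

theorem thetaHom_q {ι : Type*} (W : ι → FreeGroup (Option ι)) (E : FreeGroup (Option ι))
    (hW : ∀ j, qh ι (W j) = 1) (hE : qh ι E = 1) (w) : qh ι (thetaHom W E w) = qh ι w := by
  have : (qh ι).comp (thetaHom W E) = qh ι := by
    apply FreeGroup.ext_hom
    rintro (_ | j)
    · change qh ι (thetaHom W E (fa ι)) = qh ι (fa ι)
      rw [thetaHom_fa, map_mul, hE, mul_one]
    · change qh ι (thetaHom W E (fy j)) = qh ι (fy j)
      rw [thetaHom_fy, hW, qh_fy]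
  exact DFunLike.congr_fun this w

theorem q_fix {ι : Type*} (w : FreeGroup (Option ι)) :
    qh ι (w * fa ι ^ (-(Multiplicative.toAdd (qh ι w)))) = 1 := by
  rw [map_mul, qh_fa_zpow, ofAdd_neg, ofAdd_toAdd, mul_inv_cancel]

theorem twist {ι P : Type*} [Group P] (e e' : FreeGroup (Option ι) →* P)
    (hα : e (fa ι) = e' (fa ι))
    (hcom : ∀ x y, qh ι x = 1 → qh ι y = 1 → Commute (e x) (e' y))
    (b : P) (W : ι → FreeGroup (Option ι)) (E E' : FreeGroup (Option ι))
    (hW : ∀ j, qh ι (W j) = 1) (hE : qh ι E = 1) (hE' : qh ι E' = 1)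
    (hb : ∀ j, b * e (fy j) * b⁻¹ = e (W j))
    (hba : b * e (fa ι) * b⁻¹ = e (fa ι) * e E * e' E') (w : FreeGroup (Option ι)) :
    b * e w * b⁻¹ = e (thetaHom W E w) * e (fa ι) ^ (-(Multiplicative.toAdd (qh ι w))) *
      e' ((fa ι * E') ^ (Multiplicative.toAdd (qh ι w))) := by
  let f : FreeGroup (Option ι) →* P := MonoidHom.mk' (fun w =>
    e (thetaHom W E w) * e (fa ι) ^ (-(Multiplicative.toAdd (qh ι w))) *
      e' ((fa ι * E') ^ (Multiplicative.toAdd (qh ι w)))) (by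
      intro x y
      have h1 : qh ι (thetaHom W E y * fa ι ^ (-(Multiplicative.toAdd (qh ι y)))) = 1 := by
        have := q_fix (thetaHom W E y)
        rwa [thetaHom_q W E hW hE] at this
      have h2 : qh ι (fa ι ^ (-(Multiplicative.toAdd (qh ι x))) *
          (fa ι * E') ^ (Multiplicative.toAdd (qh ι x))) = 1 := by
        rw [map_mul, qh_fa_zpow, map_zpow, map_mul, hE', qh_fa, mul_one, ← ofAdd_zsmul,
          ← ofAdd_add]
        simp
      have h3 := (hcom _ _ h1 h2).eq
      simp only [map_mul, map_zpow, toAdd_mul, ← hα] at h3 ⊢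
      set u := Multiplicative.toAdd (qh ι x)
      set v := Multiplicative.toAdd (qh ι y)
      set A := e (fa ι)
      calc _ = e (thetaHom W E x) * (e (thetaHom W E y) * A ^ (-v) * (A ^ (-u) * (A * e' E') ^ u)) * (A * e' E') ^ v := by
            rw [neg_add_rev, zpow_add, zpow_add]; group
        _ = _ := by rw [h3]; group)
  have : (MulAut.conj b).toMonoidHom.comp e = f := by
    apply FreeGroup.ext_hom
    rintro (_ | j)
    · change b * e (fa ι) * b⁻¹ = e (thetaHom W E (fa ι)) * e (fa ι) ^ (-(Multiplicative.toAdd (qh ι (fa ι)))) *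
        e' ((fa ι * E') ^ (Multiplicative.toAdd (qh ι (fa ι))))
      have h3 : Commute (e' E') (e E) := (hcom _ _ hE hE').symm
      have h4 := (hcom (fa ι * E * (fa ι)⁻¹) (fa ι * E' * (fa ι)⁻¹) (by simp [hE]) (by simp [hE'])).eq
      rw [hba, thetaHom_fa, qh_fa]
      simp only [map_mul, toAdd_ofAdd, zpow_one, zpow_neg, ← hα]
      group
    · change b * e (fy j) * b⁻¹ = e (thetaHom W E (fy j)) * e (fa ι) ^ (-(Multiplicative.toAdd (qh ι (fy j)))) *
        e' ((fa ι * E') ^ (Multiplicative.toAdd (qh ι (fy j))))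
      rw [hb, thetaHom_fy, qh_fy]; simp
  exact DFunLike.congr_fun this w

theorem twist_all {ι P : Type*} [Group P] (e1 e2 : FreeGroup (Option ι) →* P)
    {β : P} {c n m : ℤ} {Wp Wm : ι → FreeGroup (Option ι)} {E D : FreeGroup (Option ι)}
    (H : CoreRel e1 e2 β c n m Wp Wm E D) :
    (∃ E', qh ι E' = 1 ∧ ∀ w, β * e1 w * β⁻¹ = e1 (thetaHom Wp E w) *
      e1 (fa ι) ^ (-(Multiplicative.toAdd (qh ι w))) *
      e2 ((fa ι * E') ^ (Multiplicative.toAdd (qh ι w)))) ∧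
    (∃ E', qh ι E' = 1 ∧ ∀ w, β⁻¹ * e1 w * β⁻¹⁻¹ = e1 (thetaHom Wm D w) *
      e1 (fa ι) ^ (-(Multiplicative.toAdd (qh ι w))) *
      e2 ((fa ι * E') ^ (Multiplicative.toAdd (qh ι w)))) ∧
    (∃ E', ∀ w, (β * e1 (fa ι) ^ (-n)) * e2 w * (β * e1 (fa ι) ^ (-n))⁻¹ = e2 (thetaHom Wp E w) *
      e2 (fa ι) ^ (-(Multiplicative.toAdd (qh ι w))) *
      e1 ((fa ι * E') ^ (Multiplicative.toAdd (qh ι w)))) ∧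
    (∃ E', ∀ w, (β * e1 (fa ι) ^ (-n))⁻¹ * e2 w * (β * e1 (fa ι) ^ (-n))⁻¹⁻¹ = e2 (thetaHom Wm D w) *
      e2 (fa ι) ^ (-(Multiplicative.toAdd (qh ι w))) *
      e1 ((fa ι * E') ^ (Multiplicative.toAdd (qh ι w)))) := by
  have hq : ∀ {w}, w ∈ NF ι (-c) c → qh ι w = 1 := fun h => NF_le_ker _ _ h
  have hcom : ∀ x y, qh ι x = 1 → qh ι y = 1 → Commute (e1 x) (e2 y) :=
    fun x y hx hy => comm_all e1 e2 H hx hy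
  have hcom' : ∀ x y, qh ι x = 1 → qh ι y = 1 → Commute (e2 x) (e1 y) :=
    fun x y hx hy => (comm_all e1 e2 H hy hx).symm
  have hD1 : qh ι (fa ι ^ (-n) * D * fa ι ^ n) = 1 := by
    rw [map_mul, map_mul, hq H.hD, mul_one, ← map_mul, ← zpow_add]; simp
  have hD2 : qh ι (fa ι ^ n * D * fa ι ^ (-n)) = 1 := by
    rw [map_mul, map_mul, hq H.hD, mul_one, ← map_mul, ← zpow_add]; simp
  have t1p := twist e1 e2 H.hα hcom β Wp E E (fun j => hq (H.hWp j)) (hq H.hE) (hq H.hE) H.r1p H.r3p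
  have t1m := twist e1 e2 H.hα hcom β⁻¹ Wm D (fa ι ^ (-n) * D * fa ι ^ n) (fun j => hq (H.hWm j)) (hq H.hD)
    hD1 (by simpa using H.r1m) (by simpa [H.hα] using H.r3m)
  have t2p := twist e2 e1 H.hα.symm hcom' (β * e1 (fa ι) ^ (-n)) Wp E E (fun j => hq (H.hWp j)) (hq H.hE)
    (hq H.hE) H.r2p (by
      have h := H.r3p
      rw [mul_assoc _ (e1 E), (hcom E E (hq H.hE) (hq H.hE)).eq, ← mul_assoc _ (e2 E)] at h
      rw [← H.hα, ← h]; group)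
  have t2m := twist e2 e1 H.hα.symm hcom' (β * e1 (fa ι) ^ (-n))⁻¹ Wm D (fa ι ^ n * D * fa ι ^ (-n))
    (fun j => hq (H.hWm j)) (hq H.hD)
    hD2 (by intro j; rw [inv_inv]; exact H.r2m j) (by
      have h := H.r3m
      rw [mul_assoc (e2 (fa ι)), (hcom' D _ (hq H.hD) hD2).eq]
      simp only [map_mul, map_zpow, ← H.hα]
      calc _ = e1 (fa ι) ^ n * (β⁻¹ * e1 (fa ι) * β) * e1 (fa ι) ^ (-n) := by group
        _ = _ := by rw [h]; group)
  exact ⟨⟨_, hq H.hE, t1p⟩, ⟨_, hD1, t1m⟩, ⟨_, t2p⟩, ⟨_, t2m⟩⟩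

theorem normal_form {ι P : Type*} [Group P] (e1 e2 : FreeGroup (Option ι) →* P)
    {β : P} {c n m : ℤ} {Wp Wm : ι → FreeGroup (Option ι)} {E D : FreeGroup (Option ι)}
    (H : CoreRel e1 e2 β c n m Wp Wm E D)
    (hgen : Subgroup.closure ({β} ∪ Set.range e1 ∪ Set.range e2) = ⊤) (x : P) :
    ∃ n1 n2 : FreeGroup (Option ι), ∃ i j : ℤ, qh ι n1 = 1 ∧ qh ι n2 = 1 ∧
      x = e1 n1 * e2 n2 * e1 (fa ι) ^ i * β ^ j := by
  have hq : ∀ {w}, w ∈ NF ι (-c) c → qh ι w = 1 := fun h => NF_le_ker _ _ h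
  have hcom : ∀ x y, qh ι x = 1 → qh ι y = 1 → Commute (e1 x) (e2 y) :=
    fun x y hx hy => comm_all e1 e2 H hx hy
  obtain ⟨⟨E1, hE1, t1p⟩, ⟨D1, hD1, t1m⟩, ⟨E2, t2p⟩, ⟨D2, t2m⟩⟩ := twist_all e1 e2 H
  have hqp := thetaHom_q Wp E (fun j => hq (H.hWp j)) (hq H.hE)
  have hqm := thetaHom_q Wm D (fun j => hq (H.hWm j)) (hq H.hD)
  let Z : P → Prop := fun x => ∃ n1 n2 : FreeGroup (Option ι), ∃ i j : ℤ, qh ι n1 = 1 ∧ qh ι n2 = 1 ∧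
      x = e1 n1 * e2 n2 * e1 (fa ι) ^ i * β ^ j
  have zα : ∀ (k : ℤ) x, Z x → Z (e1 (fa ι) ^ k * x) := by
    rintro k x ⟨n1, n2, i, j, h1, h2, rfl⟩
    refine ⟨fa ι ^ k * n1 * fa ι ^ (-k), fa ι ^ k * n2 * fa ι ^ (-k), k + i, j, ?_, ?_, ?_⟩
    · rw [map_mul, map_mul, h1, mul_one, ← map_mul, ← zpow_add]; simp
    · rw [map_mul, map_mul, h2, mul_one, ← map_mul, ← zpow_add]; simp
    · simp only [map_mul, map_zpow, ← H.hα]; group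
  have z1 : ∀ w x, Z x → Z (e1 w * x) := by
    intro w x hx
    obtain ⟨n1, n2, i, j, h1, h2, h⟩ := zα (Multiplicative.toAdd (qh ι w)) x hx
    refine ⟨w * fa ι ^ (-(Multiplicative.toAdd (qh ι w))) * n1, n2, i, j, ?_, h2, ?_⟩
    · rw [map_mul, q_fix, h1, mul_one]
    · have : x = e1 (fa ι) ^ (-(Multiplicative.toAdd (qh ι w))) * (e1 n1 * e2 n2 * e1 (fa ι) ^ i * β ^ j) := by
        rw [← h]; group
      rw [this, map_mul, map_mul, map_zpow]; group
  have z2 : ∀ w x, Z x → Z (e2 w * x) := by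
    intro w x hx
    obtain ⟨n1, n2, i, j, h1, h2, h⟩ := zα (Multiplicative.toAdd (qh ι w)) x hx
    refine ⟨n1, w * fa ι ^ (-(Multiplicative.toAdd (qh ι w))) * n2, i, j, h1, ?_, ?_⟩
    · rw [map_mul, q_fix, h2, mul_one]
    · rw [map_mul, ← mul_assoc (e1 n1), (hcom n1 _ h1 (q_fix w)).eq]
      have : x = e1 (fa ι) ^ (-(Multiplicative.toAdd (qh ι w))) * (e1 n1 * e2 n2 * e1 (fa ι) ^ i * β ^ j) := by
        rw [← h]; group
      rw [this, map_mul, map_zpow, ← H.hα]; group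
  have zb : ∀ (b : P) (s : ℤ), b = β ^ s → (∀ w, qh ι w = 1 → ∃ w', qh ι w' = 1 ∧ b * e1 w * b⁻¹ = e1 w') →
      (∀ w, qh ι w = 1 → ∃ w', qh ι w' = 1 ∧ b * e2 w * b⁻¹ = e2 w') →
      (∀ i : ℤ, ∃ u v, b * e1 (fa ι) ^ i * b⁻¹ = e1 u * e2 v * e1 (fa ι) ^ i) →
      ∀ x, Z x → Z (b * x) := by
    rintro b s hb h1 h2 h3 x ⟨n1, n2, i, j, hn1, hn2, rfl⟩
    obtain ⟨n1', hn1', e1'⟩ := h1 n1 hn1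
    obtain ⟨n2', hn2', e2'⟩ := h2 n2 hn2
    obtain ⟨u, v, h⟩ := h3 i
    have : b * (e1 n1 * e2 n2 * e1 (fa ι) ^ i * β ^ j) =
        e1 n1' * (e2 n2' * (e1 u * (e2 v * (e1 (fa ι) ^ i * β ^ (s + j))))) := by
      rw [← e1', ← e2', ← mul_assoc (e2 v), ← mul_assoc (e1 u), ← mul_assoc (e1 u), ← h, zpow_add, ← hb]; group
    rw [this]
    apply z1; apply z2; apply z1; apply z2; apply zα
    exact ⟨1, 1, 0, s + j, by simp, by simp, by simp⟩
  have zp : ∀ x, Z x → Z (β * x) := by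
    apply zb β 1 (by simp)
    · intro w hw
      refine ⟨_, (hqp w).trans hw, ?_⟩
      rw [t1p, hw]; simp
    · intro w hw
      have hw' : qh ι (fa ι ^ n * w * fa ι ^ (-n)) = 1 := by
        rw [map_mul, map_mul, hw, mul_one, ← map_mul, ← zpow_add]; simp
      refine ⟨_, (hqp _).trans hw', ?_⟩
      have h := t2p (fa ι ^ n * w * fa ι ^ (-n))
      rw [hw'] at h
      simp only [toAdd_one, neg_zero, zpow_zero, mul_one, map_one] at h
      rw [← h]
      simp only [map_mul, map_zpow, ← H.hα]; group
    · intro i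
      have h := t1p (fa ι ^ i)
      rw [qh_fa_zpow, map_zpow] at h
      refine ⟨thetaHom Wp E (fa ι ^ i) * fa ι ^ (-i), (fa ι * E1) ^ i * fa ι ^ (-i), ?_⟩
      rw [h]
      simp only [map_mul, map_zpow, ← H.hα, toAdd_ofAdd]; group
  have zm : ∀ x, Z x → Z (β⁻¹ * x) := by
    apply zb β⁻¹ (-1) (by simp)
    · intro w hw
      refine ⟨_, (hqm w).trans hw, ?_⟩
      rw [t1m, hw]; simp
    · intro w hw
      refine ⟨fa ι ^ (-n) * thetaHom Wm D w * fa ι ^ n, ?_, ?_⟩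
      · rw [map_mul, map_mul, hqm, hw, mul_one, ← map_mul, ← zpow_add]; simp
      have h := t2m w
      rw [hw] at h
      simp only [toAdd_one, neg_zero, zpow_zero, mul_one, map_one] at h
      simp only [map_mul, map_zpow, ← H.hα]
      rw [← h]
      group
    · intro i
      have h := t1m (fa ι ^ i)
      rw [qh_fa_zpow, map_zpow] at h
      refine ⟨thetaHom Wm D (fa ι ^ i) * fa ι ^ (-i), (fa ι * D1) ^ i * fa ι ^ (-i), ?_⟩
      rw [h]
      simp only [map_mul, map_zpow, ← H.hα, toAdd_ofAdd]; group
  have hx : x ∈ Subgroup.closure ({β} ∪ Set.range e1 ∪ Set.range e2) := hgen ▸ Subgroup.mem_top x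
  change Z x
  induction hx using Subgroup.closure_induction_left with
  | one => exact ⟨1, 1, 0, 0, by simp, by simp, by simp⟩
  | mul_left x hx y hy ih =>
    rcases hx with (hx | ⟨w, rfl⟩) | ⟨w, rfl⟩
    · obtain rfl : x = β := hx
      exact zp _ ih
    · exact z1 _ _ ih
    · exact z2 _ _ ih
  | inv_mul_cancel x hx y hy ih =>
    rcases hx with (hx | ⟨w, rfl⟩) | ⟨w, rfl⟩
    · obtain rfl : x = β := hx
      exact zm _ ih
    · rw [← map_inv]; exact z1 _ _ ih
    · rw [← map_inv]; exact z2 _ _ ih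

theorem core_inj {ι P G : Type*} [Finite ι] [Group P] [Group G]
    (e1 e2 : FreeGroup (Option ι) →* P)
    {β : P} {c n m : ℤ} {Wp Wm : ι → FreeGroup (Option ι)} {E D : FreeGroup (Option ι)}
    (H : CoreRel e1 e2 β c n m Wp Wm E D)
    (hgen : Subgroup.closure ({β} ∪ Set.range e1 ∪ Set.range e2) = ⊤)
    (κ : FreeGroup (Option ι) →* G) (t : G) (τ p : G →* Multiplicative ℤ)
    (hτt : τ t = Multiplicative.ofAdd 1) (hτκ : ∀ w, τ (κ w) = 1) (hpt : p t = 1)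
    (hpκ : ∀ w, p (κ w) = qh ι w)
    (π : P →* G × G) (hπ1 : ∀ w, π (e1 w) = (κ w, κ (fa ι ^ Multiplicative.toAdd (qh ι w))))
    (hπ2 : ∀ w, π (e2 w) = (κ (fa ι ^ Multiplicative.toAdd (qh ι w)), κ w))
    (hπβ : (π β).1 = t)
    (S : Set (FreeGroup (Option ι)))
    (hS : ∀ R : Subgroup (FreeGroup (Option ι)), R.Normal → S ⊆ R → (∀ w ∈ R, thetaHom Wp E w ∈ R) →
        (∀ w ∈ R, thetaHom Wm D w ∈ R) → κ.ker ≤ R)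
    (hS1 : ∀ s ∈ S, e1 s = 1) (hS2 : ∀ s ∈ S, e2 s = 1) : Function.Injective π := by
  have hq : ∀ {w}, w ∈ NF ι (-c) c → qh ι w = 1 := fun h => NF_le_ker _ _ h
  obtain ⟨⟨E1, hE1, t1p⟩, ⟨D1, hD1, t1m⟩, ⟨E2, t2p⟩, ⟨D2, t2m⟩⟩ := twist_all e1 e2 H
  have hq1 : ∀ w, e1 w = 1 → qh ι w = 1 := by
    intro w hw
    have := congrArg Prod.fst (hπ1 w)
    rw [hw, map_one] at this
    rw [← hpκ, ← show (1 : G) = κ w from this, map_one]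
  have hq2 : ∀ w, e2 w = 1 → qh ι w = 1 := by
    intro w hw
    have := congrArg Prod.snd (hπ2 w)
    rw [hw, map_one] at this
    rw [← hpκ, ← show (1 : G) = κ w from this, map_one]
  have k1 : κ.ker ≤ e1.ker := by
    apply hS e1.ker inferInstance (fun s hs => hS1 s hs)
    · intro w hw
      rw [MonoidHom.mem_ker] at hw ⊢
      have := t1p w
      rw [hw, hq1 w hw] at this
      simpa using this.symm
    · intro w hw
      rw [MonoidHom.mem_ker] at hw ⊢
      have := t1m w
      rw [hw, hq1 w hw] at this
      simpa using this.symm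
  have k2 : κ.ker ≤ e2.ker := by
    apply hS e2.ker inferInstance (fun s hs => hS2 s hs)
    · intro w hw
      rw [MonoidHom.mem_ker] at hw ⊢
      have := t2p w
      rw [hw, hq2 w hw] at this
      simpa using this.symm
    · intro w hw
      rw [MonoidHom.mem_ker] at hw ⊢
      have := t2m w
      rw [hw, hq2 w hw] at this
      simpa using this.symm
  rw [injective_iff_map_eq_one]
  intro x hx
  obtain ⟨n1, n2, i, j, h1, h2, rfl⟩ := normal_form e1 e2 H hgen x
  rw [← map_zpow e1, map_mul, map_mul, map_mul, map_zpow π, hπ1, hπ2, hπ1, h1, h2, qh_fa_zpow] at hx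
  have ha := congrArg Prod.fst hx
  have hb := congrArg Prod.snd hx
  simp only [toAdd_one, zpow_zero, map_one, toAdd_ofAdd, Prod.fst_mul, Prod.snd_mul, Prod.fst_one, Prod.snd_one, Prod.pow_fst, Prod.pow_snd, mul_one, one_mul, hπβ] at ha hb
  have hj := congrArg τ ha
  rw [map_mul, map_mul, hτκ, hτκ, map_zpow τ, hτt, map_one τ, ← ofAdd_zsmul] at hj
  have hj0 : j = 0 := by simpa using hj
  subst hj0
  have hi := congrArg p ha
  rw [map_mul, map_mul, hpκ, hpκ, map_zpow p, hpt, map_one, qh_fa_zpow, h1] at hi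
  have hi0 : i = 0 := by simpa using hi
  subst hi0
  have hn1 : n1 ∈ κ.ker := by simpa using ha
  have hn2 : n2 ∈ κ.ker := by simpa using hb
  have e1' : e1 n1 = 1 := k1 hn1
  have e2' : e2 n2 = 1 := k2 hn2
  simp [e1', e2']

theorem Hprime_fp {G : Type*} [Group G] (hG : Group.IsFinitelyPresented G)
    (τ p : G →* Multiplicative ℤ) (t a : G)
    (hτt : τ t = Multiplicative.ofAdd 1) (hpt : p t = 1) (hτa : τ a = 1)
    (hpa : p a = Multiplicative.ofAdd 1) (hK : τ.ker.FG) :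
    ∃ n : ℤ, ∀ H : Subgroup (G × G),
      (∀ x, x ∈ H ↔ τ x.2 = τ x.1 ∧ p x.2 = p x.1 * τ x.1 ^ n) → Group.IsFinitelyPresented H := by
  classical
  obtain ⟨X, hX⟩ := hK
  let ι := X
  let y : ι → G := fun x => (x : G) * a ^ (-(Multiplicative.toAdd (p (x : G))))
  let κ : FreeGroup (Option ι) →* G := FreeGroup.lift (fun o => o.elim a y)
  have κa : κ (fa ι) = a := by simp [κ, fa]
  have κy : ∀ j, κ (fy j) = y j := by intro j; simp [κ, fy]
  have hXτ : ∀ x : ι, τ (x : G) = 1 := by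
    intro x
    have : (x : G) ∈ τ.ker := hX ▸ Subgroup.subset_closure x.2
    exact this
  have hpaz : ∀ k : ℤ, p (a ^ k) = Multiplicative.ofAdd k := by
    intro k; rw [map_zpow, hpa, ← ofAdd_zsmul, smul_eq_mul, mul_one]
  have hpy : ∀ j, p (y j) = 1 := by
    intro j
    simp only [y, map_mul, hpaz, ofAdd_neg, ofAdd_toAdd, mul_inv_cancel]
  have hτy : ∀ j, τ (y j) = 1 := by
    intro j
    simp only [y, map_mul, map_zpow, hτa, hXτ, one_zpow, mul_one]
  have hτκ : ∀ w, τ (κ w) = 1 := by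
    intro w
    have : τ.comp κ = 1 := by
      apply FreeGroup.ext_hom
      rintro (_ | j)
      · change τ (κ (fa ι)) = 1
        rw [κa, hτa]
      · change τ (κ (fy j)) = 1
        rw [κy, hτy]
    exact DFunLike.congr_fun this w
  have hpκ : ∀ w, p (κ w) = qh ι w := by
    intro w
    have : p.comp κ = qh ι := by
      apply FreeGroup.ext_hom
      rintro (_ | j)
      · change p (κ (fa ι)) = qh ι (fa ι)
        rw [κa, hpa, qh_fa]
      · change p (κ (fy j)) = qh ι (fy j)
        rw [κy, hpy, qh_fy]
    exact DFunLike.congr_fun this w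
  have hκr : κ.range = τ.ker := by
    apply le_antisymm
    · rintro _ ⟨w, rfl⟩; exact hτκ w
    · rw [← hX, Subgroup.closure_le]
      intro x hx
      refine ⟨fy ⟨x, hx⟩ * fa ι ^ (Multiplicative.toAdd (p x)), ?_⟩
      rw [map_mul, map_zpow, κa, κy]
      simp [y]
  have hex : ∀ g, τ g = 1 → ∃ w, κ w = g := by
    intro g hg
    have : g ∈ κ.range := by rw [hκr]; exact hg
    exact this
  have hex' : ∀ g, τ g = 1 → p g = 1 → ∃ w, κ w = g ∧ ∃ k : ℤ, 0 ≤ k ∧ w ∈ NF ι (-k) k := by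
    intro g hg hg'
    obtain ⟨w, hw⟩ := hex g hg
    exact ⟨w, hw, NF_of_ker (by rw [← hpκ, hw, hg'])⟩
  have hWp : ∀ j, ∃ w, κ w = t * y j * t⁻¹ ∧ ∃ k : ℤ, 0 ≤ k ∧ w ∈ NF ι (-k) k := by
    intro j; apply hex' <;> simp [hτy, hpy]
  have hWm : ∀ j, ∃ w, κ w = t⁻¹ * y j * t ∧ ∃ k : ℤ, 0 ≤ k ∧ w ∈ NF ι (-k) k := by
    intro j; apply hex' <;> simp [hτy, hpy]
  choose Wp hWp cp hcp0 hcp using hWp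
  choose Wm hWm cm hcm0 hcm using hWm
  obtain ⟨E, hE, cE, hcE0, hcE⟩ := hex' (a⁻¹ * (t * a * t⁻¹)) (by simp [hτa]) (by simp)
  obtain ⟨D, hD, cD, hcD0, hcD⟩ := hex' (a⁻¹ * (t⁻¹ * a * t)) (by simp [hτa]) (by simp)
  obtain ⟨Bp, hBp⟩ := (Set.finite_range cp).bddAbove
  obtain ⟨Bm, hBm⟩ := (Set.finite_range cm).bddAbove
  let c : ℤ := cE + cD + |Bp| + |Bm|
  have hc1 : ∀ j, cp j ≤ c := fun j => by
    have := hBp ⟨j, rfl⟩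
    have := le_abs_self Bp
    have := abs_nonneg Bm
    simp only [c]; omega
  have hc2 : ∀ j, cm j ≤ c := fun j => by
    have := hBm ⟨j, rfl⟩
    have := le_abs_self Bm
    have := abs_nonneg Bp
    simp only [c]; omega
  have hc3 : cE ≤ c ∧ cD ≤ c := by
    have := abs_nonneg Bm
    have := abs_nonneg Bp
    simp only [c]; omega
  have hc0 : 0 ≤ c := by omega
  let θp := thetaHom Wp E
  let θm := thetaHom Wm D
  have hθp : ∀ w, κ (θp w) = t * κ w * t⁻¹ := by
    intro w
    have : κ.comp θp = (MulAut.conj t).toMonoidHom.comp κ := by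
      apply FreeGroup.ext_hom
      rintro (_ | j)
      · change κ (thetaHom Wp E (fa ι)) = t * κ (fa ι) * t⁻¹
        rw [thetaHom_fa, map_mul, hE, κa]; group
      · change κ (thetaHom Wp E (fy j)) = t * κ (fy j) * t⁻¹
        rw [thetaHom_fy, hWp, κy]
    exact DFunLike.congr_fun this w
  have hθm : ∀ w, κ (θm w) = t⁻¹ * κ w * t := by
    intro w
    have : κ.comp θm = (MulAut.conj t⁻¹).toMonoidHom.comp κ := by
      apply FreeGroup.ext_hom
      rintro (_ | j)
      · change κ (thetaHom Wm D (fa ι)) = t⁻¹ * κ (fa ι) * t⁻¹⁻¹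
        rw [thetaHom_fa, map_mul, hD, κa]; group
      · change κ (thetaHom Wm D (fy j)) = t⁻¹ * κ (fy j) * t⁻¹⁻¹
        rw [thetaHom_fy, hWm, κy, inv_inv]
    have := DFunLike.congr_fun this w
    simpa using this
  obtain ⟨S, hSf, hSκ, hS⟩ := rel_stable hG κ t τ hτt hκr θp θm hθp hθm
  let n : ℤ := 2 * c + 1
  let m : ℤ := n + 2 * c
  refine ⟨n, fun H hH => ?_⟩
  let Γ := Option (Option (ι ⊕ ι))
  let b : FreeGroup Γ := FreeGroup.of none
  let f1 : FreeGroup (Option ι) →* FreeGroup Γ :=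
    FreeGroup.lift (fun o => o.elim (FreeGroup.of (some none)) (fun j => FreeGroup.of (some (some (Sum.inl j)))))
  let f2 : FreeGroup (Option ι) →* FreeGroup Γ :=
    FreeGroup.lift (fun o => o.elim (FreeGroup.of (some none)) (fun j => FreeGroup.of (some (some (Sum.inr j)))))
  have f1a : f1 (fa ι) = FreeGroup.of (some none) := by simp [f1, fa]
  have f2a : f2 (fa ι) = FreeGroup.of (some none) := by simp [f2, fa]
  have f1y : ∀ j, f1 (fy j) = FreeGroup.of (some (some (Sum.inl j))) := by intro j; simp [f1, fy]
  have f2y : ∀ j, f2 (fy j) = FreeGroup.of (some (some (Sum.inr j))) := by intro j; simp [f2, fy]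
  let π0 : FreeGroup Γ →* G × G := FreeGroup.lift (fun o => o.elim (t, t * a ^ n)
    (fun o => o.elim (a, a) (fun s => s.elim (fun j => (y j, 1)) (fun j => (1, y j)))))
  have π0b : π0 b = (t, t * a ^ n) := by simp [π0, b]
  have hπ1 : ∀ w, π0 (f1 w) = (κ w, a ^ Multiplicative.toAdd (qh ι w)) := by
    intro w
    have : π0.comp f1 = κ.prod ((zpowersHom G a).comp (qh ι)) := by
      apply FreeGroup.ext_hom
      rintro (_ | j)
      · change π0 (f1 (fa ι)) = (κ (fa ι), a ^ Multiplicative.toAdd (qh ι (fa ι)))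
        rw [f1a, κa, qh_fa]; simp [π0]
      · change π0 (f1 (fy j)) = (κ (fy j), a ^ Multiplicative.toAdd (qh ι (fy j)))
        rw [f1y, κy, qh_fy]; simp [π0]
    exact DFunLike.congr_fun this w
  have hπ2 : ∀ w, π0 (f2 w) = (a ^ Multiplicative.toAdd (qh ι w), κ w) := by
    intro w
    have : π0.comp f2 = ((zpowersHom G a).comp (qh ι)).prod κ := by
      apply FreeGroup.ext_hom
      rintro (_ | j)
      · change π0 (f2 (fa ι)) = (a ^ Multiplicative.toAdd (qh ι (fa ι)), κ (fa ι))
        rw [f2a, κa, qh_fa]; simp [π0]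
      · change π0 (f2 (fy j)) = (a ^ Multiplicative.toAdd (qh ι (fy j)), κ (fy j))
        rw [f2y, κy, qh_fy]; simp [π0]
    exact DFunLike.congr_fun this w
  have hq : ∀ {w}, w ∈ NF ι (-c) c → qh ι w = 1 := fun h => NF_le_ker _ _ h
  have hπ1' : ∀ w, qh ι w = 1 → π0 (f1 w) = (κ w, 1) := by
    intro w hw; rw [hπ1, hw]; simp
  have hπ2' : ∀ w, qh ι w = 1 → π0 (f2 w) = (1, κ w) := by
    intro w hw; rw [hπ2, hw]; simp
  have hWpN : ∀ j, Wp j ∈ NF ι (-c) c := fun j =>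
    NF_mono (by have := hc1 j; omega) (hc1 j) (hcp j)
  have hWmN : ∀ j, Wm j ∈ NF ι (-c) c := fun j =>
    NF_mono (by have := hc2 j; omega) (hc2 j) (hcm j)
  have hEN : E ∈ NF ι (-c) c := NF_mono (by omega) (by omega) hcE
  have hDN : D ∈ NF ι (-c) c := NF_mono (by omega) (by omega) hcD
  let A := f1 (fa ι)
  have π0A : π0 A = (a, a) := by simp [A, f1a, π0]
  let b2 := b * A ^ (-n)
  have π0b2 : π0 b2 = (t * a ^ (-n), t) := by
    simp only [b2, map_mul, map_zpow, π0A, π0b]; ext <;> simp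
  let Rel : Set (FreeGroup Γ × FreeGroup Γ) :=
    Set.range (fun j => (b * f1 (fy j) * b⁻¹, f1 (Wp j))) ∪
    Set.range (fun j => (b⁻¹ * f1 (fy j) * b, f1 (Wm j))) ∪
    Set.range (fun j => (b2 * f2 (fy j) * b2⁻¹, f2 (Wp j))) ∪
    Set.range (fun j => (b2⁻¹ * f2 (fy j) * b2, f2 (Wm j))) ∪
    {(b * A * b⁻¹, A * f1 E * f2 E)} ∪
    {(b⁻¹ * A * b, A * f1 D * (A ^ (-n) * f2 D * A ^ n))} ∪
    Set.range (fun x : ι × ι × Set.Icc (-m) m =>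
      (f1 (fy x.1) * f2 (fa ι ^ (x.2.2 : ℤ) * fy x.2.1 * fa ι ^ (-(x.2.2 : ℤ))),
       f2 (fa ι ^ (x.2.2 : ℤ) * fy x.2.1 * fa ι ^ (-(x.2.2 : ℤ))) * f1 (fy x.1))) ∪
    (fun s => (f1 s, 1)) '' S ∪ (fun s => (f2 s, 1)) '' S
  have hRelf : Rel.Finite := by
    refine Set.Finite.union (Set.Finite.union (Set.Finite.union (Set.Finite.union (Set.Finite.union (Set.Finite.union (Set.Finite.union (Set.Finite.union ?_ ?_) ?_) ?_) ?_) ?_) ?_) ?_) ?_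
    all_goals first | exact Set.finite_range _ | exact Set.finite_singleton _ | exact hSf.image _
  have hRelπ : ∀ r ∈ Rel, π0 r.1 = π0 r.2 := by
    have κt : ∀ w, qh ι w = 1 → κ (fa ι * w) = a * κ w := fun w _ => by rw [map_mul, κa]
    rintro r ((((((((⟨j, rfl⟩ | ⟨j, rfl⟩) | ⟨j, rfl⟩) | ⟨j, rfl⟩) | hr) | hr) | ⟨⟨i, j, k⟩, rfl⟩) | ⟨s, hs, rfl⟩) | ⟨s, hs, rfl⟩)
    · simp only [map_mul, map_inv, π0b, hπ1' _ (qh_fy j), hπ1' _ (hq (hWpN j)), hWp, κy]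
      ext <;> simp
    · simp only [map_mul, map_inv, π0b, hπ1' _ (qh_fy j), hπ1' _ (hq (hWmN j)), hWm, κy]
      ext <;> simp
    · simp only [map_mul, map_inv, π0b2, hπ2' _ (qh_fy j), hπ2' _ (hq (hWpN j)), hWp, κy]
      ext <;> simp
    · simp only [map_mul, map_inv, π0b2, hπ2' _ (qh_fy j), hπ2' _ (hq (hWmN j)), hWm, κy]
      ext <;> simp
    · obtain rfl := hr
      simp only [map_mul, map_inv, π0b, π0A, hπ1' _ (hq hEN), hπ2' _ (hq hEN), hE]
      ext
      · simp
      · simp only [Prod.snd_mul, Prod.snd_inv]; group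
    · obtain rfl := hr
      simp only [map_mul, map_inv, map_zpow, π0b, π0A, hπ1' _ (hq hDN), hπ2' _ (hq hDN), hD]
      ext
      · simp
      · simp only [Prod.snd_mul, Prod.snd_inv, Prod.pow_snd]; group
    · simp only [map_mul π0]
      rw [hπ1' _ (qh_fy i), hπ2' _ (NF_le_ker _ _ (NF_gen j (le_refl _) (le_refl _)))]
      ext <;> simp
    · simp only [map_one]
      have : qh ι s = 1 := by rw [← hpκ, hSκ s hs, map_one]
      rw [hπ1' _ this, hSκ s hs]; rfl
    · simp only [map_one]
      have : qh ι s = 1 := by rw [← hpκ, hSκ s hs, map_one]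
      rw [hπ2' _ this, hSκ s hs]; rfl
  let R : Set (FreeGroup Γ) := (fun r => r.1⁻¹ * r.2) '' Rel
  have hRf : R.Finite := hRelf.image _
  let NR := Subgroup.normalClosure R
  have hNR : NR ≤ π0.ker := by
    apply Subgroup.normalClosure_le_normal
    rintro _ ⟨r, hr, rfl⟩
    change π0 _ = 1
    rw [map_mul, map_inv, hRelπ r hr, inv_mul_cancel]
  have hPfp : Group.IsFinitelyPresented (FreeGroup Γ ⧸ NR) := by
    have : Group.IsFinitelyPresented (FreeGroup Γ) := fp_of_free_fg
    refine Group.IsFinitelyPresented.of_surjective (QuotientGroup.mk' NR) (QuotientGroup.mk'_surjective NR) ?_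
    rw [QuotientGroup.ker_mk']
    exact ⟨R, hRf, rfl⟩
  let pr := QuotientGroup.mk' NR
  have hrel : ∀ r ∈ Rel, pr r.1 = pr r.2 := by
    intro r hr
    exact QuotientGroup.eq.2 (Subgroup.subset_normalClosure ⟨r, hr, rfl⟩)
  let π : FreeGroup Γ ⧸ NR →* G × G := QuotientGroup.lift NR π0 hNR
  have hππ : ∀ w, π (pr w) = π0 w := fun w => rfl
  let e1 := pr.comp f1
  let e2 := pr.comp f2
  have hCR : CoreRel e1 e2 (pr b) c n m Wp Wm E D := by
    refine ⟨le_refl _, hc0, le_refl _, ?_, hWpN, hWmN, hEN, hDN, ?_, ?_, ?_, ?_, ?_, ?_, ?_⟩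
    · change pr (f1 _) = pr (f2 _)
      rw [f1a, f2a]
    · intro j
      have := hrel _ (Or.inl <| Or.inl <| Or.inl <| Or.inl <| Or.inl <| Or.inl <| Or.inl <| Or.inl ⟨j, rfl⟩)
      simp only [map_mul, map_inv] at this; exact this
    · intro j
      have := hrel _ (Or.inl <| Or.inl <| Or.inl <| Or.inl <| Or.inl <| Or.inl <| Or.inl <| Or.inr ⟨j, rfl⟩)
      simp only [map_mul, map_inv] at this; exact this
    · intro j
      have := hrel _ (Or.inl <| Or.inl <| Or.inl <| Or.inl <| Or.inl <| Or.inl <| Or.inr ⟨j, rfl⟩)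
      simp only [map_mul, map_inv, map_zpow, b2, A] at this; exact this
    · intro j
      have := hrel _ (Or.inl <| Or.inl <| Or.inl <| Or.inl <| Or.inl <| Or.inr ⟨j, rfl⟩)
      simp only [map_mul, map_inv, map_zpow, b2, A] at this; exact this
    · have := hrel _ (Or.inl <| Or.inl <| Or.inl <| Or.inl <| Or.inr rfl)
      simp only [map_mul, map_inv, map_zpow, b2, A] at this; exact this
    · have := hrel _ (Or.inl <| Or.inl <| Or.inl <| Or.inr rfl)
      simp only [map_mul, map_inv, map_zpow, b2, A] at this; exact this
    · intro i j k hk hk'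
      have := hrel _ (Or.inl <| Or.inl <| Or.inr ⟨(i, j, ⟨k, hk, hk'⟩), rfl⟩)
      exact this
  have hgen : Subgroup.closure ({pr b} ∪ Set.range e1 ∪ Set.range e2) = ⊤ := by
    rw [eq_top_iff]
    have h1 : (Subgroup.closure (Set.range (FreeGroup.of : Γ → FreeGroup Γ))).map pr ≤
        Subgroup.closure ({pr b} ∪ Set.range e1 ∪ Set.range e2) := by
      rw [MonoidHom.map_closure, Subgroup.closure_le]
      rintro _ ⟨_, ⟨o, rfl⟩, rfl⟩
      apply Subgroup.subset_closure
      rcases o with _ | _ | j | j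
      · exact Or.inl (Or.inl rfl)
      · exact Or.inl (Or.inr ⟨fa ι, congrArg pr f1a⟩)
      · exact Or.inl (Or.inr ⟨fy j, congrArg pr (f1y j)⟩)
      · exact Or.inr ⟨fy j, congrArg pr (f2y j)⟩
    rw [FreeGroup.closure_range_of, ← MonoidHom.range_eq_map, MonoidHom.range_eq_top.2 (QuotientGroup.mk'_surjective NR)] at h1
    exact h1
  have hinj : Function.Injective π := by
    refine core_inj e1 e2 hCR hgen κ t τ p hτt hτκ hpt hpκ π ?_ ?_ ?_ S hS ?_ ?_
    · intro w; rw [map_zpow, κa]; exact hπ1 w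
    · intro w; rw [map_zpow, κa]; exact hπ2 w
    · change (π0 b).1 = t
      rw [π0b]
    · intro s hs
      exact hrel _ (Or.inl <| Or.inr ⟨s, hs, rfl⟩)
    · intro s hs
      exact hrel _ (Or.inr ⟨s, hs, rfl⟩)
  have hrange : π.range = H := by
    apply le_antisymm
    · rintro _ ⟨x, rfl⟩
      obtain ⟨w, rfl⟩ := QuotientGroup.mk'_surjective NR x
      change π0 w ∈ H
      have : (⊤ : Subgroup (FreeGroup Γ)) ≤ H.comap π0 := by
        rw [← FreeGroup.closure_range_of, Subgroup.closure_le]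
        rintro _ ⟨o, rfl⟩
        change π0 _ ∈ H
        rw [hH]
        rcases o with _ | _ | j | j
        · simp [π0, hτt, hpt, hτa, hpa]
        · simp [π0, hτa]
        · simp [π0, hτy, hpy]
        · simp [π0, hτy, hpy]
      exact this (Subgroup.mem_top w)
    · have hbH : ∀ x ∈ H, τ x.1 = 1 → x ∈ π.range := by
        intro x hx hx1
        rw [hH, hx1] at hx
        obtain ⟨w1, hw1⟩ := hex x.1 hx1
        obtain ⟨w2, hw2⟩ := hex x.2 hx.1
        have hqq : qh ι w2 = qh ι w1 := by
          rw [← hpκ, ← hpκ, hw1, hw2, hx.2]; simp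
        refine ⟨e1 w1 * e2 (fa ι ^ (-Multiplicative.toAdd (qh ι w1)) * w2), ?_⟩
        rw [map_mul]
        change π0 (f1 w1) * π0 (f2 _) = x
        rw [hπ1, hπ2, map_mul (qh ι), qh_fa_zpow, hqq, map_mul κ, map_zpow κ, κa]
        ext <;> simp [hw1, hw2]
      intro x hx
      have hbm : (t, t * a ^ n) ∈ H := by
        rw [hH]; simp [hτt, hpt, hτa, hpa]
      have h1 := hbH (x * (t, t * a ^ n) ^ (-(Multiplicative.toAdd (τ x.1))))
        (H.mul_mem hx (H.zpow_mem hbm _)) (by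
          simp only [Prod.fst_mul, Prod.pow_fst, map_mul, map_zpow, hτt]
          rw [← ofAdd_zsmul, smul_eq_mul, mul_one, ofAdd_neg, ofAdd_toAdd, mul_inv_cancel])
      have h2 : (t, t * a ^ n) ∈ π.range := ⟨pr b, π0b⟩
      have := Subgroup.mul_mem _ h1 (Subgroup.zpow_mem _ h2 (Multiplicative.toAdd (τ x.1)))
      rwa [mul_assoc, ← zpow_add, neg_add_cancel, zpow_zero, mul_one] at this
  have e := (MonoidHom.ofInjective hinj).trans (MulEquiv.subgroupCongr hrange)
  exact Group.IsFinitelyPresented.equiv e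

open scoped commutatorElement

theorem rank_two {G : Type*} [Group G] (hfg : Group.FG G) (N : Subgroup G) [hN : N.Normal]
    (hc : commutator G ≤ N) (hrk : rkQuot N hN = 2) :
    ∃ p1 p2 : G →* Multiplicative ℤ, ∃ g1 g2 : G, (∀ n ∈ N, p1 n = 1) ∧ (∀ n ∈ N, p2 n = 1) ∧
      p1 g1 = Multiplicative.ofAdd 1 ∧ p2 g1 = 1 ∧ p1 g2 = 1 ∧ p2 g2 = Multiplicative.ofAdd 1 ∧
      ∀ g, p1 g = 1 → p2 g = 1 → ∃ k : ℕ, 0 < k ∧ g ^ k ∈ N := by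
  classical
  let A := Additive (Abelianization (G ⧸ N))
  have hcomm : ∀ x y : G ⧸ N, x * y = y * x := by
    intro x y
    induction x using QuotientGroup.induction_on with | _ x
    induction y using QuotientGroup.induction_on with | _ y
    rw [← QuotientGroup.mk_mul, ← QuotientGroup.mk_mul, QuotientGroup.eq]
    apply hc
    have : (x * y)⁻¹ * (y * x) = ⁅y⁻¹, x⁻¹⁆ := by simp [commutatorElement_def, mul_assoc]
    rw [this]
    exact Subgroup.commutator_mem_commutator (Subgroup.mem_top _) (Subgroup.mem_top _)
  have hinj : ∀ x : G ⧸ N, Abelianization.of x = 1 → x = 1 := by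
    intro x hx
    have : x ∈ (Abelianization.of : (G ⧸ N) →* _).ker := hx
    rw [Abelianization.ker_of] at this
    have h2 : commutator (G ⧸ N) = ⊥ := by
      rw [commutator_def, Subgroup.commutator_eq_bot_iff_le_centralizer]
      intro z _ w _
      exact hcomm _ _
    rw [h2] at this
    exact this
  have h1 : Module.finrank ℤ A = 2 := hrk
  have hfgA : Module.Finite ℤ A := by
    rw [Module.Finite.iff_addGroup_fg, ← GroupFG.iff_add_fg]
    exact Group.fg_of_surjective (f := (Abelianization.of : (G ⧸ N) →* _)) (QuotientGroup.mk'_surjective _)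
  let T := Submodule.torsion ℤ A
  have hT0 : Module.finrank ℤ T = 0 := by
    rw [Module.finrank_eq_zero_iff_isTorsion]
    exact Submodule.torsion_isTorsion
  have h2 : Module.finrank ℤ (A ⧸ T) = 2 := by
    have := Submodule.finrank_quotient_add_finrank T
    omega
  have : Module.IsTorsionFree ℤ (A ⧸ T) := inferInstance
  have : Module.Free ℤ (A ⧸ T) := Module.free_of_finite_type_torsion_free'
  let b : Module.Basis (Fin 2) ℤ (A ⧸ T) := Module.finBasisOfFinrankEq ℤ _ h2
  let φ : G → A := fun g => Additive.ofMul (Abelianization.of (QuotientGroup.mk g : G ⧸ N))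
  have hφ : Function.Surjective φ := by
    intro a
    obtain ⟨q, hq⟩ := QuotientGroup.mk_surjective (s := commutator (G ⧸ N)) (Additive.toMul a)
    obtain ⟨g, rfl⟩ := QuotientGroup.mk_surjective q
    exact ⟨g, congrArg Additive.ofMul hq⟩
  let p : Fin 2 → (G →* Multiplicative ℤ) := fun i =>
    { toFun := fun g => Multiplicative.ofAdd (b.repr (T.mkQ (φ g)) i)
      map_one' := by
        have : φ 1 = 0 := by simp [φ]
        simp [this]
      map_mul' := by
        intro x y
        have : φ (x * y) = φ x + φ y := by simp [φ]
        simp [this] }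
  have hpN : ∀ i, ∀ n ∈ N, p i n = 1 := by
    intro i n hn
    have : φ n = 0 := by
      simp [φ, (QuotientGroup.eq_one_iff n).2 hn]
    show Multiplicative.ofAdd (b.repr (T.mkQ (φ n)) i) = 1
    simp [this]
  have hex : ∀ i, ∃ g, ∀ j, p j g = Multiplicative.ofAdd (if i = j then 1 else 0) := by
    intro i
    obtain ⟨x, hx⟩ := Submodule.mkQ_surjective T (b i)
    obtain ⟨g, rfl⟩ := hφ x
    refine ⟨g, fun j => ?_⟩
    show Multiplicative.ofAdd (b.repr (T.mkQ (φ g)) j) = _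
    rw [hx, Module.Basis.repr_self, Finsupp.single_apply]
  obtain ⟨g1, hg1⟩ := hex 0
  obtain ⟨g2, hg2⟩ := hex 1
  refine ⟨p 0, p 1, g1, g2, hpN 0, hpN 1, by simpa using hg1 0, by simpa using hg1 1, by simpa using hg2 0, by simpa using hg2 1, ?_⟩
  intro g h0 h1
  have h0' : b.repr (T.mkQ (φ g)) 0 = 0 := Multiplicative.ofAdd.injective h0
  have h1' : b.repr (T.mkQ (φ g)) 1 = 0 := Multiplicative.ofAdd.injective h1
  have hz : T.mkQ (φ g) = 0 := by
    apply b.repr.injective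
    ext i
    fin_cases i
    · simpa using h0'
    · simpa using h1'
  have hmem : φ g ∈ T := by simpa using hz
  rw [Submodule.mem_torsion_iff] at hmem
  obtain ⟨⟨a, ha⟩, hag⟩ := hmem
  have ha0 : a ≠ 0 := nonZeroDivisors.ne_zero ha
  have hag' : a • φ g = 0 := hag
  refine ⟨a.natAbs, Int.natAbs_pos.2 ha0, ?_⟩
  have h3 : a.natAbs • φ g = 0 := by
    rcases Int.natAbs_eq a with h | h
    · rw [h] at hag'
      simpa using hag'
    · rw [h] at hag'
      simpa using hag'
  rw [← QuotientGroup.eq_one_iff, QuotientGroup.mk_pow]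
  apply hinj
  rw [map_pow]
  exact congrArg Additive.toMul h3

open scoped commutatorElement

theorem quot_comm {G : Type*} [Group G] (N : Subgroup G) [N.Normal]
    (hc : commutator G ≤ N) (x y : G ⧸ N) : x * y = y * x := by
  induction x using QuotientGroup.induction_on with | _ x
  induction y using QuotientGroup.induction_on with | _ y
  rw [← QuotientGroup.mk_mul, ← QuotientGroup.mk_mul, QuotientGroup.eq]
  apply hc
  have : (x * y)⁻¹ * (y * x) = ⁅y⁻¹, x⁻¹⁆ := by simp [commutatorElement_def, mul_assoc]
  rw [this]
  exact Subgroup.commutator_mem_commutator (Subgroup.mem_top _) (Subgroup.mem_top _)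

theorem normal_of_comm_le {G : Type*} [Group G] (K : Subgroup G) (hc : commutator G ≤ K) :
    K.Normal := by
  constructor
  intro n hn g
  have : g * n * g⁻¹ = ⁅g, n⁆ * n := by simp [commutatorElement_def]
  rw [this]
  exact K.mul_mem (hc (Subgroup.commutator_mem_commutator (Subgroup.mem_top _) (Subgroup.mem_top _))) hn

theorem tau_exists {G : Type*} [Group G] (K : Subgroup G) [K.Normal] (t : G)
    (ht : ¬ IsOfFinOrder t) (h1 : K ⊔ Subgroup.zpowers t = ⊤) (h2 : K ⊓ Subgroup.zpowers t = ⊥) :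
    ∃ τ : G →* Multiplicative ℤ, τ.ker = K ∧ τ t = Multiplicative.ofAdd 1 := by
  have hex : ∀ g : G, ∃ n : ℤ, g * t ^ (-n) ∈ K := by
    intro g
    have : g ∈ K ⊔ Subgroup.zpowers t := by rw [h1]; trivial
    rw [← SetLike.mem_coe, Subgroup.normal_mul] at this
    obtain ⟨k, hk, z, hz, rfl⟩ := this
    obtain ⟨n, rfl⟩ := hz
    exact ⟨n, by simpa using hk⟩
  have huniq : ∀ n : ℤ, t ^ n ∈ K → n = 0 := by
    intro n hn
    have : t ^ n ∈ K ⊓ Subgroup.zpowers t := ⟨hn, n, rfl⟩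
    rw [h2, Subgroup.mem_bot] at this
    by_contra hne
    exact ht (isOfFinOrder_iff_zpow_eq_one.2 ⟨n, hne, this⟩)
  choose f hf using hex
  have key : ∀ g n, g * t ^ (-n) ∈ K → f g = n := by
    intro g n h
    have := K.mul_mem (K.inv_mem (hf g)) h
    have h3 : t ^ (-n + f g) ∈ K := by
      have h4 := (inferInstance : K.Normal).conj_mem _ this (t ^ (-f g))
      have h5 : t ^ (-f g) * ((g * t ^ (-f g))⁻¹ * (g * t ^ (-n))) * (t ^ (-f g))⁻¹ = t ^ (-n + f g) := by
        rw [zpow_add]; simp [mul_assoc]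
      rwa [h5] at h4
    have := huniq _ h3
    omega
  have hmul : ∀ x y, f (x * y) = f x + f y := by
    intro x y
    apply key
    have := K.mul_mem ((inferInstance : K.Normal).conj_mem _ (hf y) x) (hf x)
    have h4 := K.mul_mem (hf x) ((inferInstance : K.Normal).conj_mem _ (hf y) (t ^ (f x)))
    have h5 : (x * t ^ (-f x)) * (t ^ f x * (y * t ^ (-f y)) * (t ^ f x)⁻¹) = x * y * t ^ (-(f x + f y)) := by
      rw [neg_add, zpow_add]
      have : t ^ (-f y) * t ^ (-f x) = t ^ (-f x) * t ^ (-f y) := by rw [← zpow_add, ← zpow_add, add_comm]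
      simp only [zpow_neg] at this ⊢
      simp [mul_assoc, this]
    rwa [h5] at h4
  refine ⟨MonoidHom.mk' (fun g => Multiplicative.ofAdd (f g)) (fun x y => by rw [hmul]; rfl), ?_, ?_⟩
  · ext g
    constructor
    · intro hg
      have : f g = 0 := Multiplicative.ofAdd.injective hg
      simpa [this] using hf g
    · intro hg
      have : f g = 0 := key g 0 (by simpa using hg)
      show Multiplicative.ofAdd (f g) = 1
      rw [this]; rfl
  · show Multiplicative.ofAdd (f t) = _
    rw [key t 1 (by simp)]

/-- characters trivial on `N` are combinations of `p1`, `p2`. -/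
theorem char_comb {G : Type*} [Group G] (N : Subgroup G)
    (p1 p2 : G →* Multiplicative ℤ) (g1 g2 : G)
    (h11 : p1 g1 = Multiplicative.ofAdd 1) (h21 : p2 g1 = 1) (h12 : p1 g2 = 1)
    (h22 : p2 g2 = Multiplicative.ofAdd 1)
    (hk : ∀ g, p1 g = 1 → p2 g = 1 → ∃ k : ℕ, 0 < k ∧ g ^ k ∈ N)
    (χ : G →* Multiplicative ℤ) (hχ : ∀ n ∈ N, χ n = 1) (g : G) :
    (χ g).toAdd = (p1 g).toAdd * (χ g1).toAdd + (p2 g).toAdd * (χ g2).toAdd := by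
  set w := g * (g1 ^ (p1 g).toAdd)⁻¹ * (g2 ^ (p2 g).toAdd)⁻¹ with hw
  have hw1 : p1 w = 1 := by
    apply Multiplicative.toAdd.injective
    simp [hw, h11, h12]
  have hw2 : p2 w = 1 := by
    apply Multiplicative.toAdd.injective
    simp [hw, h21, h22]
  obtain ⟨k, hk0, hkN⟩ := hk w hw1 hw2
  have h3 := congrArg Multiplicative.toAdd (hχ _ hkN)
  rw [map_pow, toAdd_pow, toAdd_one, smul_eq_zero] at h3
  rcases h3 with h3 | h3
  · omega
  · simp [hw] at h3
    linarith

theorem backward {G : Type*} [Group G] (hG : Group.IsFinitelyPresented G)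
    (N : Subgroup G) [hN : N.Normal] (hc : commutator G ≤ N)
    (hrk : rkQuot N hN = 2) (t : G) (K : Subgroup G) (ht : ¬ IsOfFinOrder t) (hNK : N ≤ K)
    (hK : K.FG) (h1 : K ⊔ Subgroup.zpowers t = ⊤) (h2 : K ⊓ Subgroup.zpowers t = ⊥) :
    ∃ μ : (G ⧸ N) ≃* (G ⧸ N), Group.IsFinitelyPresented (fibreProduct N N μ) := by
  have := normal_of_comm_le K (hc.trans hNK)
  obtain ⟨τ, hτK, hτt⟩ := tau_exists K t ht h1 h2
  obtain ⟨p1, p2, g1, g2, hp1N, hp2N, h11, h21, h12, h22, hk⟩ := rank_two (fg_of_fp hG) N hc hrk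
  have hτN : ∀ n ∈ N, τ n = 1 := fun n hn => by
    have : n ∈ τ.ker := by rw [hτK]; exact hNK hn
    exact this
  have hcomb := char_comb N p1 p2 g1 g2 h11 h21 h12 h22 hk τ hτN
  set u := (τ g1).toAdd with hu
  set v := (τ g2).toAdd with hv
  set x0 := (p1 t).toAdd with hx0
  set y0 := (p2 t).toAdd with hy0
  have hbez : x0 * u + y0 * v = 1 := by
    rw [hx0, hy0, ← hcomb t, hτt]; rfl
  let p : G →* Multiplicative ℤ := p1 ^ (-y0) * p2 ^ x0
  have hp : ∀ g, (p g).toAdd = -y0 * (p1 g).toAdd + x0 * (p2 g).toAdd := by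
    intro g
    simp [p]
  let a := g1 ^ (-v) * g2 ^ u
  obtain ⟨n, hn⟩ := Hprime_fp hG τ p t a hτt
    (Multiplicative.toAdd.injective (by rw [hp, toAdd_one]; ring))
    (Multiplicative.toAdd.injective (by simp [a, ← hu, ← hv]; ring))
    (Multiplicative.toAdd.injective (by rw [hp]; simp [a, h11, h12, h21, h22]; linarith))
    (by rw [hτK]; exact hK)
  have hτa : τ a = 1 := (Multiplicative.toAdd.injective (by simp [a, ← hu, ← hv]; ring))
  have hpa : p a = Multiplicative.ofAdd 1 := 
    (Multiplicative.toAdd.injective (by rw [hp]; simp [a, h11, h12, h21, h22]; linarith))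
  letI : CommGroup (G ⧸ N) := { (inferInstance : Group (G ⧸ N)) with mul_comm := quot_comm N hc }
  have hpN : ∀ n ∈ N, p n = 1 := fun n hn => by
    apply Multiplicative.toAdd.injective
    rw [hp, hp1N n hn, hp2N n hn]; simp
  let τb : (G ⧸ N) →* Multiplicative ℤ := QuotientGroup.lift N τ hτN
  let pb : (G ⧸ N) →* Multiplicative ℤ := QuotientGroup.lift N p hpN
  let ab : G ⧸ N := QuotientGroup.mk a
  have hτab : τb ab = 1 := hτa
  have hpab : pb ab = Multiplicative.ofAdd 1 := hpa
  let m : ℤ → ((G ⧸ N) →* (G ⧸ N)) := fun n =>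
    { toFun := fun q => q * ab ^ (n * (τb q).toAdd)
      map_one' := by simp
      map_mul' := by
        intro x y
        rw [map_mul, toAdd_mul, mul_add, zpow_add]
        exact mul_mul_mul_comm _ _ _ _ }
  have hm : ∀ n q, m n q = q * ab ^ (n * (τb q).toAdd) := fun _ _ => rfl
  have hτm : ∀ n q, τb (m n q) = τb q := by
    intro n q
    rw [hm, map_mul, map_zpow, hτab, one_zpow, mul_one]
  have hpm : ∀ n q, pb (m n q) = pb q * τb q ^ n := by
    intro n q
    rw [hm, map_mul, map_zpow, hpab]
    apply Multiplicative.toAdd.injective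
    simp
  have hmm : ∀ n q, m (-n) (m n q) = q := by
    intro n q
    rw [hm (-n), hτm, hm, mul_assoc, ← zpow_add]
    simp
  let μ : (G ⧸ N) ≃* (G ⧸ N) :=
    { m n with
      invFun := m (-n)
      left_inv := hmm n
      right_inv := fun q => by have := hmm (-n) q; rwa [neg_neg] at this }
  have hμ : ∀ q, μ q = m n q := fun _ => rfl
  refine ⟨μ, ?_⟩
  let H' : Subgroup (G × G) :=
    MonoidHom.eqLocus (τ.comp (MonoidHom.snd G G)) (τ.comp (MonoidHom.fst G G)) ⊓
      MonoidHom.eqLocus (p.comp (MonoidHom.snd G G))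
        ((p.comp (MonoidHom.fst G G)) * (τ.comp (MonoidHom.fst G G)) ^ n)
  have hH' : ∀ x, x ∈ H' ↔ τ x.2 = τ x.1 ∧ p x.2 = p x.1 * τ x.1 ^ n := fun x => Iff.rfl
  have hH'fp := hn H' hH'
  let F := fibreProduct N N μ
  have hF : ∀ x : G × G, x ∈ F ↔ μ (QuotientGroup.mk x.1) = QuotientGroup.mk x.2 := fun _ => Iff.rfl
  have hFH : F ≤ H' := by
    intro x hx
    rw [hF] at hx
    rw [hH']
    constructor
    · have := hτm n (QuotientGroup.mk x.1)
      rw [← hμ, hx] at this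
      exact this
    · have := hpm n (QuotientGroup.mk x.1)
      rw [← hμ, hx] at this
      exact this
  let d : H' →* G ⧸ N :=
    ((QuotientGroup.mk' N).comp (MonoidHom.snd G G)).comp H'.subtype *
      (μ.toMonoidHom.comp ((QuotientGroup.mk' N).comp ((MonoidHom.fst G G).comp H'.subtype)))⁻¹
  have hd : ∀ x : H', d x = QuotientGroup.mk x.1.2 * (μ (QuotientGroup.mk x.1.1))⁻¹ := fun _ => rfl
  have hker : F.subgroupOf H' = d.ker := by
    ext x
    rw [Subgroup.mem_subgroupOf, MonoidHom.mem_ker, hd, mul_inv_eq_one, hF, eq_comm]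
  have hrange : Finite d.range := by
    have := fg_of_fp hH'fp
    have : Group.FG d.range := Group.fg_range d
    apply CommGroup.finite_of_fg_torsion
    rintro ⟨_, x, rfl⟩
    obtain ⟨w, hw⟩ := QuotientGroup.mk_surjective (d x)
    have hx := (hH' _).1 x.2
    have e1 : τ w = 1 := by
      show τb (QuotientGroup.mk w) = 1
      rw [hw, hd, map_mul, map_inv, hμ, hτm, mul_inv_eq_one]
      exact hx.1
    have e2 : p w = 1 := by
      show pb (QuotientGroup.mk w) = 1
      rw [hw, hd, map_mul, map_inv, hμ, hpm, mul_inv_eq_one]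
      exact hx.2
    have e1' := congrArg Multiplicative.toAdd e1
    have e2' := congrArg Multiplicative.toAdd e2
    rw [hp, toAdd_one] at e2'
    rw [hcomb, toAdd_one] at e1'
    have e3 : p1 w = 1 := Multiplicative.toAdd.injective (by
      rw [toAdd_one]
      linear_combination x0 * e1' - v * e2' - (p1 w).toAdd * hbez)
    have e4 : p2 w = 1 := Multiplicative.toAdd.injective (by
      rw [toAdd_one]
      linear_combination y0 * e1' + u * e2' - (p2 w).toAdd * hbez)
    obtain ⟨k, hk0, hkN⟩ := hk w e3 e4
    rw [isOfFinOrder_iff_pow_eq_one]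
    refine ⟨k, hk0, Subtype.ext ?_⟩
    show (d x) ^ k = 1
    rw [← hw, ← QuotientGroup.mk_pow, QuotientGroup.eq_one_iff]
    exact hkN
  have hfi : (F.subgroupOf H').FiniteIndex := by
    rw [hker]; exact Subgroup.finiteIndex_ker d
  have := fp_finite_index hH'fp (F.subgroupOf H')
  exact Group.IsFinitelyPresented.equiv (Subgroup.subgroupOfEquivOfLe hFH)

open scoped commutatorElement

/-- Paths in the (left) Cayley graph with steps in `S` and staying in `U`. -/
def Reach {Γ : Type*} [Group Γ] (S U : Set Γ) : Γ → Γ → Prop :=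
  Relation.ReflTransGen (fun g h => g ∈ U ∧ h ∈ U ∧ ∃ x ∈ S, h = x * g)

namespace Reach
variable {Γ : Type*} [Group Γ] {S S' U V : Set Γ} {u v w : Γ}

theorem refl : Reach S U u u := Relation.ReflTransGen.refl
theorem trans (h1 : Reach S U u v) (h2 : Reach S U v w) : Reach S U u w :=
  Relation.ReflTransGen.trans h1 h2
theorem step {x : Γ} (hx : x ∈ S) (hu : u ∈ U) (hv : x * u ∈ U) : Reach S U u (x * u) :=
  Relation.ReflTransGen.single ⟨hu, hv, x, hx, rfl⟩
theorem mono (hS : S ⊆ S') (hU : U ⊆ V) (h : Reach S U u v) : Reach S' V u v :=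
  Relation.ReflTransGen.mono (fun _ _ h => by
    obtain ⟨h1, h2, x, hx, h3⟩ := h
    exact ⟨hU h1, hU h2, x, hS hx, h3⟩) _ _ h
theorem symm (hS : ∀ x ∈ S, x⁻¹ ∈ S) (h : Reach S U u v) : Reach S U v u := by
  induction h with
  | refl => exact refl
  | tail _ h ih =>
    obtain ⟨h1, h2, x, hx, rfl⟩ := h
    refine trans (Relation.ReflTransGen.single ⟨h2, h1, x⁻¹, hS x hx, ?_⟩) ih
    simp
theorem translate (c : Γ) (h : Reach S U u v) (hU : ∀ g ∈ U, g * c ∈ V) :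
    Reach S V (u * c) (v * c) := by
  induction h with
  | refl => exact refl
  | tail _ h ih =>
    obtain ⟨h1, h2, x, hx, rfl⟩ := h
    exact trans ih (Relation.ReflTransGen.single ⟨hU _ h1, hU _ h2, x, hx, by rw [mul_assoc]⟩)
theorem map {Δ : Type*} [Group Δ] (f : Γ →* Δ) {S' V : Set Δ} (hS : ∀ x ∈ S, f x ∈ S')
    (hU : ∀ x ∈ U, f x ∈ V) (h : Reach S U u v) : Reach S' V (f u) (f v) := by
  induction h with
  | refl => exact refl
  | tail _ h ih =>
    obtain ⟨h1, h2, x, hx, rfl⟩ := h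
    exact trans ih (Relation.ReflTransGen.single ⟨hU _ h1, hU _ h2, f x, hS x hx, by rw [map_mul]⟩)
/-- lift a path along a homomorphism -/
theorem lift {Δ : Type*} [Group Δ] (f : Γ →* Δ) {V : Set Δ} {d : Δ}
    (h : Reach (f '' S) V (f u) d) : ∃ v, f v = d ∧ Reach S (f ⁻¹' V) u v := by
  induction h with
  | refl => exact ⟨u, rfl, refl⟩
  | tail _ h ih =>
    obtain ⟨h1, h2, x, ⟨y, hy, rfl⟩, rfl⟩ := h
    obtain ⟨v, rfl, hv⟩ := ih
    refine ⟨y * v, by simp, hv.trans (step hy h1 ?_)⟩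
    simpa using h2
theorem end_mem (h : Reach S U u v) (hu : u ∈ U) : v ∈ U := by
  induction h with
  | refl => exact hu
  | tail _ h ih => exact h.2.1
end Reach

/-- additive characters -/
def IsChar {Γ : Type*} [Group Γ] (ψ : Γ → ℝ) : Prop := ∀ x y, ψ (x * y) = ψ x + ψ y

namespace IsChar
variable {Γ : Type*} [Group Γ] {ψ : Γ → ℝ}
theorem one (h : IsChar ψ) : ψ 1 = 0 := by have := h 1 1; simp at this; exact this
theorem inv (h : IsChar ψ) (x : Γ) : ψ x⁻¹ = -ψ x := by
  have := h x⁻¹ x; rw [inv_mul_cancel, h.one] at this; linarith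
theorem neg (h : IsChar ψ) : IsChar (fun x => - ψ x) := fun x y => by
  show -ψ (x * y) = _
  rw [h x y]; ring
theorem conj (h : IsChar ψ) (u y : Γ) : ψ (u⁻¹ * y * u) = ψ y := by
  rw [h, h, h.inv]; ring
theorem pow (h : IsChar ψ) (x : Γ) (n : ℕ) : ψ (x ^ n) = n * ψ x := by
  induction n with
  | zero => simp [h.one]
  | succ n ih => rw [pow_succ, h, ih]; push_cast; ring
end IsChar

theorem exists_list_mem_closure_aux {Γ : Type*} [Group Γ] {S : Set Γ} {w : Γ}
    (hw : w ∈ Subgroup.closure S) : ∃ l : List Γ, (∀ x ∈ l, x ∈ S ∨ x⁻¹ ∈ S) ∧ l.prod = w := by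
  rw [← Subgroup.mem_toSubmonoid, Subgroup.closure_toSubmonoid] at hw
  obtain ⟨l, hl, h⟩ := Submonoid.exists_list_of_mem_closure hw
  exact ⟨l, fun x hx => by simpa using hl x hx, h⟩

theorem exists_reach {Γ : Type*} [Group Γ] {S : Set Γ} (hS : ∀ x ∈ S, x⁻¹ ∈ S)
    (hgen : Subgroup.closure S = ⊤) (w : Γ) : ∃ l : List Γ, (∀ x ∈ l, x ∈ S) ∧ l.prod = w := by
  have hw : w ∈ Subgroup.closure S := by rw [hgen]; trivial
  obtain ⟨l, hl, rfl⟩ := exists_list_mem_closure_aux hw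
  refine ⟨l, fun x hx => ?_, rfl⟩
  rcases hl x hx with h | h
  · exact h
  · simpa using hS _ h

theorem reach_bdd {Γ : Type*} [Group Γ] {S : Set Γ} (hS : ∀ x ∈ S, x⁻¹ ∈ S)
    (hgen : Subgroup.closure S = ⊤) (ψ : Γ → ℝ) (w : Γ) :
    ∃ B : ℝ, Reach S {g | |ψ g| ≤ B} 1 w := by
  obtain ⟨l, hl, rfl⟩ := exists_reach hS hgen w
  induction l with
  | nil => exact ⟨0, Reach.refl⟩
  | cons x l ih =>
    obtain ⟨B, hB⟩ := ih (fun y hy => hl y (List.mem_cons_of_mem _ hy))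
    refine ⟨max B (max |ψ l.prod| |ψ (x * l.prod)|), ?_⟩
    rw [List.prod_cons]
    refine (hB.mono subset_rfl ?_).trans (Reach.step (hl x (by simp)) ?_ ?_)
    · intro g (hg : |ψ g| ≤ B); exact (le_trans hg (le_max_left _ _) : |ψ g| ≤ _)
    · exact (le_trans (le_max_left _ _) (le_max_right _ _) : |ψ l.prod| ≤ _)
    · exact (le_trans (le_max_right _ _) (le_max_right _ _) : |ψ (x * l.prod)| ≤ _)

theorem finite_bound {α : Type*} {Y : Set α} (hY : Y.Finite) (P : α → ℝ → Prop)
    (hP : ∀ y B B', B ≤ B' → P y B → P y B') (h : ∀ y ∈ Y, ∃ B, P y B) :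
    ∃ B : ℝ, 0 ≤ B ∧ ∀ y ∈ Y, P y B := by
  induction Y, hY using Set.Finite.induction_on with
  | empty => exact ⟨0, le_rfl, by simp⟩
  | insert _ _ ih =>
    obtain ⟨B, h0, hB⟩ := ih (fun y hy => h y (Set.mem_insert_of_mem _ hy))
    obtain ⟨B', hB'⟩ := h _ (Set.mem_insert _ _)
    refine ⟨max B B', le_max_of_le_left h0, ?_⟩
    rintro y (rfl | hy)
    · exact hP _ _ _ (le_max_right _ _) hB'
    · exact hP _ _ _ (le_max_left _ _) (hB y hy)

theorem mono_list {Γ : Type*} [Group Γ] {S : Set Γ} {ψ : Γ → ℝ} (hψ : IsChar ψ) (l : List Γ)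
    (hl : ∀ x ∈ l, x ∈ S) (h0 : ∀ x ∈ l, 0 ≤ ψ x) :
    0 ≤ ψ l.prod ∧ Reach S {g | 0 ≤ ψ g ∧ ψ g ≤ ψ l.prod} 1 l.prod := by
  induction l with
  | nil => exact ⟨by simp [hψ.one], Reach.refl⟩
  | cons x l ih =>
    obtain ⟨h1, h2⟩ := ih (fun y hy => hl y (List.mem_cons_of_mem _ hy))
      (fun y hy => h0 y (List.mem_cons_of_mem _ hy))
    have hx := h0 x (by simp)
    have e : ψ (x :: l).prod = ψ x + ψ l.prod := by rw [List.prod_cons, hψ]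
    refine ⟨by rw [e]; linarith, ?_⟩
    rw [e, List.prod_cons]
    refine (h2.mono subset_rfl ?_).trans (Reach.step (hl x (by simp)) ?_ ?_)
    · rintro g ⟨h3, h4⟩; exact ⟨h3, by linarith⟩
    · exact ⟨h1, by linarith⟩
    · refine ⟨?_, ?_⟩ <;> rw [hψ] <;> linarith

/-- every word is, up to permutation, one staying on one side. -/
theorem sort_down {Γ : Type*} [Group Γ] {S : Set Γ} {ψ : Γ → ℝ} (hψ : IsChar ψ) (l : List Γ)
    (hl : ∀ x ∈ l, x ∈ S) (h0 : ψ l.prod ≤ 0) :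
    ∃ l' : List Γ, l.Perm l' ∧ Reach S {g | ψ g ≤ 0} 1 l'.prod := by
  classical
  let pos := l.filter (fun x => 0 ≤ ψ x)
  let neg := l.filter (fun x => ! decide (0 ≤ ψ x))
  have hperm : (pos ++ neg).Perm l := List.filter_append_perm _ l
  have hsum : ∀ l : List Γ, ψ l.prod = (l.map ψ).sum := by
    intro l
    induction l with
    | nil => simp [hψ.one]
    | cons x l ih => simp [hψ x, ih]
  have hps : ψ (pos ++ neg).prod ≤ 0 := by
    rw [hsum, (hperm.map ψ).sum_eq, ← hsum]; exact h0
  refine ⟨pos ++ neg, hperm.symm, ?_⟩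
  rw [List.prod_append] at hps ⊢
  rw [hψ] at hps
  obtain ⟨-, h1⟩ := mono_list (S := S) hψ pos (fun x hx => hl x (List.mem_of_mem_filter hx))
    (fun x hx => by simpa using List.of_mem_filter hx)
  obtain ⟨-, h2⟩ := mono_list (S := S) hψ.neg neg (fun x hx => hl x (List.mem_of_mem_filter hx))
    (fun x hx => by have := List.of_mem_filter hx; simp at this; linarith)
  refine (h2.mono subset_rfl ?_).trans ?_
  · rintro g ⟨h3, h4⟩
    show ψ g ≤ 0
    linarith
  · have := h1.translate (V := {g | ψ g ≤ 0}) neg.prod ?_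
    · simpa using this
    · rintro g ⟨h3, h4⟩
      show ψ _ ≤ 0
      rw [hψ]; linarith

theorem conj_down {Γ : Type*} [Group Γ] {S : Set Γ} (hS : ∀ x ∈ S, x⁻¹ ∈ S)
    {ψ : Γ → ℝ} (hψ : IsChar ψ) {u y : Γ}
    {B : ℝ} (hB : 0 ≤ B) (hu0 : ψ u ≤ 0) (hu : Reach S {g | ψ g ≤ 0} 1 u) (hy0 : ψ y = 0)
    (hy : Reach S {g | |ψ g| ≤ B} 1 y) : Reach S {g | ψ g ≤ B} 1 (u⁻¹ * y * u) := by
  refine ((hu.mono subset_rfl ?_).trans ?_).trans ?_ (v := y * u)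
  · intro g (hg : ψ g ≤ 0)
    show ψ g ≤ B
    linarith
  · have := hy.translate (V := {g | ψ g ≤ B}) u ?_
    · simpa using this
    · intro g (hg : |ψ g| ≤ B)
      show ψ _ ≤ B
      rw [hψ]; linarith [le_abs_self (ψ g)]
  · have := (hu.symm hS).translate (V := {g | ψ g ≤ B}) (u⁻¹ * y * u) ?_
    · simpa [mul_assoc] using this
    · intro g (hg : ψ g ≤ 0)
      show ψ _ ≤ B
      rw [hψ, hψ.conj, hy0]; linarith

theorem perm_prod {Γ : Type*} [Group Γ] {S Y : Set Γ} {N0 M2 : Subgroup Γ} [M2.Normal]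
    (hc : ∀ s ∈ S, ∀ s' ∈ S, ∃ c ∈ Y, ∃ m ∈ M2, s * s' = s' * s * (c * m))
    {l l' : List Γ} (hp : l.Perm l') : (∀ x ∈ l, x ∈ S) → 
    (∀ l2 : List Γ, (∀ x ∈ l2, x ∈ S) → l2.length < l.length → ∀ y ∈ Y,
      l2.prod⁻¹ * y * l2.prod ∈ N0) →
    ∃ e ∈ N0 ⊔ M2, l.prod = l'.prod * e := by
  induction hp with
  | nil => intro _ _; exact ⟨1, one_mem _, by simp⟩
  | cons x _ ih =>
    intro hl h
    obtain ⟨e, he, h1⟩ := ih (fun y hy => hl y (List.mem_cons_of_mem _ hy))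
      (fun l2 h2 h3 => h l2 h2 (by simp; omega))
    exact ⟨e, he, by rw [List.prod_cons, h1, List.prod_cons, mul_assoc]⟩
  | swap x y l =>
    intro hl h
    obtain ⟨c, hc1, m, hm, h1⟩ := hc y (hl y (by simp)) x (hl x (by simp))
    refine ⟨(l.prod⁻¹ * c * l.prod) * (l.prod⁻¹ * m * l.prod), ?_, ?_⟩
    · refine mul_mem (Subgroup.mem_sup_left ?_) (Subgroup.mem_sup_right ?_)
      · exact h l (fun z hz => hl z (by simp [hz])) (by simp) c hc1
      · simpa using (inferInstance : M2.Normal).conj_mem m hm l.prod⁻¹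
    · rw [List.prod_cons, List.prod_cons, ← mul_assoc, h1]
      simp [mul_assoc]
  | trans h12 h23 ih1 ih2 =>
    intro hl h
    obtain ⟨e, he, h1⟩ := ih1 hl h
    obtain ⟨e', he', h2⟩ := ih2 (fun x hx => hl x (h12.mem_iff.2 hx))
      (by rw [← h12.length_eq]; exact h)
    exact ⟨e' * e, mul_mem he' he, by rw [h1, h2, mul_assoc]⟩

theorem gen_lemma {Γ : Type*} [Group Γ] {S : Set Γ} (hSf : S.Finite) (hS : ∀ x ∈ S, x⁻¹ ∈ S)
    (hgen : Subgroup.closure S = ⊤) {ψ : Γ → ℝ} (hψ : IsChar ψ) (M1 M2 : Subgroup Γ)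
    [M1.Normal] [M2.Normal] (hM1 : M1.IsFinitelyNormallyGenerated)
    (hcomm : ∀ x ∈ M1, ∀ y ∈ M2, x * y = y * x) (hab : commutator Γ ≤ M1 ⊔ M2)
    (h1 : ∀ x ∈ M1, ψ x = 0) :
    ∃ a0 : ℝ, 0 ≤ a0 ∧ ∀ a, a0 ≤ a → 
      M1 ≤ Subgroup.closure {n | n ∈ M1 ∧ (Reach S {g | -a ≤ ψ g} 1 n ∨ Reach S {g | ψ g ≤ a} 1 n)} := by
  classical
  obtain ⟨Y1, hY1f, hY1⟩ := hM1
  have hcc : ∀ s s' : Γ, ∃ c ∈ M1, ∃ m ∈ M2, s * s' = s' * s * (c * m) := by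
    intro s s'
    have h : (s' * s)⁻¹ * (s * s') ∈ M1 ⊔ M2 := by
      apply hab
      have : (s' * s)⁻¹ * (s * s') = ⁅s⁻¹, s'⁻¹⁆ := by simp [commutatorElement_def, mul_assoc]
      rw [this]
      exact Subgroup.commutator_mem_commutator (Subgroup.mem_top _) (Subgroup.mem_top _)
    rw [← SetLike.mem_coe, Subgroup.normal_mul] at h
    obtain ⟨c, hc, m, hm, h⟩ := h
    refine ⟨c, hc, m, hm, ?_⟩
    simp only at h
    rw [h, mul_inv_cancel_left]
  choose c hc m hm hcm using hcc
  let Y := Y1 ∪ Set.image2 c S S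
  have hYf : Y.Finite := hY1f.union (hSf.image2 _ hSf)
  have hYM : ∀ y ∈ Y, y ∈ M1 := by
    rintro y (hy | ⟨s, _, s', _, rfl⟩)
    · rw [← hY1]; exact Subgroup.subset_normalClosure hy
    · exact hc _ _
  obtain ⟨a0, ha0, hB⟩ := finite_bound hYf (fun y B => Reach S {g | |ψ g| ≤ B} 1 y)
    (fun y B B' hBB h => h.mono subset_rfl (fun g (hg : _ ≤ _) => le_trans hg hBB))
    (fun y _ => reach_bdd hS hgen ψ y)
  refine ⟨a0, ha0, fun a ha => ?_⟩
  set N0 := Subgroup.closure {n | n ∈ M1 ∧ (Reach S {g | -a ≤ ψ g} 1 n ∨ Reach S {g | ψ g ≤ a} 1 n)} with hN0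
  have hN0M : N0 ≤ M1 := by
    rw [hN0, Subgroup.closure_le]; exact fun x hx => hx.1
  have key : ∀ n : ℕ, ∀ l : List Γ, l.length = n → (∀ x ∈ l, x ∈ S) → ∀ y ∈ Y, l.prod⁻¹ * y * l.prod ∈ N0 := by
    intro n
    induction n using Nat.strong_induction_on with
    | _ n ih =>
    intro l hln hl y hy
    have hy0 := h1 y (hYM y hy)
    have hyB := (hB y hy).mono (S' := S) (V := {g | |ψ g| ≤ a}) subset_rfl (fun g (hg : _ ≤ _) => le_trans hg ha)
    have hex : ∃ l', l.Perm l' ∧ l'.prod⁻¹ * y * l'.prod ∈ N0 := by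
      have hmem : ∀ u : Γ, u⁻¹ * y * u ∈ M1 := fun u => by
        simpa using (inferInstance : M1.Normal).conj_mem y (hYM y hy) u⁻¹
      rcases le_total (ψ l.prod) 0 with h | h
      · obtain ⟨l', hp, hr⟩ := sort_down hψ l hl h
        refine ⟨l', hp, Subgroup.subset_closure ⟨hmem _, Or.inr ?_⟩⟩
        exact conj_down hS hψ (ha0.trans ha) (hr.end_mem (by simp [hψ.one])) hr hy0 hyB
      · obtain ⟨l', hp, hr⟩ := sort_down hψ.neg l hl (by linarith)
        refine ⟨l', hp, Subgroup.subset_closure ⟨hmem _, Or.inl ?_⟩⟩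
        have := conj_down (y := y) hS hψ.neg (ha0.trans ha) (hr.end_mem (by simp [hψ.one])) hr
          (by simp [hy0]) (by simpa using hyB)
        exact this.mono subset_rfl (fun g (hg : -ψ g ≤ a) => by show -a ≤ ψ g; linarith)
    obtain ⟨l', hp, hl'⟩ := hex
    obtain ⟨e, he, hle⟩ := perm_prod (Y := Y) (N0 := N0) (M2 := M2) (S := S)
      (fun s hs s' hs' => ⟨c s s', Or.inr ⟨s, hs, s', hs', rfl⟩, m s s', hm s s', hcm s s'⟩) hp hl
      (fun l2 h2 hlen => ih _ (by omega) l2 rfl h2)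
    rw [← SetLike.mem_coe, Subgroup.mul_normal] at he
    obtain ⟨n0, hn0, m0, hm0, rfl⟩ := he
    have hfin : l.prod⁻¹ * y * l.prod = n0⁻¹ * (l'.prod⁻¹ * y * l'.prod) * n0 := by
      rw [hle]
      have h4 : m0⁻¹ * (n0⁻¹ * (l'.prod⁻¹ * y * l'.prod) * n0) * m0 = n0⁻¹ * (l'.prod⁻¹ * y * l'.prod) * n0 := by
        rw [mul_assoc, hcomm _ (hN0M (mul_mem (mul_mem (inv_mem hn0) hl') hn0)) m0 hm0]
        simp
      rw [← h4]
      simp [mul_assoc]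
    rw [hfin]
    exact mul_mem (mul_mem (inv_mem hn0) hl') hn0
  have hle : Subgroup.closure (Group.conjugatesOfSet Y1) ≤ N0 := by
    rw [Subgroup.closure_le]
    intro z hz
    obtain ⟨y, hy, hz⟩ := Group.mem_conjugatesOfSet_iff.1 hz
    obtain ⟨w, rfl⟩ := isConj_iff.1 hz
    obtain ⟨l, hl, hw⟩ := exists_reach hS hgen w⁻¹
    have := key _ l rfl hl y (Or.inl hy)
    rw [hw, inv_inv] at this
    exact this
  intro x hx
  rw [← hY1] at hx
  exact hle hx

/-- letters of the free group -/
def letters (k : ℕ) : Set (FreeGroup (Fin k)) :=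
  {x | ∃ i, x = FreeGroup.of i ∨ x = (FreeGroup.of i)⁻¹}

theorem letters_inv (k : ℕ) : ∀ x ∈ letters k, x⁻¹ ∈ letters k := by
  rintro x ⟨i, rfl | rfl⟩
  · exact ⟨i, Or.inr rfl⟩
  · exact ⟨i, Or.inl (inv_inv _)⟩

theorem letters_gen (k : ℕ) : Subgroup.closure (letters k) = ⊤ := by
  rw [eq_top_iff, ← FreeGroup.closure_range_of]
  apply Subgroup.closure_mono
  rintro _ ⟨i, rfl⟩
  exact ⟨i, Or.inl rfl⟩

theorem letters_finite (k : ℕ) : (letters k).Finite := by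
  have : letters k = Set.range (fun i => FreeGroup.of i) ∪ Set.range (fun i => (FreeGroup.of i)⁻¹) := by
    ext x
    constructor
    · rintro ⟨i, rfl | rfl⟩
      · exact Or.inl ⟨i, rfl⟩
      · exact Or.inr ⟨i, rfl⟩
    · rintro (⟨i, rfl⟩ | ⟨i, rfl⟩)
      · exact ⟨i, Or.inl rfl⟩
      · exact ⟨i, Or.inr rfl⟩
  rw [this]
  exact (Set.finite_range _).union (Set.finite_range _)

theorem cocycle_exists {H : Type*} [Group H] {k : ℕ} (π : FreeGroup (Fin k) →* H) (g f : H → ℤ)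
    (hgf : ∀ x ∈ letters k, ∀ h, g (π x * h) ≠ g h → f (π x * h) = f h) :
    ∃ T : FreeGroup (Fin k) → H → ℤ, (∀ w w' h, T (w * w') h = T w' h + T w (π w' * h)) ∧
      (∀ x ∈ letters k, ∀ h, T x h = (g (π x * h) - g h) * f h) ∧
      (∀ R : Set (FreeGroup (Fin k)), π.ker = Subgroup.normalClosure R →
        (∀ r ∈ R, ∀ h, T r h = 0) → ∀ w w', π w = π w' → ∀ h, T w h = T w' h) := by
  let P : Fin k → Equiv.Perm (H × ℤ) := fun i =>
    { toFun := fun q => (π (FreeGroup.of i) * q.1, q.2 + (g (π (FreeGroup.of i) * q.1) - g q.1) * f q.1)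
      invFun := fun q => ((π (FreeGroup.of i))⁻¹ * q.1,
        q.2 - (g q.1 - g ((π (FreeGroup.of i))⁻¹ * q.1)) * f ((π (FreeGroup.of i))⁻¹ * q.1))
      left_inv := by rintro ⟨h, n⟩; simp
      right_inv := by rintro ⟨h, n⟩; simp }
  let ρ : FreeGroup (Fin k) →* Equiv.Perm (H × ℤ) := FreeGroup.lift P
  have hρ1 : ∀ i h n, ρ (FreeGroup.of i) (h, n) =
      (π (FreeGroup.of i) * h, n + (g (π (FreeGroup.of i) * h) - g h) * f h) := by
    intro i h n
    simp only [ρ, FreeGroup.lift_apply_of]; rfl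
  have hρ2 : ∀ i h n, ρ (FreeGroup.of i)⁻¹ (h, n) =
      ((π (FreeGroup.of i))⁻¹ * h, n + (g ((π (FreeGroup.of i))⁻¹ * h) - g h) * f h) := by
    intro i h n
    have : ρ (FreeGroup.of i)⁻¹ (h, n) = ((π (FreeGroup.of i))⁻¹ * h,
        n - (g h - g ((π (FreeGroup.of i))⁻¹ * h)) * f ((π (FreeGroup.of i))⁻¹ * h)) := by
      simp only [ρ, map_inv, FreeGroup.lift_apply_of]; rfl
    rw [this]
    congr 1
    by_cases hh : g ((π (FreeGroup.of i))⁻¹ * h) = g h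
    · rw [hh]; ring
    · have := hgf (FreeGroup.of i)⁻¹ ⟨i, Or.inr rfl⟩ h (by simpa using hh)
      rw [map_inv] at this
      rw [this]; ring
  have hmain : ∀ w h, ∃ c, ∀ n, ρ w (h, n) = (π w * h, n + c) := by
    intro w
    induction w using FreeGroup.induction_on with
    | C1 => intro h; exact ⟨0, by simp⟩
    | of i => intro h; exact ⟨_, hρ1 i h⟩
    | inv_of i _ => intro h; exact ⟨_, fun n => by rw [hρ2 i h, map_inv]⟩
    | mul x y hx hy =>
      intro h
      obtain ⟨c, hc⟩ := hy h
      obtain ⟨d, hd⟩ := hx (π y * h)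
      exact ⟨c + d, fun n => by rw [map_mul, Equiv.Perm.mul_apply, hc, hd, map_mul, mul_assoc, add_assoc]⟩
  choose T hT using hmain
  refine ⟨T, ?_, ?_, ?_⟩
  · intro w w' h
    have h1 := hT (w * w') h 0
    rw [map_mul, Equiv.Perm.mul_apply, hT, hT] at h1
    have := congrArg Prod.snd h1
    simp at this
    linarith
  · rintro x ⟨i, rfl | rfl⟩ h
    · have h1 := hT (FreeGroup.of i) h 0
      rw [hρ1] at h1
      have := congrArg Prod.snd h1
      simp at this
      linarith
    · have h1 := hT (FreeGroup.of i)⁻¹ h 0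
      rw [hρ2] at h1
      have := congrArg Prod.snd h1
      simp at this
      rw [map_inv]
      linarith
  · intro R hR h0 w w' hww h
    have hker : π.ker ≤ ρ.ker := by
      rw [hR]
      apply Subgroup.normalClosure_le_normal
      intro r hr
      show ρ r = 1
      have hr1 : π r = 1 := by
        have : r ∈ π.ker := by rw [hR]; exact Subgroup.subset_normalClosure hr
        exact this
      ext ⟨h, n⟩ <;> simp [hT, hr1, h0 r hr]
    have : w⁻¹ * w' ∈ ρ.ker := hker (by
      show π _ = 1
      rw [map_mul, map_inv, hww, inv_mul_cancel])
    have h2 : ρ w = ρ w' := by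
      have h3 : ρ (w⁻¹ * w') = 1 := this
      rw [map_mul, map_inv, inv_mul_eq_one] at h3
      exact h3
    have h4 := hT w h 0
    rw [h2, hT] at h4
    have := congrArg Prod.snd h4
    simp at this
    linarith

theorem core_conn {H : Type*} [Group H] {k : ℕ} (π : FreeGroup (Fin k) →* H)
    (hπ : Function.Surjective π) (R : Set (FreeGroup (Fin k))) (hRf : R.Finite)
    (hR : π.ker = Subgroup.normalClosure R) {ψ : H → ℝ} (hψ : IsChar ψ) (M1 M2 : Subgroup H)
    [hM1n : M1.Normal] [hM2n : M2.Normal] (hM1 : M1.IsFinitelyNormallyGenerated)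
    (hM2 : M2.IsFinitelyNormallyGenerated)
    (hcomm : ∀ x ∈ M1, ∀ y ∈ M2, x * y = y * x) (hab : commutator H ≤ M1 ⊔ M2)
    (h1 : ∀ x ∈ M1, ψ x = 0) (h2 : ∀ x ∈ M2, ψ x = 0) :
    ∃ a : ℝ, (∀ n ∈ M1, ∃ m ∈ M2, Reach (π '' letters k) {g | -a ≤ ψ g} 1 (n * m)) ∨
      (∀ n ∈ M2, ∃ m ∈ M1, Reach (π '' letters k) {g | ψ g ≤ a} 1 (n * m)) := by
  classical
  set S := π '' letters k with hSdef
  have hSf : S.Finite := (letters_finite k).image _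
  have hS : ∀ x ∈ S, x⁻¹ ∈ S := by
    rintro _ ⟨x, hx, rfl⟩
    exact ⟨x⁻¹, letters_inv k x hx, by simp⟩
  have hgen : Subgroup.closure S = ⊤ := by
    rw [hSdef, ← MonoidHom.map_closure, letters_gen, ← MonoidHom.range_eq_map]
    exact MonoidHom.range_eq_top.2 hπ
  obtain ⟨a1, ha1, hg1⟩ := gen_lemma hSf hS hgen hψ M1 M2 hM1 hcomm hab h1
  obtain ⟨a2, ha2, hg2⟩ := gen_lemma hSf hS hgen hψ M2 M1 hM2 (fun x hx y hy => (hcomm y hy x hx).symm)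
    (by rwa [sup_comm]) h2
  obtain ⟨B, hB0, hB⟩ := finite_bound hRf (fun r B => Reach (letters k) {w | |ψ (π w)| ≤ B} 1 r)
    (fun y B B' hBB h => h.mono subset_rfl (fun g (hg : |ψ (π g)| ≤ B) => (le_trans hg hBB : |ψ (π g)| ≤ B')))
    (fun y _ => reach_bdd (letters_inv k) (letters_gen k) (fun w => ψ (π w)) y)
  obtain ⟨B', hB'0, hB'⟩ := finite_bound (letters_finite k) (fun x B => |ψ (π x)| ≤ B)
    (fun y B B' hBB h => le_trans h hBB) (fun y _ => ⟨_, le_rfl⟩)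
  obtain ⟨a, haa1, haa2, haB, haB'⟩ : ∃ a, a1 ≤ a ∧ a2 ≤ a ∧ 2 * B ≤ a ∧ B' ≤ a :=
    ⟨a1 + a2 + 2 * B + B', by linarith, by linarith, by linarith, by linarith⟩
  refine ⟨a, ?_⟩
  by_contra hcon
  rw [not_or] at hcon
  obtain ⟨hc1, hc2⟩ := hcon
  let p1 : H → Prop := fun h => ∃ m ∈ M2, Reach S {g | -a ≤ ψ g} 1 (h * m)
  let p2 : H → Prop := fun h => ∃ m ∈ M1, Reach S {g | ψ g ≤ a} 1 (h * m)
  -- constancy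
  have hp1 : ∀ x ∈ S, ∀ h, -a ≤ ψ h → -a ≤ ψ (x * h) → (p1 (x * h) ↔ p1 h) := by
    intro x hx h ha hb
    constructor
    · rintro ⟨m, hm, hr⟩
      refine ⟨m, hm, ?_⟩
      have := hr.trans (Reach.step (hS x hx) (show -a ≤ ψ _ by rw [hψ, h2 m hm]; linarith)
        (show -a ≤ ψ _ by rw [mul_assoc, inv_mul_cancel_left, hψ, h2 m hm]; linarith))
      rwa [mul_assoc, inv_mul_cancel_left] at this
    · rintro ⟨m, hm, hr⟩
      refine ⟨m, hm, ?_⟩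
      have := hr.trans (Reach.step hx (show -a ≤ ψ _ by rw [hψ, h2 m hm]; linarith)
        (show -a ≤ ψ _ by rw [← mul_assoc, hψ, h2 m hm]; linarith))
      rwa [← mul_assoc] at this
  have hp2 : ∀ x ∈ S, ∀ h, ψ h ≤ a → ψ (x * h) ≤ a → (p2 (x * h) ↔ p2 h) := by
    intro x hx h ha hb
    constructor
    · rintro ⟨m, hm, hr⟩
      refine ⟨m, hm, ?_⟩
      have := hr.trans (Reach.step (hS x hx) (show ψ _ ≤ a by rw [hψ, h1 m hm]; linarith)
        (show ψ _ ≤ a by rw [mul_assoc, inv_mul_cancel_left, hψ, h1 m hm]; linarith))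
      rwa [mul_assoc, inv_mul_cancel_left] at this
    · rintro ⟨m, hm, hr⟩
      refine ⟨m, hm, ?_⟩
      have := hr.trans (Reach.step hx (show ψ _ ≤ a by rw [hψ, h1 m hm]; linarith)
        (show ψ _ ≤ a by rw [← mul_assoc, hψ, h1 m hm]; linarith))
      rwa [← mul_assoc] at this
  let f1 : H → ℤ := fun h => if p1 h then 1 else 0
  let f2 : H → ℤ := fun h => if p2 h then 1 else 0
  let σ : H → ℤ := fun h => if 0 ≤ ψ h then 1 else 0
  let g : H → ℤ := fun h => σ h * f1 h
  have hf1 : ∀ x ∈ letters k, ∀ h, -a ≤ ψ h → -a ≤ ψ (π x * h) → f1 (π x * h) = f1 h := by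
    intro x hx h ha hb
    have := hp1 (π x) ⟨x, hx, rfl⟩ h ha hb
    simp only [f1, this]
  have hf2 : ∀ x ∈ letters k, ∀ h, ψ h ≤ a → ψ (π x * h) ≤ a → f2 (π x * h) = f2 h := by
    intro x hx h ha hb
    have := hp2 (π x) ⟨x, hx, rfl⟩ h ha hb
    simp only [f2, this]
  have hσ1 : ∀ h, 0 ≤ ψ h → σ h = 1 := fun h hh => by simp only [σ, if_pos hh]
  have hσ0 : ∀ h, ψ h < 0 → σ h = 0 := fun h hh => by simp only [σ, if_neg (not_le.2 hh)]
  have hstep : ∀ x ∈ letters k, ∀ h, ψ (π x * h) ≤ ψ h + B' ∧ ψ h ≤ ψ (π x * h) + B' := by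
    intro x hx h
    have := abs_le.1 (hB' x hx)
    rw [hψ]
    constructor <;> linarith [this.1, this.2]
  have ha0 : 0 ≤ a := ha1.trans haa1
  have hgf : ∀ x ∈ letters k, ∀ h, g (π x * h) ≠ g h → f2 (π x * h) = f2 h := by
    intro x hx h hne
    have hs := hstep x hx h
    apply hf2 x hx h
    · by_contra hlt
      apply hne
      rw [not_le] at hlt
      simp only [g]
      rw [hσ1 h (by linarith), hσ1 (π x * h) (by linarith [hs.2]), hf1 x hx h (by linarith) (by linarith [hs.2])]
    · by_contra hlt
      apply hne
      rw [not_le] at hlt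
      simp only [g]
      rw [hσ1 h (by linarith [hs.1]), hσ1 (π x * h) (by linarith), hf1 x hx h (by linarith [hs.1]) (by linarith)]
  obtain ⟨T, hTm, hTl, hTR⟩ := cocycle_exists π g f2 hgf
  have hT1 : ∀ h, T 1 h = 0 := fun h => by
    have := hTm 1 1 h
    simp at this
    exact this
  -- path lemmas
  have PA : ∀ (h : H) (w : FreeGroup (Fin k)), ψ h ≤ a →
      Reach (letters k) {w | ψ (π w * h) ≤ a} 1 w → 
      f2 (π w * h) = f2 h ∧ T w h = f2 h * (g (π w * h) - g h) := by
    intro h w hh hr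
    induction hr with
    | refl => simp [hT1]
    | tail _ hst ih =>
      obtain ⟨hu, hv, x, hx, rfl⟩ := hst
      simp only [Set.mem_ofPred_eq, map_mul, mul_assoc] at hu hv
      rename_i b hbc
      have e := hf2 x hx (π b * h) hu hv
      rw [map_mul, mul_assoc, e, ih.1, hTm, ih.2, hTl x hx, ih.1]
      exact ⟨rfl, by ring⟩
  have PC : ∀ (h : H) (w : FreeGroup (Fin k)), 0 ≤ ψ h →
      Reach (letters k) {w | 0 ≤ ψ (π w * h)} 1 w → 
      g (π w * h) = g h ∧ T w h = 0 := by
    intro h w hh hr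
    induction hr with
    | refl => simp [hT1]
    | tail _ hst ih =>
      obtain ⟨hu, hv, x, hx, rfl⟩ := hst
      simp only [Set.mem_ofPred_eq, map_mul, mul_assoc] at hu hv
      rename_i b hbc
      have e := hf1 x hx (π b * h) (by linarith) (by linarith)
      have e2 : g (π x * (π b * h)) = g (π b * h) := by
        simp only [g]
        rw [e, hσ1 _ hu, hσ1 _ hv]
      rw [map_mul, mul_assoc, e2, ih.1, hTm, ih.2, hTl x hx, e2]
      exact ⟨rfl, by ring⟩
  have PB0 : ∀ (h : H) (w : FreeGroup (Fin k)), f1 h = 0 →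
      Reach (letters k) {w | -a ≤ ψ (π w * h)} 1 w → 
      f1 (π w * h) = 0 ∧ T w h = 0 := by
    intro h w hh hr
    induction hr with
    | refl => simp [hT1, hh]
    | tail _ hst ih =>
      obtain ⟨hu, hv, x, hx, rfl⟩ := hst
      simp only [Set.mem_ofPred_eq, map_mul, mul_assoc] at hu hv
      rename_i b hbc
      have e := hf1 x hx (π b * h) (by linarith) (by linarith)
      rw [ih.1] at e
      rw [map_mul, mul_assoc, e, hTm, ih.2, hTl x hx]
      simp only [g]
      rw [e, ih.1]
      simp
  have PB1 : ∀ (h : H) (w : FreeGroup (Fin k)), f1 h = 1 →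
      Reach (letters k) {w | -a ≤ ψ (π w * h)} 1 w → 
      f1 (π w * h) = 1 ∧ T w h = (σ (π w * h) - 1) * f2 (π w * h) - (σ h - 1) * f2 h := by
    intro h w hh hr
    induction hr with
    | refl => simp [hT1, hh]
    | tail _ hst ih =>
      obtain ⟨hu, hv, x, hx, rfl⟩ := hst
      simp only [Set.mem_ofPred_eq, map_mul, mul_assoc] at hu hv
      rename_i b hbc
      have e := hf1 x hx (π b * h) (by linarith) (by linarith)
      rw [ih.1] at e
      rw [map_mul, mul_assoc, e, hTm, ih.2, hTl x hx]
      have eg1 : g (π b * h) = σ (π b * h) := by simp only [g, ih.1, mul_one]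
      have eg2 : g (π x * (π b * h)) = σ (π x * (π b * h)) := by simp only [g, e, mul_one]
      rw [eg1, eg2]
      refine ⟨rfl, ?_⟩
      have hs := hstep x hx (π b * h)
      rcases le_or_gt 0 (ψ (π b * h)) with hp | hp <;>
      rcases le_or_gt 0 (ψ (π x * (π b * h))) with hq | hq
      · rw [hσ1 _ hp, hσ1 _ hq]; ring
      · rw [hf2 x hx _ (by linarith [hs.2]) (by linarith)]; ring
      · rw [hf2 x hx _ (by linarith [hs.2]) (by linarith)]; ring
      · rw [hf2 x hx _ (by linarith [hs.2]) (by linarith)]; ring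
  have hrel : ∀ r ∈ R, ∀ h, T r h = 0 := by
    intro r hr h
    have hr1 : π r = 1 := by
      have : r ∈ π.ker := by rw [hR]; exact Subgroup.subset_normalClosure hr
      exact this
    have hb := hB r hr
    rcases le_total (ψ h) (a - B) with hle | hle
    · have := (PA h r (by linarith) (hb.mono subset_rfl (fun w (hw : |ψ (π w)| ≤ B) => by
        show ψ _ ≤ a
        rw [hψ]; linarith [(abs_le.1 hw).2]))).2
      rw [this, hr1, one_mul]; ring
    · exact (PC h r (by linarith) (hb.mono subset_rfl (fun w (hw : |ψ (π w)| ≤ B) => by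
        show 0 ≤ ψ _
        rw [hψ]; linarith [(abs_le.1 hw).1]))).2
  have hTeq := hTR R hR hrel
  have hψ1 := hψ.one
  -- subgroups
  let D1 : Subgroup H :=
    { carrier := {h | ψ h = 0 ∧ Reach S {g | -a ≤ ψ g} 1 h}
      one_mem' := ⟨hψ1, Reach.refl⟩
      mul_mem' := by
        rintro x y ⟨hx, hxr⟩ ⟨hy, hyr⟩
        refine ⟨by rw [hψ, hx, hy, add_zero], hyr.trans ?_⟩
        have := hxr.translate (V := {g | -a ≤ ψ g}) y (fun g (hg : -a ≤ ψ g) => by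
          show -a ≤ ψ _; rw [hψ, hy]; linarith)
        rwa [one_mul] at this
      inv_mem' := by
        rintro x ⟨hx, hxr⟩
        refine ⟨by rw [hψ.inv, hx, neg_zero], ?_⟩
        have := (hxr.symm hS).translate (V := {g | -a ≤ ψ g}) x⁻¹ (fun g (hg : -a ≤ ψ g) => by
          show -a ≤ ψ _; rw [hψ, hψ.inv, hx]; linarith)
        rwa [one_mul, mul_inv_cancel] at this }
  let D2 : Subgroup H :=
    { carrier := {h | ψ h = 0 ∧ Reach S {g | ψ g ≤ a} 1 h}
      one_mem' := ⟨hψ1, Reach.refl⟩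
      mul_mem' := by
        rintro x y ⟨hx, hxr⟩ ⟨hy, hyr⟩
        refine ⟨by rw [hψ, hx, hy, add_zero], hyr.trans ?_⟩
        have := hxr.translate (V := {g | ψ g ≤ a}) y (fun g (hg : ψ g ≤ a) => by
          show ψ _ ≤ a; rw [hψ, hy]; linarith)
        rwa [one_mul] at this
      inv_mem' := by
        rintro x ⟨hx, hxr⟩
        refine ⟨by rw [hψ.inv, hx, neg_zero], ?_⟩
        have := (hxr.symm hS).translate (V := {g | ψ g ≤ a}) x⁻¹ (fun g (hg : ψ g ≤ a) => by
          show ψ _ ≤ a; rw [hψ, hψ.inv, hx]; linarith)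
        rwa [one_mul, mul_inv_cancel] at this }
  have hD1 : ∀ h ∈ D1 ⊔ M2, p1 h := by
    intro h hh
    rw [← SetLike.mem_coe, Subgroup.mul_normal] at hh
    obtain ⟨d, hd, m, hm, rfl⟩ := hh
    exact ⟨m⁻¹, inv_mem hm, by simpa using hd.2⟩
  have hD2 : ∀ h ∈ D2 ⊔ M1, p2 h := by
    intro h hh
    rw [← SetLike.mem_coe, Subgroup.mul_normal] at hh
    obtain ⟨d, hd, m, hm, rfl⟩ := hh
    exact ⟨m⁻¹, inv_mem hm, by simpa using hd.2⟩
  obtain ⟨n1, hn1M, hn1p, hn1r⟩ : ∃ n1 ∈ M1, ¬ p1 n1 ∧ Reach S {g | ψ g ≤ a} 1 n1 := by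
    by_contra hne
    push Not at hne
    apply hc1
    intro n hn
    apply hD1
    refine (hg1 a haa1).trans ?_ hn
    rw [Subgroup.closure_le]
    rintro z ⟨hz, hz1 | hz2⟩
    · exact Subgroup.mem_sup_left (⟨h1 z hz, hz1⟩ : z ∈ D1)
    · by_contra hznot
      by_cases hzp : p1 z
      · obtain ⟨m, hm, hr⟩ := hzp
        apply hznot
        have h3 : z * m ∈ D1 := ⟨by rw [hψ, h1 z hz, h2 m hm, add_zero], hr⟩
        have := mul_mem (Subgroup.mem_sup_left (T := M2) h3) (Subgroup.mem_sup_right (S := D1) (inv_mem hm))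
        simpa using this
      · exact hne z hz hzp hz2
  obtain ⟨n2, hn2M, hn2p, hn2r⟩ : ∃ n2 ∈ M2, ¬ p2 n2 ∧ Reach S {g | -a ≤ ψ g} 1 n2 := by
    by_contra hne
    push Not at hne
    apply hc2
    intro n hn
    apply hD2
    refine (hg2 a haa2).trans ?_ hn
    rw [Subgroup.closure_le]
    rintro z ⟨hz, hz1 | hz2⟩
    · by_contra hznot
      by_cases hzp : p2 z
      · obtain ⟨m, hm, hr⟩ := hzp
        apply hznot
        have h3 : z * m ∈ D2 := ⟨by rw [hψ, h2 z hz, h1 m hm, add_zero], hr⟩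
        have := mul_mem (Subgroup.mem_sup_left (T := M1) h3) (Subgroup.mem_sup_right (S := D2) (inv_mem hm))
        simpa using this
      · exact hne z hz hzp hz1
    · exact Subgroup.mem_sup_left (⟨h2 z hz, hz2⟩ : z ∈ D2)
  rw [← map_one π] at hn1r hn2r
  obtain ⟨wA, hwA, hrA⟩ := hn1r.lift
  obtain ⟨wB, hwB, hrB⟩ := hn2r.lift
  have z1 := h1 n1 hn1M
  have z2 := h2 n2 hn2M
  have hf11 : f1 1 = 1 := if_pos ⟨1, one_mem _, by rw [mul_one]; exact Reach.refl⟩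
  have hf21 : f2 1 = 1 := if_pos ⟨1, one_mem _, by rw [mul_one]; exact Reach.refl⟩
  have hf1n : f1 n1 = 0 := if_neg hn1p
  have hf2n : f2 n2 = 0 := if_neg hn2p
  have q1 := (PA 1 wA (by linarith) (hrA.mono subset_rfl (fun w (hw : ψ (π w) ≤ a) => by
    show ψ _ ≤ a; rw [mul_one]; exact hw))).2
  have q2 := (PB0 n1 wB hf1n (hrB.mono subset_rfl (fun w (hw : -a ≤ ψ (π w)) => by
    show -a ≤ ψ _; rw [hψ, z1]; linarith))).2
  have q3 := (PB1 1 wB hf11 (hrB.mono subset_rfl (fun w (hw : -a ≤ ψ (π w)) => by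
    show -a ≤ ψ _; rw [hψ, hψ1]; linarith))).2
  have q4 := (PA n2 wA (by linarith) (hrA.mono subset_rfl (fun w (hw : ψ (π w) ≤ a) => by
    show ψ _ ≤ a; rw [hψ, z2]; linarith))).2
  have e := hTeq (wA * wB) (wB * wA) (by rw [map_mul, map_mul, hwA, hwB, hcomm n1 hn1M n2 hn2M]) 1
  rw [hTm, hTm, hwA, hwB, mul_one, mul_one, q2, q4] at e
  rw [hwA, mul_one, hf21] at q1
  rw [hwB, mul_one, hσ1 1 (by linarith), hσ1 n2 (by linarith)] at q3
  simp only [g, hf1n, hf11, hσ1 1 (by linarith), hf2n] at e q1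
  rw [q1, q3] at e
  norm_num at e

open scoped commutatorElement

/-- certificate that a character is in the Sigma invariant -/
def Cert {Γ : Type*} [Group Γ] (X : Set Γ) (χ : Γ → ℝ) : Prop :=
  ∃ t ∈ X, ∃ k : ℕ, ∃ ε : ℝ, 0 < ε ∧ 0 < χ t ∧
    ∀ x ∈ X, Reach X {g | min 0 (χ x) + ε ≤ χ g} (t ^ k) (t ^ k * x)

theorem Reach.finite {Γ : Type*} [Group Γ] {S U : Set Γ} {u v : Γ} (h : Reach S U u v) :
    ∃ U0 : Set Γ, U0.Finite ∧ U0 ⊆ U ∧ Reach S U0 u v := by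
  induction h with
  | refl => exact ⟨∅, Set.finite_empty, Set.empty_subset _, Reach.refl⟩
  | tail _ h ih =>
    rename_i b c hbc
    obtain ⟨h1, h2, x, hx, h3⟩ := h
    obtain ⟨U0, hf, hU, hr⟩ := ih
    refine ⟨U0 ∪ {b, c}, hf.union (by simp), ?_, ?_⟩
    · rintro z (hz | rfl | rfl)
      · exact hU hz
      · exact h1
      · exact h2
    · exact (hr.mono subset_rfl Set.subset_union_left).trans
        (Relation.ReflTransGen.single ⟨by simp, by simp, x, hx, h3⟩)

theorem cert_of_conn {Γ : Type*} [Group Γ] {X : Set Γ} (hXf : X.Finite) (hX : ∀ x ∈ X, x⁻¹ ∈ X)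
    (hgen : Subgroup.closure X = ⊤) {χ : Γ → ℝ} (hχ : IsChar χ) (N : Subgroup Γ)
    (hc : commutator Γ ≤ N) {a : ℝ} (hconn : ∀ n ∈ N, Reach X {g | -a ≤ χ g} 1 n)
    {g0 : Γ} (hg0 : χ g0 ≠ 0) : Cert X χ := by
  obtain ⟨t, ht, htp⟩ : ∃ t ∈ X, 0 < χ t := by
    by_contra hne
    push Not at hne
    obtain ⟨l, hl, hlp⟩ := exists_reach hX hgen g0
    have h0 : ∀ x ∈ X, χ x = 0 := fun x hx => by
      have h1 := hne x hx
      have h2 := hne _ (hX x hx)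
      rw [hχ.inv] at h2
      linarith
    apply hg0
    rw [← hlp]
    clear hlp
    induction l with
    | nil => simp [hχ.one]
    | cons x l ih =>
      rw [List.prod_cons, hχ, h0 x (hl x (by simp)), ih (fun y hy => hl y (by simp [hy])), add_zero]
  obtain ⟨B, hB0, hB⟩ := finite_bound hXf (fun x B => |χ x| ≤ B)
    (fun y B B' hBB h => le_trans h hBB) (fun y _ => ⟨_, le_rfl⟩)
  obtain ⟨k, hk⟩ := exists_nat_ge ((|a| + 2 * B + 1) / χ t)
  rw [div_le_iff₀ htp] at hk
  refine ⟨t, ht, k, 1, one_pos, htp, fun x hx => ?_⟩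
  have hx' := abs_le.1 (hB x hx)
  have hmin : min 0 (χ x) ≤ 0 := min_le_left _ _
  have hmin2 : min 0 (χ x) ≤ χ x := min_le_right _ _
  have hpk := hχ.pow t k
  have ha := neg_abs_le a
  have ha' := le_abs_self a
  have ha'' := abs_nonneg a
  refine (Reach.step hx (show _ ≤ χ _ by rw [hpk]; linarith) (show _ ≤ χ _ by rw [hχ, hpk]; linarith [hx'.1])).trans ?_
  have hn : ⁅t ^ k, x⁆ ∈ N := hc (Subgroup.commutator_mem_commutator (Subgroup.mem_top _) (Subgroup.mem_top _))
  have := (hconn _ hn).translate (V := {g | min 0 (χ x) + 1 ≤ χ g}) (x * t ^ k) ?_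
  · simpa [commutatorElement_def] using this
  · intro g (hg : -a ≤ χ g)
    show _ ≤ χ _
    rw [hχ, hχ, hpk]
    linarith [hx'.1, hx'.2]

theorem Cert.improve {Γ : Type*} [Group Γ] {X : Set Γ} {χ : Γ → ℝ} (hχ : IsChar χ) {t : Γ} {k : ℕ}
    {ε : ℝ} (h : ∀ x ∈ X, Reach X {g | min 0 (χ x) + ε ≤ χ g} (t ^ k) (t ^ k * x))
    {b : ℝ} {u v : Γ} (hr : Reach X {g | b ≤ χ g} u v) :
    Reach X {g | b + ε ≤ χ g} (t ^ k * u) (t ^ k * v) := by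
  induction hr with
  | refl => exact Reach.refl
  | tail _ hs ih =>
    rename_i w c hbc
    obtain ⟨h1, h2, x, hx, rfl⟩ := hs
    refine ih.trans ?_
    have := (h x hx).translate (V := {g | b + ε ≤ χ g}) w ?_
    · simpa [mul_assoc] using this
    · intro g (hg : _ ≤ χ g)
      show _ ≤ χ _
      change b ≤ χ w at h1
      change b ≤ χ (x * w) at h2
      rw [hχ] at h2 ⊢
      rcases min_choice 0 (χ x) with h | h <;> rw [h] at hg <;> linarith

theorem Cert.reach {Γ : Type*} [Group Γ] {X : Set Γ} (hX : ∀ x ∈ X, x⁻¹ ∈ X)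
    (hgen : Subgroup.closure X = ⊤) {χ : Γ → ℝ} (hχ : IsChar χ) (h : Cert X χ) {u : Γ}
    (hu : 0 ≤ χ u) : Reach X {g | 0 ≤ χ g} 1 u := by
  obtain ⟨t, ht, k, ε, hε, htp, hr⟩ := h
  obtain ⟨B, hB⟩ := reach_bdd hX hgen χ u
  have hb : Reach X {g | -B ≤ χ g} 1 u := hB.mono subset_rfl (fun g (hg : |χ g| ≤ B) =>
    (abs_le.1 hg).1)
  have hit : ∀ m : ℕ, Reach X {g | -B + m * ε ≤ χ g} (t ^ (k * m)) (t ^ (k * m) * u) := by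
    intro m
    induction m with
    | zero => simpa using hb
    | succ m ih =>
      have := Cert.improve hχ hr ih
      rw [← mul_assoc, ← pow_add] at this
      rw [show k * (m + 1) = k + k * m by ring]
      refine this.mono subset_rfl (fun g (hg : _ ≤ χ g) => ?_)
      show _ ≤ χ g
      push_cast
      linarith
  obtain ⟨m, hm⟩ := exists_nat_ge (B / ε)
  rw [div_le_iff₀ hε] at hm
  have h1 : ∀ j : ℕ, ∀ w, 0 ≤ χ w → Reach X {g | 0 ≤ χ g} w (t ^ j * w) := by
    intro j w hw
    induction j with
    | zero => simp only [pow_zero, one_mul]; exact Reach.refl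
    | succ j ih =>
      refine ih.trans ?_
      have h2 : χ (t ^ j * w) = j * χ t + χ w := by rw [hχ, hχ.pow]
      have h3 : 0 ≤ (j : ℝ) * χ t := by positivity
      have := Reach.step (U := {g | 0 ≤ χ g}) (u := t ^ j * w) ht (show 0 ≤ χ _ by rw [h2]; linarith)
        (show 0 ≤ χ _ by rw [hχ, h2]; linarith)
      rwa [← mul_assoc, ← pow_succ'] at this
  have e1 := h1 (k * m) 1 (by rw [hχ.one])
  rw [mul_one] at e1
  refine (e1.trans ((hit m).mono subset_rfl ?_)).trans ((h1 (k * m) u hu).symm hX)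
  intro g (hg : _ ≤ χ g)
  show 0 ≤ χ g
  linarith

theorem cert_scale {Γ : Type*} [Group Γ] {X : Set Γ} {χ : Γ → ℝ} {c : ℝ} (hc : 0 < c)
    (h : Cert X χ) : Cert X (fun g => c * χ g) := by
  obtain ⟨t, ht, k, ε, hε, htp, hr⟩ := h
  refine ⟨t, ht, k, c * ε, by positivity, by positivity, fun x hx => (hr x hx).mono subset_rfl ?_⟩
  intro g (hg : _ ≤ χ g)
  show min 0 (c * χ x) + c * ε ≤ c * χ g
  have : min 0 (c * χ x) = c * min 0 (χ x) := by
    rw [mul_min_of_nonneg _ _ hc.le, mul_zero]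
  rw [this]
  nlinarith

theorem cert_open {Γ : Type*} [Group Γ] {X : Set Γ} (hXf : X.Finite) {E : Type*} [TopologicalSpace E]
    (χ : E → Γ → ℝ) (hcont : ∀ g, Continuous (fun v => χ v g)) :
    IsOpen {v | Cert X (χ v)} := by
  rw [isOpen_iff_mem_nhds]
  rintro v ⟨t, ht, k, ε, hε, htp, hr⟩
  choose! U hUf hUs hUr using fun x hx => (hr x hx).finite
  have e1 : ∀ᶠ v' in nhds v, 0 < χ v' t := (hcont t).continuousAt.eventually (lt_mem_nhds htp)
  have e2 : ∀ᶠ v' in nhds v, ∀ x ∈ X, ∀ g ∈ U x, min 0 (χ v' x) + ε / 2 < χ v' g := by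
    rw [Filter.eventually_all_finite hXf]
    intro x hx
    rw [Filter.eventually_all_finite (hUf x hx)]
    intro g hg
    have h1 : min 0 (χ v x) + ε ≤ χ v g := hUs x hx hg
    apply ContinuousAt.eventually_lt (f := fun v' => min 0 (χ v' x) + ε / 2) (g := fun v' => χ v' g)
    · exact ((continuous_const.min (hcont x)).add continuous_const).continuousAt
    · exact (hcont g).continuousAt
    · linarith
  filter_upwards [e1, e2] with v' h1 h2
  exact ⟨t, ht, k, ε / 2, by linarith, h1, fun x hx => (hUr x hx).mono subset_rfl
    (fun g hg => (h2 x hx g hg).le)⟩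

theorem ker_fg_of_reach {Γ : Type*} [Group Γ] {X : Set Γ} (hXf : X.Finite)
    (τ : Γ →* Multiplicative ℤ) (s : Γ) (hs : τ s = Multiplicative.ofAdd 1)
    (hpos : ∀ u, τ u = 1 → Reach X {g | 0 ≤ (τ g).toAdd} 1 u)
    (hneg : ∀ u, τ u = 1 → Reach X {g | (τ g).toAdd ≤ 0} 1 u) : τ.ker.FG := by
  classical
  let T : Γ → ℤ := fun g => (τ g).toAdd
  have hT : ∀ x y, T (x * y) = T x + T y := fun x y => by simp [T]
  have hTs : ∀ n : ℤ, T (s ^ n) = n := fun n => by simp [T, hs]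
  have hTk : ∀ g, T g = 0 ↔ g ∈ τ.ker := fun g => by
    rw [MonoidHom.mem_ker]
    constructor
    · intro h; exact Multiplicative.toAdd.injective h
    · intro h; simp [T, h]
  let y : Γ → Γ := fun x => s ^ (-T x) * x
  have hy : ∀ x, T (y x) = 0 := fun x => by simp only [y]; rw [hT, hTs]; ring
  let f : ℤ → Γ → Γ := fun i x => s ^ (-i) * y x * s ^ i
  have hf : ∀ i x, T (f i x) = 0 := fun i x => by
    simp only [f]; rw [hT, hT, hTs, hTs, hy]; ring
  let L : Set ℤ → Subgroup Γ := fun I => Subgroup.closure {z | ∃ i ∈ I, ∃ x ∈ X, z = f i x}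
  have hLmem : ∀ I i x, i ∈ I → x ∈ X → f i x ∈ L I := fun I i x hi hx =>
    Subgroup.subset_closure ⟨i, hi, x, hx, rfl⟩
  have hLK : ∀ I, L I ≤ τ.ker := by
    intro I
    rw [Subgroup.closure_le]
    rintro _ ⟨i, _, x, _, rfl⟩
    exact (hTk _).1 (hf i x)
  have path : ∀ (U : Set Γ) (I : Set ℤ), (∀ g ∈ U, T g ∈ I) → ∀ u, Reach X U 1 u → 
      s ^ (-T u) * u ∈ L I := by
    intro U I hUI u hr
    induction hr with
    | refl =>
      have : T 1 = 0 := by simp [T]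
      rw [this]; simp [one_mem]
    | tail _ h ih =>
      rename_i b c hbc
      obtain ⟨h1, h2, x, hx, rfl⟩ := h
      have : s ^ (-T (x * b)) * (x * b) = f (T b) x * (s ^ (-T b) * b) := by
        simp only [f, y]
        rw [hT, neg_add, zpow_add]
        have : s ^ (-T x) * s ^ (-T b) = s ^ (-T b) * s ^ (-T x) := by
          rw [← zpow_add, ← zpow_add, add_comm]
        rw [this]
        simp [mul_assoc]
      rw [this]
      exact mul_mem (hLmem _ _ _ (hUI _ h1) hx) ih
  -- bounded
  have hd : ∀ x ∈ X, ∃ B : ℝ, ∃ d : ℤ, (d : ℝ) ≤ B ∧ f (-1) x ∈ L (Set.Icc 0 d) := by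
    intro x hx
    obtain ⟨U0, hf0, hU0, hr⟩ := (hpos (f (-1) x) ((hTk _).1 (hf _ x))).finite
    obtain ⟨B, hB⟩ := (hf0.image T).bddAbove
    have := path U0 (Set.Icc 0 B) (fun g hg => ⟨hU0 hg, hB ⟨g, hg, rfl⟩⟩) _ hr
    rw [hf] at this
    simp only [neg_zero, zpow_zero, one_mul] at this
    exact ⟨B, B, le_rfl, this⟩
  obtain ⟨B, hB0, hB⟩ := finite_bound hXf (fun x B => ∃ d : ℤ, (d : ℝ) ≤ B ∧ f (-1) x ∈ L (Set.Icc 0 d))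
    (fun x B B' hBB ⟨d, h1, h2⟩ => ⟨d, h1.trans hBB, h2⟩) hd
  obtain ⟨D, hD⟩ : ∃ D : ℤ, B ≤ D := ⟨⌈B⌉, Int.le_ceil B⟩
  have hmono : ∀ I J : Set ℤ, I ⊆ J → L I ≤ L J := by
    intro I J hIJ
    apply Subgroup.closure_mono
    rintro z ⟨i, hi, x, hx, rfl⟩
    exact ⟨i, hIJ hi, x, hx, rfl⟩
  have h1 : ∀ x ∈ X, f (-1) x ∈ L (Set.Icc 0 D) := by
    intro x hx
    obtain ⟨d, hd1, hd2⟩ := hB x hx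
    refine hmono _ _ (Set.Icc_subset_Icc_right ?_) hd2
    exact_mod_cast hd1.trans hD
  have hshift : ∀ i x, s * f i x * s⁻¹ = f (i - 1) x := by
    intro i x
    simp only [f]
    rw [neg_sub, sub_eq_add_neg, zpow_add, zpow_sub]
    simp [mul_assoc, zpow_neg]
  set LD := L (Set.Icc 0 D) with hLD
  have hD0 : 0 ≤ D := by exact_mod_cast hB0.trans hD
  have hconj : ∀ z ∈ LD, s * z * s⁻¹ ∈ LD := by
    have : LD ≤ LD.comap (MulAut.conj s).toMonoidHom := by
      conv_lhs => rw [hLD]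
      rw [Subgroup.closure_le]
      rintro _ ⟨i, hi, x, hx, rfl⟩
      show s * f i x * s⁻¹ ∈ LD
      rw [hshift]
      by_cases h0 : i = 0
      · rw [h0]; exact h1 x hx
      · exact hLmem _ _ _ ⟨by have := hi.1; omega, by have := hi.2; omega⟩ hx
    exact fun z hz => this hz
  have hall : ∀ j : ℕ, ∀ x ∈ X, f (-(j : ℤ)) x ∈ LD := by
    intro j x hx
    induction j with
    | zero => exact hLmem _ _ _ ⟨by simp, by simpa using hD0⟩ hx
    | succ j ih =>
      have := hconj _ ih
      rw [hshift] at this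
      convert this using 2
      push_cast; ring
  have hneg' : L (Set.Iic 0) ≤ LD := by
    rw [Subgroup.closure_le]
    rintro _ ⟨i, hi, x, hx, rfl⟩
    have hi' : i ≤ 0 := hi
    have := hall i.natAbs x hx
    rwa [show -(i.natAbs : ℤ) = i by omega] at this
  have hK : τ.ker = LD := by
    apply le_antisymm
    · intro u hu
      have := path _ (Set.Iic 0) (fun g hg => hg) u (hneg u hu)
      rw [(hTk u).2 hu] at this
      simp only [neg_zero, zpow_zero, one_mul] at this
      exact hneg' this
    · exact hLK _
  rw [hK]
  refine (Subgroup.fg_iff _).2 ⟨_, rfl, ?_⟩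
  have : {z | ∃ i ∈ Set.Icc 0 D, ∃ x ∈ X, z = f i x} = Set.image2 f (Set.Icc 0 D) X := by
    ext z
    constructor
    · rintro ⟨i, hi, x, hx, rfl⟩; exact ⟨i, hi, x, hx, rfl⟩
    · rintro ⟨i, hi, x, hx, rfl⟩; exact ⟨i, hi, x, hx, rfl⟩
  rw [this]
  exact (Set.finite_Icc 0 D).image2 _ hXf

/-- topological step -/
theorem exists_two_sided (C : ℝ × ℝ → Prop) (hopen : IsOpen {v | C v}) 
    (L : ℝ × ℝ → ℝ × ℝ) (hLc : Continuous L) (hLneg : ∀ v, L (-v) = - L v)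
    (hL0 : ∀ v, v ≠ 0 → L v ≠ 0) (h : ∀ v, v ≠ 0 → C (L v) ∨ C (-v)) :
    ∃ v, v ≠ 0 ∧ C v ∧ C (-v) := by
  by_contra hne
  push Not at hne
  have hconn : IsPreconnected ({0}ᶜ : Set (ℝ × ℝ)) := by
    apply (isConnected_compl_singleton_of_one_lt_rank _ _).isPreconnected
    rw [← Module.finrank_eq_rank]
    norm_num
  have o1 : IsOpen {w | C (L w)} := hopen.preimage hLc
  have o2 : IsOpen {w | C (-L w)} := hopen.preimage hLc.neg
  have hcov : ∀ w : ℝ × ℝ, w ≠ 0 → C (L w) ∨ C (-L w) := by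
    intro w hw
    rcases h w hw with h1 | h1
    · exact Or.inl h1
    · rcases h (-w) (neg_ne_zero.2 hw) with h2 | h2
      · right; rwa [hLneg] at h2
      · rw [neg_neg] at h2
        exact absurd h1 (hne w hw h2)
  have hw0 : ((1, 0) : ℝ × ℝ) ≠ 0 := by simp
  have n1 : ({0}ᶜ ∩ {w | C (L w)} : Set (ℝ × ℝ)).Nonempty := by
    rcases hcov _ hw0 with h1 | h1
    · exact ⟨_, hw0, h1⟩
    · refine ⟨-(1, 0), neg_ne_zero.2 hw0, ?_⟩
      show C (L _)
      rwa [hLneg]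
  have n2 : ({0}ᶜ ∩ {w | C (-L w)} : Set (ℝ × ℝ)).Nonempty := by
    rcases hcov _ hw0 with h1 | h1
    · refine ⟨-(1, 0), neg_ne_zero.2 hw0, ?_⟩
      show C (-L _)
      rwa [hLneg, neg_neg]
    · exact ⟨_, hw0, h1⟩
  obtain ⟨w, hw, h1, h2⟩ := hconn _ _ o1 o2 (fun w hw => hcov w hw) n1 n2
  exact hne (L w) (hL0 w hw) h1 h2

theorem exists_coprime (C : ℝ × ℝ → Prop) (hopen : IsOpen {v | C v}) 
    (hscale : ∀ (c : ℝ) v, 0 < c → C v → C (c • v)) (v : ℝ × ℝ) (hv : v ≠ 0) (h1 : C v) (h2 : C (-v)) :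
    ∃ m n x y : ℤ, x * m + y * n = 1 ∧ C ((m : ℝ), (n : ℝ)) ∧ C (-((m : ℝ), (n : ℝ))) := by
  have hdense : DenseRange (Prod.map (fun q : ℚ => (q : ℝ)) (fun q : ℚ => (q : ℝ))) :=
    (Rat.denseRange_cast (𝕜 := ℝ)).prodMap Rat.denseRange_cast
  have ho : IsOpen ({v | C v} ∩ {v | C (-v)} ∩ {0}ᶜ : Set (ℝ × ℝ)) :=
    (hopen.inter (hopen.preimage continuous_neg)).inter isOpen_compl_singleton
  obtain ⟨⟨p, q⟩, ⟨hp1, hp2⟩, hp3⟩ := hdense.exists_mem_open ho ⟨v, ⟨h1, h2⟩, hv⟩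
  simp only [Prod.map_apply] at hp1 hp2 hp3
  change C ((p : ℝ), (q : ℝ)) at hp1
  change C (-((p : ℝ), (q : ℝ))) at hp2
  let m0 : ℤ := p.num * q.den
  let n0 : ℤ := q.num * p.den
  have hd : (0 : ℝ) < p.den * q.den := by
    have := p.den_pos; have := q.den_pos; positivity
  have em : (m0 : ℝ) = p.den * q.den * p := by
    have : (p : ℝ) * p.den = p.num := by exact_mod_cast Rat.mul_den_eq_num p
    simp only [m0]; push_cast; rw [← this]; ring
  have en : (n0 : ℝ) = p.den * q.den * q := by
    have : (q : ℝ) * q.den = q.num := by exact_mod_cast Rat.mul_den_eq_num q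
    simp only [n0]; push_cast; rw [← this]; ring
  have hne : Int.gcd m0 n0 ≠ 0 := by
    intro h0
    rw [Int.gcd_eq_zero_iff] at h0
    apply hp3
    rw [h0.1] at em
    rw [h0.2] at en
    rw [Int.cast_zero] at em en
    have e1 : (p : ℝ) = 0 := (mul_eq_zero.1 em.symm).resolve_left hd.ne'
    have e2 : (q : ℝ) = 0 := (mul_eq_zero.1 en.symm).resolve_left hd.ne'
    simp [e1, e2]
  set d : ℤ := (Int.gcd m0 n0 : ℤ) with hdd
  have hdpos : 0 < d := by omega
  obtain ⟨m, hm⟩ : d ∣ m0 := Int.gcd_dvd_left _ _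
  obtain ⟨n, hn⟩ : d ∣ n0 := Int.gcd_dvd_right _ _
  have hbz := Int.gcd_eq_gcd_ab m0 n0
  rw [← hdd] at hbz
  have hdR : (0 : ℝ) < d := by exact_mod_cast hdpos
  have key : ((m : ℝ), (n : ℝ)) = ((p.den * q.den : ℝ) / d) • ((p : ℝ), (q : ℝ)) := by
    have e1 : (m0 : ℝ) = d * m := by exact_mod_cast hm
    have e2 : (n0 : ℝ) = d * n := by exact_mod_cast hn
    ext
    · simp only [Prod.smul_mk, smul_eq_mul]
      field_simp
      rw [← em, e1]; ring
    · simp only [Prod.smul_mk, smul_eq_mul]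
      field_simp
      rw [← en, e2]; ring
  refine ⟨m, n, Int.gcdA m0 n0, Int.gcdB m0 n0, ?_, ?_, ?_⟩
  · have : d * (Int.gcdA m0 n0 * m + Int.gcdB m0 n0 * n) = d * 1 := by
      calc _ = (d * m) * Int.gcdA m0 n0 + (d * n) * Int.gcdB m0 n0 := by ring
        _ = d * 1 := by rw [← hm, ← hn, mul_one, ← hbz]
    exact mul_left_cancel₀ hdpos.ne' this
  · rw [key]; exact hscale _ _ (by positivity) hp1
  · rw [key, ← smul_neg]; exact hscale _ _ (by positivity) hp2

set_option maxHeartbeats 1000000 in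
theorem forward_aux {G H : Type*} [Group G] [Group H] (hG : Group.IsFinitelyPresented G)
    (N : Subgroup G) [hN : N.Normal] (hc : commutator G ≤ N)
    (hrk : rkQuot N hN = 2) (μ : (G ⧸ N) ≃* (G ⧸ N))
    (hHfp : Group.IsFinitelyPresented H) {k : ℕ} (π : FreeGroup (Fin k) →* H)
    (R : Finset (FreeGroup (Fin k))) (hπ : Function.Surjective π)
    (hR : π.ker = Subgroup.normalClosure (R : Set (FreeGroup (Fin k))))
    (π1 π2 : H →* G) (hπ1 : Function.Surjective π1) (hπ2 : Function.Surjective π2)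
    (hμπ : ∀ h : H, μ (QuotientGroup.mk (π1 h)) = QuotientGroup.mk (π2 h))
    (lift1 : ∀ n ∈ N, ∃ x : H, x ∈ π2.ker ∧ π1 x = n)
    (lift2 : ∀ n ∈ N, ∃ x : H, x ∈ π1.ker ∧ π2 x = n)
    (hext : ∀ x y : H, π1 x = π1 y → π2 x = π2 y → x = y) :
    ∃ (t : G) (K : Subgroup G), ¬ IsOfFinOrder t ∧ N ≤ K ∧ K.FG ∧
      K ⊔ Subgroup.zpowers t = ⊤ ∧ K ⊓ Subgroup.zpowers t = ⊥ := by
  classical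
  obtain ⟨p1, p2, g1, g2, hp1N, hp2N, h11, h21, h12, h22, hk⟩ := rank_two (fg_of_fp hG) N hc hrk
  have hHfg := fg_of_fp hHfp
  let M1 := π2.ker
  let M2 := π1.ker
  have hM1 : M1.IsFinitelyNormallyGenerated := ker_fng π2 hπ2
  have hM2 : M2.IsFinitelyNormallyGenerated := ker_fng π1 hπ1
  have hM1N : ∀ x : H, x ∈ M1 → π1 x ∈ N := by
    intro x (hx : π2 x = 1)
    have := hμπ x
    rw [hx, QuotientGroup.mk_one, EmbeddingLike.map_eq_one_iff, QuotientGroup.eq_one_iff] at this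
    exact this
  have hM2N : ∀ x : H, x ∈ M2 → π2 x ∈ N := by
    intro x (hx : π1 x = 1)
    have := hμπ x
    rw [hx, QuotientGroup.mk_one, map_one, eq_comm, QuotientGroup.eq_one_iff] at this
    exact this
  have hcomm : ∀ x ∈ M1, ∀ y ∈ M2, x * y = y * x := by
    intro x (hx : π2 x = 1) y (hy : π1 y = 1)
    apply hext <;> simp [hx, hy]
  have hab : commutator H ≤ M1 ⊔ M2 := by
    intro x hx
    have hx1 : π1 x ∈ N := by
      apply hc
      have : commutator H ≤ (commutator G).comap π1 := by
        rw [← Subgroup.map_le_iff_le_comap, commutator_def, Subgroup.map_commutator]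
        exact Subgroup.commutator_mono le_top le_top
      exact this hx
    obtain ⟨y, hy, hyx⟩ := lift1 _ hx1
    have : x = y * (y⁻¹ * x) := by simp
    rw [this]
    refine mul_mem (Subgroup.mem_sup_left hy) (Subgroup.mem_sup_right ?_)
    show π1 _ = 1
    rw [map_mul, map_inv, hyx, inv_mul_cancel]
  -- generating set
  have himg : ∀ ρ : H →* G, Function.Surjective ρ → Subgroup.closure (ρ '' (π '' letters k)) = ⊤ := by
    intro ρ hρ
    rw [← MonoidHom.map_closure, ← MonoidHom.map_closure, letters_gen, ← MonoidHom.range_eq_map,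
      MonoidHom.range_eq_top.2 hπ, ← MonoidHom.range_eq_map, MonoidHom.range_eq_top.2 hρ]
  have hinv : ∀ ρ : H →* G, ∀ x ∈ ρ '' (π '' letters k), x⁻¹ ∈ ρ '' (π '' letters k) := by
    rintro ρ _ ⟨_, ⟨x, hx, rfl⟩, rfl⟩
    exact ⟨_, ⟨x⁻¹, letters_inv k x hx, rfl⟩, by simp⟩
  let X := π1 '' (π '' letters k) ∪ π2 '' (π '' letters k)
  have hXf : X.Finite := (((letters_finite k).image _).image _).union (((letters_finite k).image _).image _)
  have hX : ∀ x ∈ X, x⁻¹ ∈ X := by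
    rintro x (hx | hx)
    · exact Or.inl (hinv _ _ hx)
    · exact Or.inr (hinv _ _ hx)
  have hgen : Subgroup.closure X = ⊤ := by
    rw [eq_top_iff, ← himg π1 hπ1]
    exact Subgroup.closure_mono Set.subset_union_left
  -- characters
  let χ : ℝ × ℝ → G → ℝ := fun v g => v.1 * ((p1 g).toAdd : ℤ) + v.2 * ((p2 g).toAdd : ℤ)
  have hχ : ∀ v, IsChar (χ v) := by
    intro v x y
    simp only [χ, map_mul, toAdd_mul]
    push_cast; ring
  have hχN : ∀ v, ∀ n ∈ N, χ v n = 0 := by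
    intro v n hn
    simp [χ, hp1N n hn, hp2N n hn]
  have hχneg : ∀ v g, χ (-v) g = - χ v g := by
    intro v g
    simp only [χ, Prod.fst_neg, Prod.snd_neg]; ring
  have hχ1 : ∀ v, χ v g1 = v.1 := fun v => by simp [χ, h11, h21]
  have hχ2 : ∀ v, χ v g2 = v.2 := fun v => by simp [χ, h12, h22]
  have hχne : ∀ v, v ≠ 0 → ∃ g, χ v g ≠ 0 := by
    intro v hv
    by_contra hne
    push Not at hne
    apply hv
    ext
    · rw [← hχ1, hne]; rfl
    · rw [← hχ2, hne]; rfl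
  -- pullback
  let q1 : G →* Multiplicative ℤ :=
    ((QuotientGroup.lift N p1 hp1N).comp μ.toMonoidHom).comp (QuotientGroup.mk' N)
  let q2 : G →* Multiplicative ℤ :=
    ((QuotientGroup.lift N p2 hp2N).comp μ.toMonoidHom).comp (QuotientGroup.mk' N)
  have hq1 : ∀ h : H, q1 (π1 h) = p1 (π2 h) := by
    intro h
    show QuotientGroup.lift N p1 hp1N (μ (QuotientGroup.mk (π1 h))) = _
    rw [hμπ]; rfl
  have hq2 : ∀ h : H, q2 (π1 h) = p2 (π2 h) := by
    intro h
    show QuotientGroup.lift N p2 hp2N (μ (QuotientGroup.mk (π1 h))) = _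
    rw [hμπ]; rfl
  have hqN : ∀ (q : (G ⧸ N) →* Multiplicative ℤ), ∀ n ∈ N, ((q.comp μ.toMonoidHom).comp (QuotientGroup.mk' N)) n = 1 := by
    intro q n hn
    show q (μ (QuotientGroup.mk n)) = 1
    rw [(QuotientGroup.eq_one_iff n).2 hn, map_one, map_one]
  have c1 := char_comb N p1 p2 g1 g2 h11 h21 h12 h22 hk q1 (hqN _)
  have c2 := char_comb N p1 p2 g1 g2 h11 h21 h12 h22 hk q2 (hqN _)
  let L : ℝ × ℝ → ℝ × ℝ := fun v =>
    (v.1 * ((q1 g1).toAdd : ℤ) + v.2 * ((q2 g1).toAdd : ℤ), v.1 * ((q1 g2).toAdd : ℤ) + v.2 * ((q2 g2).toAdd : ℤ))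
  have hLc : Continuous L := by fun_prop
  have hLneg : ∀ v, L (-v) = -L v := by
    intro v
    simp only [L, Prod.fst_neg, Prod.snd_neg, Prod.neg_mk]
    ext <;> ring
  have hLχ : ∀ v (h : H), χ (L v) (π1 h) = χ v (π2 h) := by
    intro v h
    simp only [χ, L]
    rw [← hq1, ← hq2, c1 (π1 h), c2 (π1 h)]
    push_cast; ring
  have hL0 : ∀ v, v ≠ 0 → L v ≠ 0 := by
    intro v hv h0
    obtain ⟨g, hg⟩ := hχne v hv
    obtain ⟨h, rfl⟩ := hπ2 g
    apply hg
    rw [← hLχ, h0]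
    simp [χ]
  let C : ℝ × ℝ → Prop := fun v => Cert X (χ v)
  have hCopen : IsOpen {v | C v} := cert_open hXf χ (fun g => by
    show Continuous (fun v : ℝ × ℝ => v.1 * (((p1 g).toAdd : ℤ) : ℝ) + v.2 * (((p2 g).toAdd : ℤ) : ℝ))
    exact (continuous_fst.mul continuous_const).add (continuous_snd.mul continuous_const))
  have hor : ∀ v, v ≠ 0 → C (L v) ∨ C (-v) := by
    intro v hv
    have hRf : (R : Set (FreeGroup (Fin k))).Finite := R.finite_toSet
    obtain ⟨a, ha⟩ := core_conn π hπ (R : Set (FreeGroup (Fin k))) hRf hR (ψ := fun h => χ v (π2 h))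
      (fun x y => by simp only [map_mul]; exact hχ v _ _) M1 M2 hM1 hM2 hcomm hab
      (fun x (hx : π2 x = 1) => by simp only [hx]; exact (hχ v).one)
      (fun x hx => hχN v _ (hM2N x hx))
    rcases ha with ha | ha
    · left
      obtain ⟨g0, hg0⟩ := hχne _ (hL0 v hv)
      refine cert_of_conn hXf hX hgen (hχ _) N hc (a := a) (fun n hn => ?_) hg0
      obtain ⟨x, hx, hxn⟩ := lift1 n hn
      obtain ⟨m, hm, hr⟩ := ha x hx
      have := hr.map π1 (S' := X) (V := {g | -a ≤ χ (L v) g}) (fun y hy => Or.inl ⟨y, hy, rfl⟩)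
        (fun y (hy : -a ≤ χ v (π2 y)) => by
          show -a ≤ χ (L v) (π1 y)
          rw [hLχ]; exact hy)
      have hm' : π1 m = 1 := hm
      rwa [map_mul, map_one, hxn, hm', mul_one] at this
    · right
      obtain ⟨g0, hg0⟩ := hχne _ (neg_ne_zero.2 hv)
      refine cert_of_conn hXf hX hgen (hχ _) N hc (a := a) (fun n hn => ?_) hg0
      obtain ⟨x, hx, hxn⟩ := lift2 n hn
      obtain ⟨m, hm, hr⟩ := ha x hx
      have := hr.map π2 (S' := X) (V := {g | -a ≤ χ (-v) g}) (fun y hy => Or.inr ⟨y, hy, rfl⟩)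
        (fun y (hy : χ v (π2 y) ≤ a) => by
          show -a ≤ χ (-v) (π2 y)
          rw [hχneg]; linarith)
      have hm' : π2 m = 1 := hm
      rwa [map_mul, map_one, hxn, hm', mul_one] at this
  obtain ⟨v, hv, hv1, hv2⟩ := exists_two_sided C hCopen L hLc hLneg hL0 hor
  obtain ⟨m, n, x, y, hxy, hC1, hC2⟩ := exists_coprime C hCopen (by
    intro c v hc h
    have := cert_scale hc h
    have e : χ (c • v) = fun g => c * χ v g := by
      funext g
      simp only [χ, Prod.smul_fst, Prod.smul_snd, smul_eq_mul]; ring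
    show Cert X (χ (c • v))
    rw [e]; exact this) v hv hv1 hv2
  let τ : G →* Multiplicative ℤ := p1 ^ m * p2 ^ n
  have hτ : ∀ g, (τ g).toAdd = m * (p1 g).toAdd + n * (p2 g).toAdd := by
    intro g
    simp [τ]
  have hτχ : ∀ g, χ ((m : ℝ), (n : ℝ)) g = ((τ g).toAdd : ℤ) := by
    intro g
    rw [hτ]; simp only [χ]; push_cast; ring
  let s : G := g1 ^ x * g2 ^ y
  have hs : τ s = Multiplicative.ofAdd 1 := by
    apply Multiplicative.toAdd.injective
    rw [hτ]
    simp [s, h11, h12, h21, h22]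
    linarith
  have hKfg : τ.ker.FG := by
    apply ker_fg_of_reach hXf τ s hs
    · intro u hu
      refine (Cert.reach hX hgen (hχ _) hC1 (u := u) (by rw [hτχ, hu]; simp)).mono subset_rfl ?_
      intro g (hg : 0 ≤ χ _ g)
      rw [hτχ] at hg
      show 0 ≤ (τ g).toAdd
      exact_mod_cast hg
    · intro u hu
      refine (Cert.reach hX hgen (hχ _) hC2 (u := u) (by rw [hχneg, hτχ, hu]; simp)).mono subset_rfl ?_
      intro g (hg : 0 ≤ χ _ g)
      rw [hχneg, hτχ] at hg
      show (τ g).toAdd ≤ 0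
      have : ((τ g).toAdd : ℝ) ≤ 0 := by linarith
      exact_mod_cast this
  have hsz : ∀ z : ℤ, (τ (s ^ z)).toAdd = z := fun z => by simp [hs]
  refine ⟨s, τ.ker, ?_, ?_, hKfg, ?_, ?_⟩
  · intro hfin
    obtain ⟨z, hz, hz1⟩ := isOfFinOrder_iff_zpow_eq_one.1 hfin
    apply hz
    rw [← hsz z, hz1]; simp
  · intro z hz
    show τ z = 1
    apply Multiplicative.toAdd.injective
    rw [hτ, hp1N z hz, hp2N z hz]; simp
  · rw [eq_top_iff]
    intro g _
    have : g = (g * (s ^ (τ g).toAdd)⁻¹) * s ^ (τ g).toAdd := by simp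
    rw [this]
    refine mul_mem (Subgroup.mem_sup_left ?_) (Subgroup.mem_sup_right ⟨_, rfl⟩)
    show τ _ = 1
    apply Multiplicative.toAdd.injective
    rw [map_mul, toAdd_mul, map_inv, toAdd_inv, hsz]; simp
  · rw [eq_bot_iff]
    rintro _ ⟨hz1, z, rfl⟩
    have h0 : τ (s ^ z) = 1 := hz1
    have : z = 0 := by rw [← hsz z, h0]; rfl
    rw [this]
    simp

theorem forward {G : Type*} [Group G] (hG : Group.IsFinitelyPresented G)
    (N : Subgroup G) [hN : N.Normal] (hc : commutator G ≤ N)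
    (hrk : rkQuot N hN = 2) (μ : (G ⧸ N) ≃* (G ⧸ N))
    (hfp : FinitelyPresentedGroup (fibreProduct N N μ)) :
    ∃ (t : G) (K : Subgroup G), ¬ IsOfFinOrder t ∧ N ≤ K ∧ K.FG ∧
      K ⊔ Subgroup.zpowers t = ⊤ ∧ K ⊓ Subgroup.zpowers t = ⊥ := by
  classical
  set H := fibreProduct N N μ with hHdef
  have hH : ∀ x : G × G, x ∈ H ↔ μ (QuotientGroup.mk x.1) = QuotientGroup.mk x.2 := fun _ => Iff.rfl
  have hHfp : Group.IsFinitelyPresented H := fpg_iff.1 hfp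
  obtain ⟨k, π, R, hπ, hR⟩ := hfp
  -- projections
  let π1 : H →* G := (MonoidHom.fst G G).comp H.subtype
  let π2 : H →* G := (MonoidHom.snd G G).comp H.subtype
  have hπ1 : Function.Surjective π1 := by
    intro g
    obtain ⟨g', hg'⟩ := QuotientGroup.mk_surjective (μ (QuotientGroup.mk g))
    exact ⟨⟨(g, g'), hg'.symm⟩, rfl⟩
  have hπ2 : Function.Surjective π2 := by
    intro g
    obtain ⟨g', hg'⟩ := QuotientGroup.mk_surjective (μ.symm (QuotientGroup.mk g))
    refine ⟨⟨(g', g), ?_⟩, rfl⟩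
    rw [hH]
    show μ (QuotientGroup.mk g') = QuotientGroup.mk g
    rw [hg', MulEquiv.apply_symm_apply]
  have hμπ : ∀ h : H, μ (QuotientGroup.mk (π1 h)) = QuotientGroup.mk (π2 h) := fun h => h.2
  have lift1 : ∀ n ∈ N, ∃ x : H, x ∈ π2.ker ∧ π1 x = n := by
    intro n hn
    refine ⟨⟨(n, 1), ?_⟩, rfl, rfl⟩
    rw [hH]
    show μ (QuotientGroup.mk n) = QuotientGroup.mk 1
    rw [(QuotientGroup.eq_one_iff n).2 hn, map_one, QuotientGroup.mk_one]
  have lift2 : ∀ n ∈ N, ∃ x : H, x ∈ π1.ker ∧ π2 x = n := by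
    intro n hn
    refine ⟨⟨(1, n), ?_⟩, rfl, rfl⟩
    rw [hH]
    show μ (QuotientGroup.mk 1) = QuotientGroup.mk n
    rw [(QuotientGroup.eq_one_iff n).2 hn, QuotientGroup.mk_one, map_one]
  have hext : ∀ x y : H, π1 x = π1 y → π2 x = π2 y → x = y := fun x y h1 h2 =>
    Subtype.ext (Prod.ext h1 h2)
  exact forward_aux hG N hc hrk μ hHfp π R hπ hR π1 π2 hπ1 hπ2 hμπ lift1 lift2 hext

/-- For a finitely presented group `G` and `G' ≤ N ⊴ G` with `rk G/N = 2`, there is an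
automorphism `μ` of `G/N` with `H_μ ≤ G × G` finitely presented iff `G = K ⋊ ⟨t⟩` for some
element `t` of infinite order and finitely generated subgroup `N ≤ K ≤ G`. -/
theorem exists_fp_fibre_product_corank_two_iff {G : Type*} [Group G]
    (hfp : FinitelyPresentedGroup G)
    (N : Subgroup G) [hN : N.Normal] (hc : commutator G ≤ N)
    (hrk : rkQuot N hN = 2) :
    (∃ μ : (G ⧸ N) ≃* (G ⧸ N), FinitelyPresentedGroup ↥(fibreProduct N N μ)) ↔
    (∃ (t : G) (K : Subgroup G), ¬ IsOfFinOrder t ∧ N ≤ K ∧ K.FG ∧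
      K ⊔ Subgroup.zpowers t = ⊤ ∧ K ⊓ Subgroup.zpowers t = ⊥) := by
  constructor
  · rintro ⟨μ, hμ⟩
    exact forward (fpg_iff.1 hfp) N hc hrk μ hμ
  · rintro ⟨t, K, ht, hNK, hK, h1, h2⟩
    obtain ⟨μ, hμ⟩ := backward (fpg_iff.1 hfp) N hc hrk t K ht hNK hK h1 h2
    exact ⟨μ, fpg_iff.2 hμ⟩
end

section
/- Let Δ be a finite simple graph and G = G_Δ the associated right-angled Artin group. Then the untwisted G'-fibre product {(g₁,g₂) ∈ G × G : g₁G' = g₂G'} is finitely presented if and only if G is abelian. -/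
/-- The commutation relators of a simple graph: one commutator for each edge. -/
def raagRels {V : Type*} (Δ : SimpleGraph V) : Set (FreeGroup V) :=
  {r | ∃ u v : V, Δ.Adj u v ∧
    r = FreeGroup.of u * FreeGroup.of v * (FreeGroup.of u)⁻¹ * (FreeGroup.of v)⁻¹}

/-- The right-angled Artin group associated to a simple graph `Δ`. -/
def RAAG {V : Type*} (Δ : SimpleGraph V) : Type _ :=
  PresentedGroup (raagRels Δ)

instance {V : Type*} (Δ : SimpleGraph V) : Group (RAAG Δ) :=
  inferInstanceAs (Group (PresentedGroup (raagRels Δ)))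

/-- Upper triangular matrices `[[1,a,z],[0,c,b],[0,0,1]]` over the rationals. -/
@[ext] structure TriGrp where
  c : ℚˣ
  a : ℚ
  b : ℚ
  z : ℚ

namespace TriGrp

instance : Mul TriGrp := ⟨fun x y => ⟨x.c * y.c, y.a + x.a * y.c, x.c * y.b + x.b,
  y.z + x.a * y.b + x.z⟩⟩
instance : One TriGrp := ⟨⟨1, 0, 0, 0⟩⟩
instance : Inv TriGrp := ⟨fun x => ⟨x.c⁻¹, -(x.a * (x.c⁻¹ : ℚˣ)), -((x.c⁻¹ : ℚˣ) * x.b),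
  x.a * (x.c⁻¹ : ℚˣ) * x.b - x.z⟩⟩

@[simp] theorem mul_c (x y : TriGrp) : (x * y).c = x.c * y.c := rfl
@[simp] theorem mul_a (x y : TriGrp) : (x * y).a = y.a + x.a * y.c := rfl
@[simp] theorem mul_b (x y : TriGrp) : (x * y).b = x.c * y.b + x.b := rfl
@[simp] theorem mul_z (x y : TriGrp) : (x * y).z = y.z + x.a * y.b + x.z := rfl
@[simp] theorem one_c : (1 : TriGrp).c = 1 := rfl
@[simp] theorem one_a : (1 : TriGrp).a = 0 := rfl
@[simp] theorem one_b : (1 : TriGrp).b = 0 := rfl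
@[simp] theorem one_z : (1 : TriGrp).z = 0 := rfl
@[simp] theorem inv_c (x : TriGrp) : (x⁻¹).c = x.c⁻¹ := rfl
@[simp] theorem inv_a (x : TriGrp) : (x⁻¹).a = -(x.a * (x.c⁻¹ : ℚˣ)) := rfl
@[simp] theorem inv_b (x : TriGrp) : (x⁻¹).b = -((x.c⁻¹ : ℚˣ) * x.b) := rfl
@[simp] theorem inv_z (x : TriGrp) : (x⁻¹).z = x.a * (x.c⁻¹ : ℚˣ) * x.b - x.z := rfl

instance : Group TriGrp := Group.ofLeftAxioms
  (by
    intro x y w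
    ext
    · simp [mul_assoc]
    · simp; ring
    · simp; ring
    · simp; ring)
  (by intro x; ext <;> simp)
  (by
    intro x
    ext
    · simp
    · simp
    · simp
    · simp; ring)

/-- The diagonal character. -/
def chi : TriGrp →* ℚˣ where
  toFun x := x.c
  map_one' := rfl
  map_mul' _ _ := rfl

/-- Keep the upper left block. -/
def pA : TriGrp →* TriGrp where
  toFun x := ⟨x.c, x.a, 0, 0⟩
  map_one' := rfl
  map_mul' x y := by ext <;> simp

/-- Keep the lower right block. -/
def pB : TriGrp →* TriGrp where
  toFun x := ⟨x.c, 0, x.b, 0⟩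
  map_one' := rfl
  map_mul' x y := by ext <;> simp

/-- Central elements whose corner entry has denominator dividing `D`. -/
def cen (D : ℤ) : Subgroup TriGrp where
  carrier := {x | x.c = 1 ∧ x.a = 0 ∧ x.b = 0 ∧ ∃ m : ℤ, (D : ℚ) * x.z = m}
  one_mem' := ⟨rfl, rfl, rfl, 0, by simp⟩
  mul_mem' := by
    rintro x y ⟨h1, h2, h3, m, h4⟩ ⟨k1, k2, k3, n, k4⟩
    refine ⟨by simp [h1, k1], by simp [h2, k2], by simp [h3, k3], m + n, ?_⟩
    simp [h2, mul_add, h4, k4, add_comm]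
  inv_mem' := by
    rintro x ⟨h1, h2, h3, m, h4⟩
    refine ⟨by simp [h1], by simp [h2], by simp [h3], -m, ?_⟩
    simp [h2, h4]

instance (D : ℤ) : (cen D).Normal where
  conj_mem := by
    rintro x ⟨h1, h2, h3, m, h4⟩ g
    have : g * x * g⁻¹ = x := by
      rw [mul_inv_eq_iff_eq_mul]
      ext <;> simp [h1, h2, h3, add_comm]
    rw [this]
    exact ⟨h1, h2, h3, m, h4⟩

end TriGrp

theorem fibre_fst_snd {G : Type*} [Group G]
    (p : ↥(fibreProduct (commutator G) (commutator G) (MulEquiv.refl (G ⧸ commutator G))))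
    {A : Type*} [CommGroup A] (χ : G →* A) : χ p.1.1 = χ p.1.2 := by
  have h : (QuotientGroup.mk p.1.1 : G ⧸ commutator G) = QuotientGroup.mk p.1.2 := p.2
  rw [QuotientGroup.eq] at h
  have h2 := Abelianization.commutator_subset_ker χ h
  rw [MonoidHom.mem_ker, map_mul, map_inv, inv_mul_eq_one] at h2
  exact h2

theorem key_not_fp {G : Type*} [Group G] (φ : G →* TriGrp) (u v : G)
    (hu : φ u = ⟨Units.mk0 2 two_ne_zero, 0, 0, 0⟩) (hv : φ v = ⟨1, 1, 1, 0⟩)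
    (hfp : FinitelyPresentedGroup
      ↥(fibreProduct (commutator G) (commutator G) (MulEquiv.refl (G ⧸ commutator G)))) :
    False := by
  obtain ⟨n, f, S, hf, hker⟩ := hfp
  let q : FreeGroup (Fin n) →* TriGrp := FreeGroup.lift fun i =>
    ⟨(φ (f (.of i)).1.1).c, (φ (f (.of i)).1.1).a, (φ (f (.of i)).1.2).b, 0⟩
  let P := fibreProduct (commutator G) (commutator G) (MulEquiv.refl (G ⧸ commutator G))
  have hA : TriGrp.pA.comp q =
      (TriGrp.pA.comp φ).comp (((MonoidHom.fst G G).comp P.subtype).comp f) := by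
    ext i : 1
    simp [q, TriGrp.pA, P]
  have hB : TriGrp.pB.comp q =
      (TriGrp.pB.comp φ).comp (((MonoidHom.snd G G).comp P.subtype).comp f) := by
    ext i : 1
    have := fibre_fst_snd (f (.of i)) (TriGrp.chi.comp φ)
    simp [TriGrp.chi] at this
    simp [q, TriGrp.pB, P, this]
  have hc (w) : (q w).c = (φ (f w).1.1).c := by
    have h := congrArg TriGrp.c (DFunLike.congr_fun hA w)
    exact h
  have ha (w) : (q w).a = (φ (f w).1.1).a := by
    have h := congrArg TriGrp.a (DFunLike.congr_fun hA w)
    exact h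
  have hb (w) : (q w).b = (φ (f w).1.2).b := by
    have h := congrArg TriGrp.b (DFunLike.congr_fun hB w)
    exact h
  let D : ℤ := ∏ s ∈ S, ((q s).z.den : ℤ)
  have hD : D ≠ 0 := Finset.prod_ne_zero_iff.2 fun s _ => by simp
  have hle : f.ker ≤ (TriGrp.cen D).comap q := by
    rw [hker]
    apply Subgroup.normalClosure_le_normal
    intro s hs
    have h1 : f s = 1 := by
      rw [← MonoidHom.mem_ker, hker]; exact Subgroup.subset_normalClosure hs
    refine ⟨by rw [hc, h1]; simp, by rw [ha, h1]; simp, by rw [hb, h1]; simp, ?_⟩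
    obtain ⟨e, he⟩ : ((q s).z.den : ℤ) ∣ D := Finset.dvd_prod_of_mem _ hs
    refine ⟨e * (q s).z.num, ?_⟩
    rw [he]
    push_cast
    have := Rat.den_mul_eq_num (q s).z
    linear_combination (e : ℚ) * this
  have memc (x y : G) : x * y * x⁻¹ * y⁻¹ ∈ commutator G :=
    Subgroup.commutator_mem_commutator (Subgroup.mem_top x) (Subgroup.mem_top y)
  have mem1 (g : G) (hg : g ∈ commutator G) : (g, (1 : G)) ∈ P := by
    change (QuotientGroup.mk g : G ⧸ commutator G) = QuotientGroup.mk 1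
    rw [QuotientGroup.eq]; simpa using hg
  have mem2 (g : G) (hg : g ∈ commutator G) : ((1 : G), g) ∈ P := by
    change (QuotientGroup.mk 1 : G ⧸ commutator G) = QuotientGroup.mk g
    rw [QuotientGroup.eq]; simpa using hg
  have hpow (k : ℕ) : φ (u ^ k) = ⟨Units.mk0 2 two_ne_zero ^ k, 0, 0, 0⟩ := by
    induction k with
    | zero => simp; rfl
    | succ k ih => rw [pow_succ, map_mul, ih, hu]; ext <;> simp [pow_succ]
  obtain ⟨w2, hw2⟩ := hf ⟨_, mem2 _ (memc u v)⟩
  have main (k : ℕ) : ∃ m : ℤ, (D : ℚ) * ((2 ^ k)⁻¹ - 1) = m := by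
    obtain ⟨w1, hw1⟩ := hf ⟨_, mem1 _ (memc (u ^ k) v)⟩
    have hk : w1 * w2 * w1⁻¹ * w2⁻¹ ∈ f.ker := by
      rw [MonoidHom.mem_ker]
      simp only [map_mul, map_inv, hw1, hw2]
      ext <;> simp
    obtain ⟨-, -, -, m, hm⟩ := hle hk
    refine ⟨m, ?_⟩
    rw [← hm]
    have c1 : (q w1).c = 1 := by rw [hc, hw1]; simp [hv, hpow]
    have a1 : (q w1).a = (2 ^ k)⁻¹ - 1 := by rw [ha, hw1]; simp [hv, hpow]; try ring
    have b1 : (q w1).b = 0 := by rw [hb, hw1]; simp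
    have c2 : (q w2).c = 1 := by rw [hc, hw2]; simp
    have a2 : (q w2).a = 0 := by rw [ha, hw2]; simp
    have b2 : (q w2).b = 1 := by rw [hb, hw2]; simp [hv, hu]; try norm_num
    simp [c1, a1, b1, c2, a2, b2]
    try ring
  obtain ⟨m, hm⟩ := main D.natAbs
  have h3 : D = (m + D) * 2 ^ D.natAbs := by
    have : (D : ℚ) = (m + D) * 2 ^ D.natAbs := by
      rw [← hm]; field_simp; ring
    exact_mod_cast this
  have h4 : (2 : ℤ) ^ D.natAbs ∣ D := Dvd.intro_left _ h3.symm
  have h5 := Int.natAbs_dvd_natAbs.2 h4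
  rw [Int.natAbs_pow] at h5
  have h6 := Nat.le_of_dvd (Int.natAbs_pos.2 hD) h5
  exact absurd h6 (not_le.2 (Nat.lt_pow_self (by norm_num)))

theorem raag_adj_of_fp {V : Type*} [Fintype V] (Δ : SimpleGraph V)
    (h : FinitelyPresentedGroup
        ↥(fibreProduct (commutator (RAAG Δ)) (commutator (RAAG Δ))
          (MulEquiv.refl (RAAG Δ ⧸ commutator (RAAG Δ))))) (u v : V) (huv : u ≠ v) :
    Δ.Adj u v := by
  classical
  by_contra hadj
  let F : V → TriGrp := fun x =>
    if x = u then ⟨Units.mk0 2 two_ne_zero, 0, 0, 0⟩ else if x = v then ⟨1, 1, 1, 0⟩ else 1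
  have hF : ∀ r ∈ raagRels Δ, FreeGroup.lift F r = 1 := by
    rintro r ⟨x, y, hxy, rfl⟩
    have hne := hxy.ne
    have key : F x * F y = F y * F x := by
      by_cases hx : x = u
      · have hy : y ≠ u := fun hy => hne (hx.trans hy.symm)
        have hy' : y ≠ v := fun hy => hadj (hx ▸ hy ▸ hxy)
        simp [F, hy, hy']
      · by_cases hx' : x = v
        · have hy : y ≠ v := fun hy => hne (hx'.trans hy.symm)
          have hy' : y ≠ u := fun hy => hadj (hx' ▸ hy ▸ hxy.symm)
          simp [F, hy, hy']
        · simp [F, hx, hx']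
    simp [key]
  refine key_not_fp (G := RAAG Δ) (PresentedGroup.toGroup hF)
    (PresentedGroup.of u : PresentedGroup (raagRels Δ))
    (PresentedGroup.of v : PresentedGroup (raagRels Δ)) ?_ ?_ h
  · refine (PresentedGroup.toGroup.of hF).trans ?_
    simp [F]
  · refine (PresentedGroup.toGroup.of hF).trans ?_
    simp [F, huv.symm]

theorem raagRels_finite {V : Type*} [Fintype V] (Δ : SimpleGraph V) : (raagRels Δ).Finite := by
  refine (Set.finite_range fun p : V × V =>
    FreeGroup.of p.1 * FreeGroup.of p.2 * (FreeGroup.of p.1)⁻¹ * (FreeGroup.of p.2)⁻¹).subset ?_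
  rintro r ⟨u, v, -, rfl⟩
  exact ⟨(u, v), rfl⟩

theorem raag_fp_of_comm {V : Type*} [Fintype V] (Δ : SimpleGraph V)
    (h : ∀ a b : RAAG Δ, a * b = b * a) :
    FinitelyPresentedGroup
        ↥(fibreProduct (commutator (RAAG Δ)) (commutator (RAAG Δ))
          (MulEquiv.refl (RAAG Δ ⧸ commutator (RAAG Δ)))) := by
  classical
  let e := Fintype.equivFin V
  let E : FreeGroup (Fin (Fintype.card V)) ≃* FreeGroup V := FreeGroup.freeGroupCongr e.symm
  let π : FreeGroup V →* RAAG Δ := PresentedGroup.mk (raagRels Δ)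
  have hπ : Function.Surjective π := PresentedGroup.mk_surjective _
  have hπk : π.ker = Subgroup.normalClosure (raagRels Δ) := QuotientGroup.ker_mk' _
  let δ : RAAG Δ →* ↥(fibreProduct (commutator (RAAG Δ)) (commutator (RAAG Δ))
          (MulEquiv.refl (RAAG Δ ⧸ commutator (RAAG Δ)))) :=
    { toFun := fun g => ⟨(g, g), rfl⟩
      map_one' := rfl
      map_mul' := fun _ _ => rfl }
  have hδ : Function.Injective δ := fun x y hxy =>
    congrArg (fun p => p.1.1) hxy
  have hcomm : commutator (RAAG Δ) = ⊥ := by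
    rw [commutator_def, Subgroup.commutator_eq_bot_iff_le_centralizer]
    intro x _
    rw [Subgroup.mem_centralizer_iff]
    exact fun y _ => h y x
  have hδs : Function.Surjective δ := by
    rintro ⟨⟨g, k⟩, hgk⟩
    refine ⟨g, ?_⟩
    have h1 : (QuotientGroup.mk g : RAAG Δ ⧸ commutator (RAAG Δ)) = QuotientGroup.mk k := hgk
    rw [QuotientGroup.eq] at h1
    have h2 : g⁻¹ * k = 1 := by
      rw [← Subgroup.mem_bot, ← hcomm]; exact h1
    have h3 : g = k := inv_mul_eq_one.1 h2
    subst h3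
    rfl
  refine ⟨Fintype.card V, (δ.comp π).comp E.toMonoidHom,
    (raagRels_finite Δ).toFinset.image E.symm, ?_, ?_⟩
  · exact (hδs.comp hπ).comp E.surjective
  · have h1 : ((δ.comp π).comp E.toMonoidHom).ker = π.ker.comap E.toMonoidHom := by
      ext w
      simp only [MonoidHom.mem_ker, Subgroup.mem_comap, MonoidHom.comp_apply]
      exact map_eq_one_iff δ hδ
    rw [h1, hπk]
    have h2 := Subgroup.map_normalClosure (raagRels Δ) E.symm.toMonoidHom E.symm.surjective
    have h3 := Subgroup.map_equiv_eq_comap_symm E.symm (Subgroup.normalClosure (raagRels Δ))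
    rw [Finset.coe_image, Set.Finite.coe_toFinset]
    exact h3.symm.trans h2

/-- For a right-angled Artin group `G = G_Δ` on a finite graph, the untwisted `G'`-fibre
product `{(g₁,g₂) : g₁G' = g₂G'} ≤ G × G` is finitely presented iff `G` is abelian. -/
theorem raag_untwisted_fibre_product_fp_iff_abelian {V : Type*} [Fintype V]
    (Δ : SimpleGraph V) :
    FinitelyPresentedGroup
        ↥(fibreProduct (commutator (RAAG Δ)) (commutator (RAAG Δ))
          (MulEquiv.refl (RAAG Δ ⧸ commutator (RAAG Δ)))) ↔
      ∀ a b : RAAG Δ, a * b = b * a := by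
  refine ⟨fun h => ?_, raag_fp_of_comm Δ⟩
  have hadj := raag_adj_of_fp Δ h
  have hgen : ∀ x ∈ Set.range (PresentedGroup.of (rels := raagRels Δ)),
      ∀ y ∈ Set.range (PresentedGroup.of (rels := raagRels Δ)), x * y = y * x := by
    rintro _ ⟨u, rfl⟩ _ ⟨v, rfl⟩
    by_cases huv : u = v
    · rw [huv]
    · have : PresentedGroup.mk (raagRels Δ) (FreeGroup.of u * FreeGroup.of v *
          (FreeGroup.of u)⁻¹ * (FreeGroup.of v)⁻¹) = 1 :=
        PresentedGroup.one_of_mem ⟨u, v, hadj u v huv, rfl⟩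
      simp only [map_mul, map_inv] at this
      rw [mul_inv_eq_one, mul_inv_eq_iff_eq_mul] at this
      exact this
  have htop := PresentedGroup.closure_range_of (raagRels Δ)
  have hle : Subgroup.closure (Set.range (PresentedGroup.of (rels := raagRels Δ))) ≤
      Subgroup.centralizer (Set.range (PresentedGroup.of (rels := raagRels Δ))) := by
    rw [Subgroup.closure_le]
    intro x hx
    exact Subgroup.mem_centralizer_iff.2 fun y hy => hgen y hy x hx
  have hle2 : Subgroup.closure (Set.range (PresentedGroup.of (rels := raagRels Δ))) ≤
      Subgroup.centralizer (⊤ : Subgroup (PresentedGroup (raagRels Δ))) := by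
    rw [Subgroup.closure_le]
    intro x hx
    refine Subgroup.mem_centralizer_iff.2 fun y _ => ?_
    have hy : y ∈ Subgroup.closure (Set.range (PresentedGroup.of (rels := raagRels Δ))) := by
      rw [htop]; trivial
    exact (Subgroup.mem_centralizer_iff.1 (hle hy) x hx).symm
  rw [htop] at hle2
  intro a b
  exact Subgroup.mem_centralizer_iff.1 (hle2 (Subgroup.mem_top b)) a (Subgroup.mem_top a)
end
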